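/- Let k, l > 1 be integers. Then for every integer r with 1 ≤ r ≤ l, the 2r-th homotopy group of the frame space Fr^U_{k,l} is trivial, and the (2r−1)-st homotopy group of Fr^U_{k,l} is isomorphic to ℤ/kℤ. -/

import Mathlib

open Matrix Kronecker Topology

/-- The relation of lying in the same left coset of the subgroup
`H'_{k,l} = { 1_k ⊗ B : B ∈ U(l) }` of `U(kl)`,
where `M_{kl}(ℂ)` is realized with index type `Fin k × Fin l`. -/
def frameCosetRel (k l : ℕ) (x y : Matrix.unitaryGroup (Fin k × Fin l) ℂ) : Prop :=
  ∃ B ∈ Matrix.unitaryGroup (Fin l) ℂ,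
    (y : Matrix (Fin k × Fin l) (Fin k × Fin l) ℂ) =
      (x : Matrix (Fin k × Fin l) (Fin k × Fin l) ℂ) *
        ((1 : Matrix (Fin k) (Fin k) ℂ) ⊗ₖ B)

/-- The frame space `Fr^U_{k,l} = U(kl) / (1_k ⊗ U(l))`, the quotient topological
space of left cosets. -/
def FrU (k l : ℕ) : Type :=
  Quot (frameCosetRel k l)

instance (k l : ℕ) : TopologicalSpace (FrU k l) :=
  inferInstanceAs (TopologicalSpace (Quot (frameCosetRel k l)))

/-- The base point of `Fr^U_{k,l}`: the coset of the identity matrix. -/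
def FrU.pt (k l : ℕ) : FrU k l := Quot.mk _ 1

section Part1
open Matrix Kronecker Topology
namespace BP
open unitInterval

section basic
variable {X : Type} [TopologicalSpace X] {Y : Type} [TopologicalSpace Y]
variable {G : Type} [Group G] [TopologicalSpace G] [IsTopologicalGroup G]
variable {H : Type} [Group H] [TopologicalSpace H] [IsTopologicalGroup H]

/-- maps equal to `1` on `S`. -/
def Lp (S : Set X) (G : Type) [Group G] [TopologicalSpace G] [IsTopologicalGroup G] :
    Subgroup C(X, G) where
  carrier := {f | ∀ x ∈ S, f x = 1}
  mul_mem' := by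
    intro a b ha hb x hx
    simp [ha x hx, hb x hx]
  one_mem' := by intro x _; rfl
  inv_mem' := by
    intro a ha x hx
    simp [ha x hx]

/-- null-homotopic rel `S`. -/
def Nul (S : Set X) (G : Type) [Group G] [TopologicalSpace G] [IsTopologicalGroup G] :
    Subgroup C(X, G) where
  carrier := {f | ∃ K : C(X × I, G), (∀ x, K (x, 0) = 1) ∧ (∀ x, K (x, 1) = f x) ∧
    ∀ x ∈ S, ∀ t, K (x, t) = 1}
  mul_mem' := by
    rintro a b ⟨K, h1, h2, h3⟩ ⟨L, g1, g2, g3⟩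
    exact ⟨K * L, by simp [h1, g1], by simp [h2, g2],
      fun x hx t => by simp [h3 x hx t, g3 x hx t]⟩
  one_mem' := ⟨1, by simp, by simp, by simp⟩
  inv_mem' := by
    rintro a ⟨K, h1, h2, h3⟩
    exact ⟨K⁻¹, by simp [h1], by simp [h2], fun x hx t => by simp [h3 x hx t]⟩

theorem mem_Lp {S : Set X} {f : C(X, G)} : f ∈ Lp S G ↔ ∀ x ∈ S, f x = 1 := Iff.rfl

theorem mem_Nul {S : Set X} {f : C(X, G)} : f ∈ Nul S G ↔
    ∃ K : C(X × I, G), (∀ x, K (x, 0) = 1) ∧ (∀ x, K (x, 1) = f x) ∧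
    ∀ x ∈ S, ∀ t, K (x, t) = 1 := Iff.rfl

theorem Nul_le_Lp (S : Set X) : Nul S G ≤ Lp S G := by
  rintro f ⟨K, h1, h2, h3⟩ x hx
  rw [← h2, h3 x hx]

instance (S : Set X) : (Nul S G).Normal := by
  constructor
  rintro n ⟨K, h1, h2, h3⟩ g
  exact ⟨⟨fun p => g p.1 * K p * (g p.1)⁻¹, by fun_prop⟩, by simp [h1], by simp [h2],
    fun x hx t => by simp [h3 x hx t]⟩

/-- homotopic rel `S` -/
def Ht (S : Set X) (f g : C(X, G)) : Prop := f⁻¹ * g ∈ Nul S G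

theorem Ht.of_homotopy {S : Set X} {f g : C(X, G)} (K : C(X × I, G))
    (h0 : ∀ x, K (x, 0) = f x) (h1 : ∀ x, K (x, 1) = g x)
    (hS : ∀ x ∈ S, ∀ t, K (x, t) = f x) : Ht S f g :=
  ⟨⟨fun p => (f p.1)⁻¹ * K p, by fun_prop⟩, by simp [h0], by simp [h1],
    fun x hx t => by simp [hS x hx t]⟩

theorem Ht.exists_homotopy {S : Set X} {f g : C(X, G)} (h : Ht S f g) :
    ∃ K : C(X × I, G), (∀ x, K (x, 0) = f x) ∧ (∀ x, K (x, 1) = g x) ∧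
      (∀ x ∈ S, ∀ t, K (x, t) = f x) := by
  obtain ⟨K, h1, h2, h3⟩ := h
  exact ⟨⟨fun p => f p.1 * K p, by fun_prop⟩, by simp [h1], by simp [h2],
    fun x hx t => by simp [h3 x hx t]⟩

theorem Ht.refl (S : Set X) (f : C(X, G)) : Ht S f f := by
  simp [Ht, one_mem]

theorem Ht.symm {S : Set X} {f g : C(X, G)} (h : Ht S f g) : Ht S g f := by
  have := inv_mem h
  simpa [Ht] using this

theorem Ht.trans {S : Set X} {f g h : C(X, G)} (h1 : Ht S f g) (h2 : Ht S g h) : Ht S f h := by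
  have := mul_mem h1 h2
  simpa [Ht, mul_assoc] using this

theorem Ht.mul {S : Set X} {f g f' g' : C(X, G)} (h1 : Ht S f g) (h2 : Ht S f' g') :
    Ht S (f * f') (g * g') := by
  unfold Ht at *
  have h3 := (inferInstance : (Nul S G).Normal).conj_mem _ h1 f'⁻¹
  have := mul_mem h3 h2
  convert this using 1
  group

theorem Ht.inv {S : Set X} {f g : C(X, G)} (h1 : Ht S f g) : Ht S f⁻¹ g⁻¹ := by
  have h2 := h1.symm
  unfold Ht at *
  have h3 := (inferInstance : (Nul S G).Normal).conj_mem _ h2 g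
  convert h3 using 1
  group

theorem Ht.mono {S T : Set X} (hST : S ⊆ T) {f g : C(X, G)} (h : Ht T f g) : Ht S f g := by
  obtain ⟨K, h1, h2, h3⟩ := h
  exact ⟨K, h1, h2, fun x hx => h3 x (hST hx)⟩

theorem Ht.one_iff {S : Set X} {f : C(X, G)} : Ht S 1 f ↔ f ∈ Nul S G := by simp [Ht]

theorem Ht.iff_one {S : Set X} {f : C(X, G)} : Ht S f 1 ↔ f ∈ Nul S G := by simp [Ht]

theorem Ht.mem_Lp {S : Set X} {f g : C(X, G)} (h : Ht S f g) : f ∈ Lp S G ↔ g ∈ Lp S G := by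
  have := Nul_le_Lp S h
  constructor <;> intro hf x hx <;> have h2 := this x hx <;> have h3 := hf x hx <;>
   simp [h3] at h2 ⊢ <;> assumption

theorem Ht.mem_Nul {S : Set X} {f g : C(X, G)} (h : Ht S f g) : f ∈ Nul S G ↔ g ∈ Nul S G := by
  rw [← Ht.one_iff, ← Ht.one_iff]
  exact ⟨fun h1 => h1.trans h, fun h1 => h1.trans h.symm⟩

/-- postcomposition with a continuous hom -/
def pc (φ : G →* H) (hφ : Continuous φ) : C(X, G) →* C(X, H) where
  toFun f := ⟨fun x => φ (f x), by fun_prop⟩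
  map_one' := by ext; simp
  map_mul' := by intros; ext; simp

@[simp] theorem pc_apply (φ : G →* H) (hφ : Continuous φ) (f : C(X, G)) (x : X) :
    pc φ hφ f x = φ (f x) := rfl

theorem pc_Lp (φ : G →* H) (hφ : Continuous φ) {S : Set X} {f : C(X, G)} (hf : f ∈ Lp S G) :
    pc φ hφ f ∈ Lp S H := by
  intro x hx
  simp [hf x hx]

theorem pc_Nul (φ : G →* H) (hφ : Continuous φ) {S : Set X} {f : C(X, G)} (hf : f ∈ Nul S G) :
    pc φ hφ f ∈ Nul S H := by
  obtain ⟨K, h1, h2, h3⟩ := hf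
  exact ⟨pc φ hφ K, by simp [h1], by simp [h2], fun x hx t => by simp [h3 x hx t]⟩

theorem pc_Ht (φ : G →* H) (hφ : Continuous φ) {S : Set X} {f g : C(X, G)} (h : Ht S f g) :
    Ht S (pc φ hφ f) (pc φ hφ g) := by
  have := pc_Nul φ hφ h
  simpa [Ht] using this

/-- precomposition -/
def pre (p : C(X, Y)) : C(Y, G) →* C(X, G) where
  toFun f := f.comp p
  map_one' := by ext; simp
  map_mul' := by intros; ext; simp

@[simp] theorem pre_apply (p : C(X, Y)) (f : C(Y, G)) (x : X) : pre p f x = f (p x) := rfl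

theorem pre_Lp (p : C(X, Y)) {S : Set X} {T : Set Y} (hp : ∀ x ∈ S, p x ∈ T) {f : C(Y, G)}
    (hf : f ∈ Lp T G) : pre p f ∈ Lp S G := by
  intro x hx
  simp [hf _ (hp x hx)]

theorem pre_Nul (p : C(X, Y)) {S : Set X} {T : Set Y} (hp : ∀ x ∈ S, p x ∈ T) {f : C(Y, G)}
    (hf : f ∈ Nul T G) : pre p f ∈ Nul S G := by
  obtain ⟨K, h1, h2, h3⟩ := hf
  exact ⟨⟨fun q => K (p q.1, q.2), by fun_prop⟩, by simp [h1], by simp [h2],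
    fun x hx t => by simp [h3 _ (hp x hx) t]⟩

/-- boundary -/
def bd (S : Set X) : Set (X × I) := {p | p.1 ∈ S ∨ p.2 = 0 ∨ p.2 = 1}

/-- homotopy classes -/
abbrev A (S : Set X) (G : Type) [Group G] [TopologicalSpace G] [IsTopologicalGroup G] : Type :=
  Lp S G ⧸ (Nul S G).subgroupOf (Lp S G)

theorem A_eq {S : Set X} {f g : Lp S G} :
    (QuotientGroup.mk f : A S G) = QuotientGroup.mk g ↔ Ht S (f : C(X, G)) g := by
  rw [QuotientGroup.eq]
  rfl

theorem A_eq_one {S : Set X} {f : Lp S G} :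
    (QuotientGroup.mk f : A S G) = 1 ↔ (f : C(X, G)) ∈ Nul S G := by
  rw [QuotientGroup.eq_one_iff]
  rfl

theorem A_subsingleton {S : Set X} : Subsingleton (A S G) ↔ Lp S G ≤ Nul S G := by
  constructor
  · intro h f hf
    exact A_eq_one.1 (Subsingleton.elim (QuotientGroup.mk (⟨f, hf⟩ : Lp S G) : A S G) 1)
  · intro h
    refine subsingleton_of_forall_eq 1 ?_
    intro a
    induction a using QuotientGroup.induction_on with
    | H f => exact A_eq_one.2 (h f.2)

/-- induced map -/
def Amap (φ : G →* H) (hφ : Continuous φ) (S : Set X) : A S G →* A S H :=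
  QuotientGroup.map _ _ (((pc φ hφ).comp (Lp S G).subtype).codRestrict (Lp S H)
    (fun f => pc_Lp φ hφ f.2)) (by
      intro f hf
      exact pc_Nul φ hφ hf)

theorem Amap_mk (φ : G →* H) (hφ : Continuous φ) (S : Set X) (f : C(X, G)) (hf : f ∈ Lp S G) :
    Amap φ hφ S (QuotientGroup.mk ⟨f, hf⟩) = QuotientGroup.mk ⟨pc φ hφ f, pc_Lp φ hφ hf⟩ := rfl

/-- homeos -/
def Apre (p : X ≃ₜ Y) (S : Set X) (T : Set Y) (h : ∀ x, x ∈ S ↔ p x ∈ T) : A T G ≃* A S G where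
  toFun := QuotientGroup.map _ _ (((pre (p : C(X, Y))).comp (Lp T G).subtype).codRestrict (Lp S G)
    (fun f => pre_Lp _ (fun x hx => (h x).1 hx) f.2)) (by
      intro f hf
      exact pre_Nul _ (fun x hx => (h x).1 hx) hf)
  invFun := QuotientGroup.map _ _ (((pre (p.symm : C(Y, X))).comp (Lp S G).subtype).codRestrict
    (Lp T G) (fun f => pre_Lp _ (fun x hx => (h _).2 (by simpa using hx)) f.2)) (by
      intro f hf
      exact pre_Nul _ (fun x hx => (h _).2 (by simpa using hx)) hf)
  left_inv := by
    intro a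
    induction a using QuotientGroup.induction_on with
    | H f =>
      refine congrArg QuotientGroup.mk ?_
      ext x
      change f.1 (p (p.symm x)) = f.1 x
      simp
  right_inv := by
    intro a
    induction a using QuotientGroup.induction_on with
    | H f =>
      refine congrArg QuotientGroup.mk ?_
      ext x
      change f.1 (p.symm (p x)) = f.1 x
      simp
  map_mul' := map_mul _

end basic

section transport

theorem unif_step {X B : Type} [TopologicalSpace X] [CompactSpace X] [TopologicalSpace B]
    {W : Set (B × B)} (hW : IsOpen W) (hd : ∀ b, (b, b) ∈ W) (h : C(X × I, B)) :
    ∃ ε > (0 : ℝ), ∀ x (t t' : I), dist t t' < ε → (h (x, t), h (x, t')) ∈ W := by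
  let V : Set (X × (I × I)) := {p | (h (p.1, p.2.1), h (p.1, p.2.2)) ∈ W}
  have hV : IsOpen V := hW.preimage (by fun_prop)
  have hc := (isClosedMap_snd_of_compactSpace (X := X) (Y := I × I)) _ hV.isClosed_compl
  have ho : (Prod.snd '' Vᶜ)ᶜ ∈ 𝓝ˢ (Set.diagonal I) := by
    rw [mem_nhdsSet_iff_forall]
    rintro ⟨t, t'⟩ htt
    refine hc.isOpen_compl.mem_nhds ?_
    rintro ⟨⟨x, s⟩, hs, rfl⟩
    apply hs
    simp only [Set.mem_diagonal_iff] at htt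
    subst htt
    exact hd _
  rw [nhdsSet_diagonal_eq_uniformity, Metric.mem_uniformity_dist] at ho
  obtain ⟨ε, hε, h2⟩ := ho
  refine ⟨ε, hε, fun x t t' htt => ?_⟩
  have := h2 htt
  by_contra hcon
  exact this ⟨(x, (t, t')), hcon, rfl⟩

theorem transport {X B G : Type} [TopologicalSpace X] [CompactSpace X] [TopologicalSpace B]
    [Group G] [TopologicalSpace G] [IsTopologicalGroup G]
    (T : G → B → B → Prop) (hT1 : ∀ b, T 1 b b)
    (hTm : ∀ g g' b b' b'', T g b b' → T g' b' b'' → T (g' * g) b b'')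
    (W : Set (B × B)) (hW : IsOpen W) (hd : ∀ b, (b, b) ∈ W)
    (sg : B × B → G) (hs : ContinuousOn sg W) (hs1 : ∀ b, sg (b, b) = 1)
    (hsT : ∀ p ∈ W, T (sg p) p.1 p.2) (h : C(X × I, B)) :
    ∃ g : C(X × I, G), (∀ x, g (x, 0) = 1) ∧ (∀ x t, T (g (x, t)) (h (x, 0)) (h (x, t))) ∧
      ∀ x, (∀ t, h (x, t) = h (x, 0)) → ∀ t, g (x, t) = 1 := by
  obtain ⟨ε, hε, hst⟩ := unif_step hW hd h
  obtain ⟨N, hN⟩ := exists_nat_one_div_lt hε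
  let τ : ℕ → C(I, I) := fun j => ⟨fun t => Set.projIcc 0 1 zero_le_one (min (t : ℝ) (j / (N + 1 : ℝ))),
    by fun_prop⟩
  have hτv : ∀ j t, ((τ j t : I) : ℝ) = min (t : ℝ) (j / (N + 1 : ℝ)) := by
    intro j t
    simp only [τ, ContinuousMap.coe_mk]
    rw [Set.projIcc_of_mem]
    exact ⟨le_min t.2.1 (by positivity), (min_le_left _ _).trans t.2.2⟩
  have key : ∀ j : ℕ, ∃ g : C(X × I, G), (∀ x, g (x, 0) = 1) ∧
      (∀ x t, T (g (x, t)) (h (x, 0)) (h (x, τ j t))) ∧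
      ∀ x, (∀ t, h (x, t) = h (x, 0)) → ∀ t, g (x, t) = 1 := by
    intro j
    induction j with
    | zero =>
      refine ⟨1, by simp, ?_, by simp⟩
      intro x t
      have : τ 0 t = 0 := by
        apply Subtype.ext
        rw [hτv]
        simp [t.2.1]
      rw [this]
      exact hT1 _
    | succ j ih =>
      obtain ⟨g, g1, g2, g3⟩ := ih
      have hmem : ∀ x t, (h (x, τ j t), h (x, τ (j+1) t)) ∈ W := by
        intro x t
        apply hst
        refine lt_of_le_of_lt ?_ hN
        rw [Subtype.dist_eq, Real.dist_eq, hτv, hτv]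
        have : ((j + 1 : ℕ) : ℝ) / (N + 1 : ℝ) = j / (N + 1 : ℝ) + 1 / (N + 1 : ℝ) := by
          push_cast; ring
        rw [this]
        have hp : 0 < 1 / (N + 1 : ℝ) := by positivity
        rw [abs_le]
        constructor
        · have : min (t : ℝ) (j / (N + 1 : ℝ) + 1 / (N + 1 : ℝ)) ≤ 
            min (t : ℝ) (j / (N + 1 : ℝ)) + 1 / (N + 1 : ℝ) := by
            rcases min_cases (t : ℝ) (j / (N + 1 : ℝ)) with h | h <;>
            rcases min_cases (t : ℝ) (j / (N + 1 : ℝ) + 1 / (N + 1 : ℝ)) with h' | h' <;> linarith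
          linarith
        · have : min (t : ℝ) (j / (N + 1 : ℝ)) ≤ min (t : ℝ) (j / (N + 1 : ℝ) + 1 / (N + 1 : ℝ)) :=
            min_le_min le_rfl (by linarith)
          linarith
      refine ⟨⟨fun p => sg (h (p.1, τ j p.2), h (p.1, τ (j+1) p.2)) * g p, ?_⟩, ?_, ?_, ?_⟩
      · refine Continuous.mul ?_ g.continuous
        exact hs.comp_continuous (f := fun p : X × I => (h (p.1, τ j p.2), h (p.1, τ (j+1) p.2)))
          (by fun_prop) (fun p => hmem _ _)
      · intro x
        have h0 : ∀ j, τ j 0 = 0 := by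
          intro j
          apply Subtype.ext
          rw [hτv]
          simp
          positivity
        simp [h0, g1, hs1]
      · intro x t
        exact hTm _ _ _ _ _ (g2 x t) (hsT _ (hmem x t))
      · intro x hx t
        simp only [ContinuousMap.coe_mk]
        rw [g3 x hx, hx, hx (τ (j+1) t), hs1, mul_one]
  obtain ⟨g, g1, g2, g3⟩ := key (N + 1)
  refine ⟨g, g1, ?_, g3⟩
  intro x t
  have := g2 x t
  have h1 : τ (N + 1) t = t := by
    apply Subtype.ext
    rw [hτv]
    have : ((N + 1 : ℕ) : ℝ) / (N + 1 : ℝ) = 1 := by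
      push_cast
      exact div_self (by positivity)
    rw [this]
    simp [t.2.2]
  rwa [h1] at this

end transport
end BP
end Part1

section Part2
open Matrix Kronecker Topology
namespace BP
set_option linter.unusedSectionVars false
set_option linter.unusedSimpArgs false
noncomputable section
open unitInterval

section GLs
variable {X : Type} [TopologicalSpace X]
variable {ι : Type} [Fintype ι] [DecidableEq ι] {κ : Type} [Fintype κ] [DecidableEq κ]
variable {μ : Type} [Fintype μ] [DecidableEq μ]

theorem continuous_inv_mat {M : X → Matrix ι ι ℂ} (hM : Continuous M) (hu : ∀ x, IsUnit (M x)) :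
    Continuous fun x => (M x)⁻¹ := by
  have : (fun x => (M x)⁻¹) = fun x => ((M x).det)⁻¹ • (M x).adjugate := by
    ext1 x
    rw [Matrix.inv_def, Ring.inverse_eq_inv']
  rw [this]
  refine Continuous.smul (Continuous.inv₀ hM.matrix_det ?_) hM.matrix_adjugate
  intro x
  exact ((Matrix.isUnit_iff_isUnit_det _).1 (hu x)).ne_zero

/-- build maps into GL -/
def mkGL (M : X → Matrix ι ι ℂ) (hM : Continuous M) (hu : ∀ x, IsUnit (M x)) :
    C(X, GL ι ℂ) where
  toFun x := (hu x).unit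
  continuous_toFun := by
    rw [Units.continuous_iff]
    refine ⟨hM, ?_⟩
    convert continuous_inv_mat hM hu using 1
    ext1 x
    have h1 : (((hu x).unit⁻¹ : GL ι ℂ) : Matrix ι ι ℂ) = ((hu x).unit : Matrix ι ι ℂ)⁻¹ := by simp
    exact h1

@[simp] theorem mkGL_val (M : X → Matrix ι ι ℂ) (hM : Continuous M) (hu : ∀ x, IsUnit (M x))
    (x : X) : ((mkGL M hM hu x : GL ι ℂ) : Matrix ι ι ℂ) = M x := rfl

/-- coordinate inclusion matrix -/
def J (e : ι ↪ κ) : Matrix κ ι ℂ := fun a i => if a = e i then 1 else 0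

theorem JT_J (e : ι ↪ κ) : (J e)ᵀ * J e = 1 := by
  ext i j
  simp [J, Matrix.mul_apply, Matrix.one_apply, eq_comm]

theorem J_comp (e : ι ↪ κ) (e' : κ ↪ μ) : J (e.trans e') = J e' * J e := by
  ext i j
  simp [J, Matrix.mul_apply]

theorem J_mul_apply (e : ι ↪ κ) (M : Matrix ι μ ℂ) (i : ι) (j : μ) : (J e * M) (e i) j = M i j := by
  simp [J, Matrix.mul_apply]

theorem J_mul_apply' (e : ι ↪ κ) (M : Matrix ι μ ℂ) (a : κ) (j : μ) (ha : ∀ i, a ≠ e i) :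
    (J e * M) a j = 0 := by
  simp [J, Matrix.mul_apply, ha]

theorem mul_JT_apply (e : ι ↪ κ) (M : Matrix μ ι ℂ) (i : ι) (j : μ) : (M * (J e)ᵀ) j (e i) = M j i := by
  simp [J, Matrix.mul_apply]

theorem mul_JT_apply' (e : ι ↪ κ) (M : Matrix μ ι ℂ) (a : κ) (j : μ) (ha : ∀ i, a ≠ e i) :
    (M * (J e)ᵀ) j a = 0 := by
  simp [J, Matrix.mul_apply, ha]

/-- extension by the identity, matrices -/
def extM (e : ι ↪ κ) : Matrix ι ι ℂ →* Matrix κ κ ℂ where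
  toFun M := 1 + J e * (M - 1) * (J e)ᵀ
  map_one' := by simp
  map_mul' M N := by
    have h := JT_J e
    have : J e * (M - 1) * (J e)ᵀ * (J e * (N - 1) * (J e)ᵀ) =
        J e * (M - 1) * ((J e)ᵀ * J e) * (N - 1) * (J e)ᵀ := by simp only [Matrix.mul_assoc]
    rw [Matrix.add_mul, Matrix.mul_add, Matrix.mul_add (J e * (M - 1) * (J e)ᵀ), this, h]
    simp only [Matrix.mul_add, Matrix.add_mul, Matrix.mul_sub, Matrix.sub_mul, Matrix.mul_one,
      Matrix.one_mul, Matrix.mul_assoc]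
    abel

theorem extM_def (e : ι ↪ κ) (M : Matrix ι ι ℂ) : extM e M = 1 + J e * (M - 1) * (J e)ᵀ := rfl

theorem extM_apply (e : ι ↪ κ) (M : Matrix ι ι ℂ) (i j : ι) : extM e M (e i) (e j) = M i j := by
  rw [extM_def, Matrix.add_apply, mul_JT_apply, J_mul_apply]
  simp [Matrix.one_apply]

theorem extM_apply_left (e : ι ↪ κ) (M : Matrix ι ι ℂ) (a b : κ) (ha : ∀ i, a ≠ e i) :
    extM e M a b = (1 : Matrix κ κ ℂ) a b := by
  rw [extM_def, Matrix.add_apply, Matrix.mul_assoc, J_mul_apply' e _ a _ ha]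
  simp

theorem extM_apply_right (e : ι ↪ κ) (M : Matrix ι ι ℂ) (a b : κ) (hb : ∀ i, b ≠ e i) :
    extM e M a b = (1 : Matrix κ κ ℂ) a b := by
  rw [extM_def, Matrix.add_apply, mul_JT_apply' e _ b _ hb]
  simp

theorem extM_comp (e : ι ↪ κ) (e' : κ ↪ μ) (M : Matrix ι ι ℂ) :
    extM e' (extM e M) = extM (e.trans e') M := by
  simp only [extM_def, J_comp, Matrix.transpose_mul]
  congr 1
  rw [add_sub_cancel_left]
  simp only [Matrix.mul_assoc]

theorem extM_continuous (e : ι ↪ κ) : Continuous (extM e) := by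
  change Continuous fun M : Matrix ι ι ℂ => 1 + J e * (M - 1) * (J e)ᵀ
  fun_prop

theorem extM_inl {α β : Type} [Fintype α] [DecidableEq α] [Fintype β] [DecidableEq β]
    (M : Matrix α α ℂ) : extM (Function.Embedding.inl : α ↪ α ⊕ β) M = fromBlocks M 0 0 1 := by
  ext a b
  rcases a with a | a
  · rcases b with b | b
    · exact extM_apply Function.Embedding.inl M a b
    · rw [extM_apply_right _ _ _ _ (by simp)]
      simp [Matrix.one_apply]
  · rw [extM_apply_left _ _ _ _ (by simp)]
    rcases b with b | b <;> simp [Matrix.one_apply]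

theorem extM_inr {α β : Type} [Fintype α] [DecidableEq α] [Fintype β] [DecidableEq β]
    (M : Matrix β β ℂ) : extM (Function.Embedding.inr : β ↪ α ⊕ β) M = fromBlocks 1 0 0 M := by
  ext a b
  rcases a with a | a
  · rw [extM_apply_left _ _ _ _ (by simp)]
    rcases b with b | b <;> simp [Matrix.one_apply]
  · rcases b with b | b
    · rw [extM_apply_right _ _ _ _ (by simp)]
      simp [Matrix.one_apply]
    · exact extM_apply Function.Embedding.inr M a b

/-- extension by the identity -/
def ext (e : ι ↪ κ) : GL ι ℂ →* GL κ ℂ := Units.map (extM e)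

@[simp] theorem ext_val (e : ι ↪ κ) (g : GL ι ℂ) :
    ((ext e g : GL κ ℂ) : Matrix κ κ ℂ) = extM e (g : Matrix ι ι ℂ) := rfl

theorem ext_continuous (e : ι ↪ κ) : Continuous (ext e) :=
  Continuous.units_map _ (extM_continuous e)

theorem ext_comp (e : ι ↪ κ) (e' : κ ↪ μ) (g : GL ι ℂ) :
    ext e' (ext e g) = ext (e.trans e') g := by
  apply Units.ext
  simp [extM_comp]

/-- extension of families -/
def pe (e : ι ↪ κ) : C(X, GL ι ℂ) →* C(X, GL κ ℂ) := pc (ext e) (ext_continuous e)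

@[simp] theorem pe_apply (e : ι ↪ κ) (f : C(X, GL ι ℂ)) (x : X) : pe e f x = ext e (f x) := rfl

theorem pe_comp (e : ι ↪ κ) (e' : κ ↪ μ) (f : C(X, GL ι ℂ)) :
    pe e' (pe e f) = pe (e.trans e') f := by
  ext1 x
  simp [ext_comp]

theorem ext_injective (e : ι ↪ κ) : Function.Injective (ext e) := by
  intro f g h
  apply Units.ext
  ext i j
  have := congrArg (fun q : GL κ ℂ => (q : Matrix κ κ ℂ) (e i) (e j)) h
  simpa [extM_apply] using this

/-- GL is path connected -/
theorem GL_path (g : GL ι ℂ) : ∃ γ : C(I, GL ι ℂ), γ 0 = 1 ∧ γ 1 = g := by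
  let M : ℂ → Matrix ι ι ℂ := fun z => 1 + z • ((g : Matrix ι ι ℂ) - 1)
  let p : Polynomial ℂ := Matrix.det (1 + (Polynomial.X : Polynomial ℂ) •
    (((g : Matrix ι ι ℂ) - 1).map Polynomial.C))
  have hp : ∀ z, p.eval z = (M z).det := by
    intro z
    have := RingHom.map_det (Polynomial.evalRingHom z) (1 + (Polynomial.X : Polynomial ℂ) •
      (((g : Matrix ι ι ℂ) - 1).map Polynomial.C))
    change Polynomial.evalRingHom z p = _
    rw [this]
    congr 1
    ext i j
    by_cases h : i = j
    · simp [M, Matrix.one_apply, h]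
    · simp [M, Matrix.one_apply, h]
      ring
  have hp0 : p ≠ 0 := by
    intro h
    have := hp 0
    rw [h] at this
    simp [M] at this
  have hfin : (p.roots.toFinset : Set ℂ).Countable := p.roots.toFinset.countable_toSet
  have hpc := hfin.isPathConnected_compl_of_one_lt_rank (by
    rw [Complex.rank_real_complex]; norm_num)
  have hmem : ∀ z, z ∈ (p.roots.toFinset : Set ℂ)ᶜ ↔ IsUnit (M z) := by
    intro z
    rw [Matrix.isUnit_iff_isUnit_det, ← hp, isUnit_iff_ne_zero]
    simp [hp0]
  have h0 : (0 : ℂ) ∈ (p.roots.toFinset : Set ℂ)ᶜ := by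
    rw [hmem]; simp [M]
  have h1 : (1 : ℂ) ∈ (p.roots.toFinset : Set ℂ)ᶜ := by
    rw [hmem]; simp only [M]; simp
  obtain ⟨γ, hγ⟩ := hpc.joinedIn 0 h0 1 h1
  refine ⟨mkGL (fun t => M (γ t)) (by simp only [M]; fun_prop) (fun t => (hmem _).1 (hγ t)), ?_, ?_⟩
  · apply Units.ext
    simp [M]
  · apply Units.ext
    simp [M]

theorem conj_Ht (g : GL ι ℂ) {S : Set X} {f : C(X, GL ι ℂ)} (hf : f ∈ Lp S (GL ι ℂ)) :
    Ht S f ((ContinuousMap.const X g) * f * (ContinuousMap.const X g)⁻¹) := by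
  obtain ⟨γ, h0, h1⟩ := GL_path g
  refine Ht.of_homotopy ⟨fun p => γ p.2 * f p.1 * (γ p.2)⁻¹, by fun_prop⟩ ?_ ?_ ?_
  · intro x; simp [h0]
  · intro x; simp [h1]
  · intro x hx t; simp [hf x hx]

theorem exists_perm (e e' : ι ↪ κ) : ∃ π : Equiv.Perm κ, ∀ i, π (e i) = e' i := by
  classical
  let q := (Equiv.ofInjective e e.injective).symm.trans (Equiv.ofInjective e' e'.injective)
  refine ⟨q.extendSubtype, fun i => ?_⟩
  rw [Equiv.extendSubtype_apply_of_mem _ _ ⟨i, rfl⟩]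
  have : (⟨e i, ⟨i, rfl⟩⟩ : Set.range e) = Equiv.ofInjective e e.injective i := rfl
  simp only [q, Equiv.trans_apply]
  erw [this, Equiv.symm_apply_apply]
  rfl

theorem ext_conj (e e' : ι ↪ κ) : ∃ g : GL κ ℂ, ∀ f, ext e' f = g * ext e f * g⁻¹ := by
  obtain ⟨π, hπ⟩ := exists_perm e e'
  have h1 : (J π.toEmbedding : Matrix κ κ ℂ)ᵀ * J π.toEmbedding = 1 := JT_J _
  have h2 : J π.toEmbedding * (J π.toEmbedding : Matrix κ κ ℂ)ᵀ = 1 := mul_eq_one_comm.1 h1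
  refine ⟨⟨J π.toEmbedding, (J π.toEmbedding)ᵀ, h2, h1⟩, ?_⟩
  intro f
  have : e' = e.trans π.toEmbedding := by
    ext i; simp [hπ]
  apply Units.ext
  rw [this]
  simp only [ext_val, Units.val_mul, Units.inv_mk, extM_def, J_comp, Matrix.transpose_mul]
  rw [Matrix.mul_add, Matrix.add_mul, Matrix.mul_one, h2]
  congr 1
  simp only [Matrix.mul_assoc]

theorem pe_indep (e e' : ι ↪ κ) {S : Set X} {f : C(X, GL ι ℂ)} (hf : f ∈ Lp S (GL ι ℂ)) :
    Ht S (pe e f) (pe e' f) := by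
  obtain ⟨g, hg⟩ := ext_conj e e'
  have := conj_Ht g (pc_Lp (ext e) (ext_continuous e) hf)
  have h2 : pe e' f = ContinuousMap.const X g * pe e f * (ContinuousMap.const X g)⁻¹ := by
    ext1 x
    simp [hg]
  rw [h2]
  exact this

end GLs
end
end BP
end Part2

section Part3
open Matrix Kronecker Topology
namespace BP
set_option linter.unusedSectionVars false
set_option linter.unusedSimpArgs false
noncomputable section
open unitInterval

section dim

/-- general position -/
def DimLE (X : Type) [TopologicalSpace X] (n : ℕ) : Prop :=
  ∀ (E : Type) [NormedAddCommGroup E] [NormedSpace ℝ E] [FiniteDimensional ℝ E],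
    n < Module.finrank ℝ E → ∀ (u : C(X, E)) (ε : ℝ), 0 < ε →
      ∃ u' : C(X, E), (∀ x, u' x ≠ 0) ∧ ∀ x, ‖u' x - u x‖ < ε

theorem DimLE.of_homeo {X Y : Type} [TopologicalSpace X] [TopologicalSpace Y] (p : X ≃ₜ Y) {n : ℕ}
    (h : DimLE X n) : DimLE Y n := by
  intro E _ _ _ hE u ε hε
  obtain ⟨u', h1, h2⟩ := h E hE (u.comp (p : C(X, Y))) ε hε
  refine ⟨u'.comp (p.symm : C(Y, X)), fun x => h1 _, fun x => ?_⟩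
  have := h2 (p.symm x)
  simpa using this

theorem DimLE.mono {X : Type} [TopologicalSpace X] {n m : ℕ} (h : DimLE X n) (hnm : n ≤ m) :
    DimLE X m := fun E _ _ _ hE => h E (by omega)

theorem DimLE_cube (i : ℕ) : DimLE (Fin i → I) i := by
  intro E _ _ _ hE u ε hε
  let pr : (Fin i → ℝ) → (Fin i → I) := fun x j => Set.projIcc 0 1 zero_le_one (x j)
  have hpr : Continuous pr := by fun_prop
  obtain ⟨g, hg1, hg2⟩ := Continuous.exists_contDiff_approx (f := fun x => u (pr x)) 1
    (by fun_prop) (ε := fun _ => ε / 2) continuous_const (fun _ => by positivity)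
  have hd := ContDiff.dense_compl_range_of_finrank_lt_finrank (f := g) (by simpa using hg1)
    (by simpa using hE)
  obtain ⟨c, hc1, hc2⟩ := hd.exists_dist_lt 0 (half_pos hε)
  have hgc : Continuous g := hg1.continuous
  refine ⟨⟨fun x => g (fun j => (x j : ℝ)) - c, by fun_prop⟩, ?_, ?_⟩
  · intro x h
    exact hc1 ⟨_, sub_eq_zero.1 h⟩
  · intro x
    have h1 := hg2.1 (fun j => (x j : ℝ))
    have h2 : pr (fun j => (x j : ℝ)) = x := by
      ext j; simp [pr]
    rw [h2, dist_eq_norm] at h1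
    rw [dist_eq_norm, zero_sub, norm_neg] at hc2
    simp only [ContinuousMap.coe_mk]
    calc _ = ‖(g (fun j => (x j : ℝ)) - u x) - c‖ := by congr 1; abel
      _ ≤ _ := norm_sub_le _ _
      _ < ε := by linarith
end dim

section col
variable {X : Type} [TopologicalSpace X]
variable {ι : Type} [Fintype ι] [DecidableEq ι] {κ : Type} [Fintype κ] [DecidableEq κ]

open Classical in
/-- junk extension of unit -/
def glOf (M : Matrix ι ι ℂ) : GL ι ℂ := if h : IsUnit M then h.unit else 1

theorem glOf_val {M : Matrix ι ι ℂ} (h : IsUnit M) : ((glOf M : GL ι ℂ) : Matrix ι ι ℂ) = M := by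
  simp [glOf, h]

theorem glOf_one : glOf (1 : Matrix ι ι ℂ) = 1 := by
  apply Units.ext
  rw [glOf_val isUnit_one]
  rfl

theorem continuousOn_glOf {M : X → Matrix ι ι ℂ} {W : Set X} (hM : ContinuousOn M W)
    (hu : ∀ w ∈ W, IsUnit (M w)) : ContinuousOn (fun x => glOf (M x)) W := by
  rw [continuousOn_iff_continuous_domRestrict] at hM ⊢
  have hM' : Continuous (fun w : W => M w) := hM
  have := (mkGL (fun w : W => M w) hM' (fun w => hu w w.2)).continuous
  have h2 : (fun w : W => glOf (M w)) = (mkGL (fun w : W => M w) hM' (fun w => hu w w.2)) := by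
    ext1 w
    apply Units.ext
    rw [mkGL_val]
    exact glOf_val (hu w w.2)
  change Continuous (fun w : W => glOf (M w))
  rw [h2]
  exact this

/-- nonzero vectors -/
abbrev NZ (κ : Type) : Type := {v : κ → ℂ // v ≠ 0}

open ComplexOrder in
theorem NZ_pos (b : NZ κ) : star b.1 ⬝ᵥ b.1 ≠ 0 := by
  intro hb
  exact b.2 (dotProduct_star_self_eq_zero.1 hb)

theorem colMove [CompactSpace X] (S : Set X) (f : C(X, GL κ ℂ)) (c : κ) (h : C(X × I, κ → ℂ))
    (hn : ∀ p, h p ≠ 0) (h0 : ∀ x a, h (x, 0) a = (f x : Matrix κ κ ℂ) a c)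
    (hS : ∀ x ∈ S, ∀ t, h (x, t) = h (x, 0)) :
    ∃ f' : C(X, GL κ ℂ), Ht S f f' ∧ ∀ x a, (f' x : Matrix κ κ ℂ) a c = h (x, 1) a := by
  have hpos : ∀ b : NZ κ, star b.1 ⬝ᵥ b.1 ≠ 0 := NZ_pos
  let W : Set (NZ κ × NZ κ) := {p | star p.1.1 ⬝ᵥ p.2.1 ≠ 0}
  let M : NZ κ × NZ κ → Matrix κ κ ℂ := fun p =>
    1 + (star p.1.1 ⬝ᵥ p.1.1)⁻¹ • vecMulVec (p.2.1 - p.1.1) (star p.1.1)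
  have hMc : Continuous M := by
    have h1 : Continuous fun p : NZ κ × NZ κ => star p.1.1 ⬝ᵥ p.1.1 :=
      Continuous.dotProduct (by fun_prop) (by fun_prop)
    have h2 : Continuous fun p : NZ κ × NZ κ => vecMulVec (p.2.1 - p.1.1) (star p.1.1) :=
      Continuous.matrix_vecMulVec (by fun_prop) (by fun_prop)
    exact continuous_const.add ((h1.inv₀ (fun p => hpos _)).smul h2)
  have hMu : ∀ p ∈ W, IsUnit (M p) := by
    intro p hp
    rw [Matrix.isUnit_iff_isUnit_det]
    have : M p = 1 + vecMulVec ((star p.1.1 ⬝ᵥ p.1.1)⁻¹ • (p.2.1 - p.1.1)) (star p.1.1) := by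
      simp only [M]
      rw [smul_vecMulVec]
    rw [this, Matrix.vecMulVec_eq Unit, Matrix.det_one_add_replicateCol_mul_replicateRow,
      dotProduct_smul, dotProduct_sub, smul_sub, smul_eq_mul, smul_eq_mul, inv_mul_cancel₀ (hpos _)]
    simp only [isUnit_iff_ne_zero]
    have h1 := hpos p.1
    have h2 : star p.1.1 ⬝ᵥ p.2.1 ≠ 0 := hp
    rw [add_sub_cancel]
    exact mul_ne_zero (inv_ne_zero h1) h2
  have hMm : ∀ p, M p *ᵥ p.1.1 = p.2.1 := by
    intro p
    simp only [M]
    rw [Matrix.add_mulVec, Matrix.one_mulVec, Matrix.smul_mulVec, Matrix.vecMulVec_mulVec]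
    ext a
    simp
    have h1 := hpos p.1
    field_simp
    ring
  obtain ⟨g, g1, g2, g3⟩ := transport (X := X) (B := NZ κ) (G := GL κ ℂ)
    (fun g b b' => (g : Matrix κ κ ℂ) *ᵥ b.1 = b'.1) (by simp)
    (by
      intro g g' b b' b'' h h'
      simp only [Units.val_mul]
      rw [← Matrix.mulVec_mulVec, h, h'])
    W (isOpen_ne_fun (Continuous.dotProduct (by fun_prop) (by fun_prop)) continuous_const) (fun b => hpos b)
    (fun p => glOf (M p)) (continuousOn_glOf hMc.continuousOn hMu)
    (by intro b; simp only [M]; rw [sub_self, zero_vecMulVec, smul_zero, add_zero, glOf_one])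
    (by
      intro p hp
      rw [glOf_val (hMu p hp)]
      exact hMm p)
    ⟨fun p => ⟨h p, hn p⟩, by fun_prop⟩
  have hcol : ∀ x t a, ((g (x, t) * f x : GL κ ℂ) : Matrix κ κ ℂ) a c = h (x, t) a := by
    intro x t a
    have := congrFun (g2 x t) a
    simp only [ContinuousMap.coe_mk] at this
    rw [← this]
    simp only [Units.val_mul, Matrix.mul_apply, Matrix.mulVec, dotProduct, h0]
  refine ⟨⟨fun x => g (x, 1) * f x, by fun_prop⟩, ?_, fun x a => hcol x 1 a⟩
  refine Ht.of_homotopy ⟨fun p => g p * f p.1, by fun_prop⟩ ?_ ?_ ?_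
  · intro x; simp [g1]
  · intro x; rfl
  · intro x hx t
    simp only [ContinuousMap.coe_mk]
    rw [g3 x (by intro t; exact Subtype.ext (hS x hx t)), one_mul]

theorem isUnit_of_extM (e : ι ↪ κ) {M : Matrix ι ι ℂ} (h : IsUnit (extM e M)) : IsUnit M := by
  obtain ⟨g, hg⟩ := h
  have h1 : (J e)ᵀ * extM e M = M * (J e)ᵀ := by
    rw [extM_def, Matrix.mul_add, Matrix.mul_one, ← Matrix.mul_assoc, ← Matrix.mul_assoc, JT_J,
      Matrix.one_mul, Matrix.sub_mul, Matrix.one_mul]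
    abel
  have h2 : M * ((J e)ᵀ * ((g⁻¹ : GL κ ℂ) : Matrix κ κ ℂ) * J e) = 1 := by
    calc _ = (M * (J e)ᵀ) * ((g⁻¹ : GL κ ℂ) : Matrix κ κ ℂ) * J e := by simp only [Matrix.mul_assoc]
      _ = (J e)ᵀ * (extM e M * ((g⁻¹ : GL κ ℂ) : Matrix κ κ ℂ)) * J e := by
        rw [← h1]; simp only [Matrix.mul_assoc]
      _ = 1 := by
        rw [← hg, Units.mul_inv, Matrix.mul_one, JT_J]
  exact IsUnit.of_mul_eq_one _ h2

theorem of_extM (e : ι ↪ κ) (f : C(X, GL κ ℂ))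
    (h : ∀ x, ∃ M : Matrix ι ι ℂ, (f x : Matrix κ κ ℂ) = extM e M) :
    ∃ g : C(X, GL ι ℂ), f = pe e g := by
  have h1 : ∀ x, (f x : Matrix κ κ ℂ) = extM e ((f x : Matrix κ κ ℂ).submatrix e e) := by
    intro x
    obtain ⟨M, hM⟩ := h x
    have : M = (f x : Matrix κ κ ℂ).submatrix e e := by
      ext i j
      rw [hM, submatrix_apply, extM_apply]
    rw [← this, hM]
  refine ⟨mkGL (fun x => (f x : Matrix κ κ ℂ).submatrix e e) ?_ ?_, ?_⟩
  · exact Continuous.matrix_submatrix (by fun_prop) _ _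
  · intro x
    apply isUnit_of_extM e
    rw [← h1]
    exact (f x).isUnit
  · ext1 x
    apply Units.ext
    simp only [pe_apply, ext_val, mkGL_val]
    exact h1 x

theorem eq_extM_some {M : Matrix (Option ι) (Option ι) ℂ}
    (h1 : ∀ a, M a none = (1 : Matrix (Option ι) (Option ι) ℂ) a none)
    (h2 : ∀ a, M none a = (1 : Matrix (Option ι) (Option ι) ℂ) none a) :
    M = extM Function.Embedding.some (M.submatrix some some) := by
  ext a b
  rcases a with _ | a
  · rw [extM_apply_left _ _ _ _ (by simp), h2]
  · rcases b with _ | b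
    · rw [extM_apply_right _ _ _ _ (by simp), h1]
    · rw [show (some a : Option ι) = Function.Embedding.some a from rfl,
        show (some b : Option ι) = Function.Embedding.some b from rfl, extM_apply]
      rfl

/-- last step of the reduction -/
theorem rowKill (S : Set X) (f : C(X, GL (Option ι) ℂ))
    (hc : ∀ x a, (f x : Matrix (Option ι) (Option ι) ℂ) a none =
      (1 : Matrix (Option ι) (Option ι) ℂ) a none)
    (hS : ∀ x ∈ S, ∀ a, (f x : Matrix (Option ι) (Option ι) ℂ) none a =
      (1 : Matrix (Option ι) (Option ι) ℂ) none a) :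
    ∃ g : C(X, GL ι ℂ), Ht S f (pe Function.Embedding.some g) := by
  let r : X → Option ι → ℂ := fun x a => (f x : Matrix (Option ι) (Option ι) ℂ) none a -
    (1 : Matrix (Option ι) (Option ι) ℂ) none a
  have hr : Continuous r := by
    refine continuous_pi fun a => Continuous.sub ?_ continuous_const
    exact Continuous.matrix_elem (by fun_prop) _ _
  have hr0 : ∀ x, r x none = 0 := by intro x; simp [r, hc]
  let e : Option ι → ℂ := Pi.single none 1
  let N : X × I → Matrix (Option ι) (Option ι) ℂ := fun p =>
    1 - ((p.2 : ℝ) : ℂ) • vecMulVec e (r p.1)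
  have hNc : Continuous N := by
    have h1 : Continuous fun p : X × I => ((p.2 : ℝ) : ℂ) := by fun_prop
    have h2 : Continuous fun p : X × I => vecMulVec e (r p.1) :=
      Continuous.matrix_vecMulVec (by fun_prop) (by fun_prop)
    exact continuous_const.sub (h1.smul h2)
  have hre : ∀ x, r x ⬝ᵥ e = 0 := by intro x; simp [e, hr0]
  have hNu : ∀ p, IsUnit (N p) := by
    intro p
    refine IsUnit.of_mul_eq_one (1 + ((p.2 : ℝ) : ℂ) • vecMulVec e (r p.1)) ?_
    have : vecMulVec e (r p.1) * vecMulVec e (r p.1) = 0 := by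
      rw [vecMulVec_mul_vecMulVec, hre]
      simp
    simp only [N]
    rw [Matrix.mul_add, Matrix.sub_mul]
    simp [this, Matrix.sub_mul]
  have hfe : ∀ x, (f x : Matrix (Option ι) (Option ι) ℂ) *ᵥ e = e := by
    intro x
    ext a
    simp only [e, mulVec_single_one, Matrix.col_apply, hc]
    simp [Matrix.one_apply, Pi.single_apply]
  let K : C(X × I, GL (Option ι) ℂ) := ⟨fun p => f p.1 * mkGL N hNc hNu p, by fun_prop⟩
  have hK : ∀ p, (K p : Matrix (Option ι) (Option ι) ℂ) = (f p.1 : Matrix (Option ι) (Option ι) ℂ)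
      - ((p.2 : ℝ) : ℂ) • vecMulVec e (r p.1) := by
    intro p
    simp only [K, ContinuousMap.coe_mk, Units.val_mul, mkGL_val, N]
    rw [Matrix.mul_sub, Matrix.mul_one, Matrix.mul_smul, Matrix.mul_vecMulVec, hfe]
  obtain ⟨g, hg⟩ := of_extM (Function.Embedding.some : ι ↪ Option ι)
    (⟨fun x => K (x, 1), by fun_prop⟩ : C(X, GL (Option ι) ℂ)) (by
      intro x
      refine ⟨_, eq_extM_some ?_ ?_⟩
      · intro a
        simp [hK, vecMulVec_apply, hr0, hc]
      · intro a
        simp [hK, vecMulVec_apply, e, r])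
  refine ⟨g, ?_⟩
  rw [← hg]
  refine Ht.of_homotopy K ?_ ?_ ?_
  · intro x
    apply Units.ext
    simp [hK]
  · intro x; rfl
  · intro x hx t
    apply Units.ext
    rw [hK]
    have : r x = 0 := by
      ext a; simp [r, hS x hx]
    rw [this, vecMulVec_zero, smul_zero, sub_zero]

end col
end
end BP
end Part3

section Part4
open Matrix Kronecker Topology
namespace BP
set_option linter.unusedSectionVars false
set_option linter.unusedSimpArgs false
noncomputable section
open unitInterval

section stab
variable {X : Type} [TopologicalSpace X]
variable {ι : Type} [Fintype ι] [DecidableEq ι] {κ : Type} [Fintype κ] [DecidableEq κ]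

/-- drop the real part of the last coordinate -/
def qv (v : Option ι → ℂ) : (ι → ℂ) × ℝ := (fun i => v (some i), (v none).im)

/-- put it back -/
def lf (r : ℝ) (w : (ι → ℂ) × ℝ) : Option ι → ℂ := fun a => a.elim (⟨r, w.2⟩ : ℂ) w.1

theorem lf_qv (v : Option ι → ℂ) : lf (v none).re (qv v) = v := by
  ext a
  rcases a with _ | a <;> rfl

theorem lf_eq_zero {r : ℝ} {w : (ι → ℂ) × ℝ} : lf r w = 0 ↔ r = 0 ∧ w = 0 := by
  constructor
  · intro h
    have h1 := congrFun h none
    have h2 : ∀ i, w.1 i = 0 := fun i => congrFun h (some i)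
    rw [Complex.ext_iff] at h1
    exact ⟨h1.1, Prod.ext (funext h2) h1.2⟩
  · rintro ⟨rfl, rfl⟩
    ext a
    rcases a with _ | a
    · rfl
    · rfl

theorem continuous_qv : Continuous (qv : (Option ι → ℂ) → (ι → ℂ) × ℝ) := by
  unfold qv
  fun_prop

theorem continuous_lf : Continuous (fun p : ℝ × ((ι → ℂ) × ℝ) => lf p.1 p.2) := by
  refine continuous_pi fun a => ?_
  rcases a with _ | a
  · have : (fun p : ℝ × ((ι → ℂ) × ℝ) => lf p.1 p.2 none) =
      fun p : ℝ × ((ι → ℂ) × ℝ) => ((p.1 : ℂ) + (p.2.2 : ℂ) * Complex.I) := by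
      ext1 p
      exact Complex.mk_eq_add_mul_I _ _
    rw [this]
    fun_prop
  · have : (fun p : ℝ × ((ι → ℂ) × ℝ) => lf p.1 p.2 (some a)) = fun p => p.2.1 a := rfl
    rw [this]
    fun_prop

theorem finrank_E : Module.finrank ℝ ((ι → ℂ) × ℝ) = 2 * Fintype.card ι + 1 := by
  rw [Module.finrank_prod, Module.finrank_pi_fintype]
  simp [Complex.finrank_real_complex, mul_comm]

theorem reduce [CompactSpace X] {n : ℕ} (hX : DimLE X n) (hn : n ≤ 2 * Fintype.card ι) (S : Set X)
    (f : C(X, GL (Option ι) ℂ))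
    (hS : ∀ x ∈ S, ∃ g : GL ι ℂ, f x = ext Function.Embedding.some g) :
    ∃ g : C(X, GL ι ℂ), Ht S f (pe Function.Embedding.some g) := by
  let v : C(X, Option ι → ℂ) := ⟨fun x a => (f x : Matrix (Option ι) (Option ι) ℂ) a none, by
    refine continuous_pi fun a => ?_
    exact Continuous.matrix_elem (by fun_prop) _ _⟩
  have hv0 : ∀ x, v x ≠ 0 := by
    intro x h
    have h1 : (f x : Matrix (Option ι) (Option ι) ℂ) *ᵥ (Pi.single none 1) = 0 := by
      rw [mulVec_single_one]
      exact h
    have h2 := congrArg (fun w => ((f x)⁻¹ : GL (Option ι) ℂ).1 *ᵥ w) h1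
    simp only [Matrix.mulVec_mulVec, Matrix.mulVec_zero, Units.inv_mul, Matrix.one_mulVec] at h2
    have := congrFun h2 none
    simp at this
  have hvS : ∀ x ∈ S, v x = lf 1 0 := by
    intro x hx
    obtain ⟨g, hg⟩ := hS x hx
    ext a
    simp only [v, ContinuousMap.coe_mk, hg, ext_val]
    rw [extM_apply_right _ _ _ _ (by simp)]
    rcases a with _ | a
    · simp [lf]; rfl
    · simp [lf]
  -- lower bound where the real part vanishes
  obtain ⟨δ, hδ, hδ2⟩ : ∃ δ > 0, ∀ x, (v x none).re = 0 → δ ≤ ‖qv (v x)‖ := by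
    let Z : Set X := {x | (v x none).re = 0}
    have hZ : IsCompact Z := by
      apply IsClosed.isCompact
      exact isClosed_eq (by fun_prop) continuous_const
    have hc : Continuous fun x => ‖qv (v x)‖ := (continuous_qv.comp v.continuous).norm
    rcases Z.eq_empty_or_nonempty with hZe | hZn
    · refine ⟨1, one_pos, fun x hx => ?_⟩
      have : x ∈ Z := hx
      rw [hZe] at this
      exact this.elim
    · obtain ⟨x0, hx0, hmin⟩ := hZ.exists_isMinOn hZn hc.continuousOn
      refine ⟨‖qv (v x0)‖, ?_, fun x hx => hmin hx⟩
      rw [gt_iff_lt, norm_pos_iff]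
      intro h
      have h3 := lf_qv (v x0)
      rw [h, show (v x0 none).re = 0 from hx0] at h3
      exact hv0 x0 (h3.symm.trans (lf_eq_zero.2 ⟨rfl, rfl⟩))
  obtain ⟨u', hu1, hu2⟩ := hX ((ι → ℂ) × ℝ) (by rw [finrank_E]; omega)
    ⟨fun x => qv (v x), continuous_qv.comp v.continuous⟩ δ hδ
  simp only [ContinuousMap.coe_mk] at hu2
  let χ : X → ℝ := fun x => max 0 (min 1 (2 - 3 * (v x none).re))
  have hχc : Continuous χ := by simp only [χ]; fun_prop
  have hχ0 : ∀ x, 0 ≤ χ x := fun x => le_max_left _ _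
  have hχ1 : ∀ x, χ x ≤ 1 := fun x => max_le zero_le_one (min_le_left _ _)
  have hχa : ∀ x, (v x none).re ≤ 0 → χ x = 1 := by
    intro x hx
    simp only [χ]
    rw [min_eq_left (by linarith), max_eq_right zero_le_one]
  have hχS : ∀ x ∈ S, χ x = 0 := by
    intro x hx
    have : (v x none).re = 1 := by rw [hvS x hx]; rfl
    simp only [χ, this]
    norm_num
  -- first move
  let d : X → (ι → ℂ) × ℝ := fun x => χ x • (u' x - qv (v x))
  have hqc : Continuous fun x => qv (v x) := continuous_qv.comp v.continuous
  have hdc : Continuous d := by simp only [d]; fun_prop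
  let h1 : C(X × I, Option ι → ℂ) := ⟨fun p => lf (v p.1 none).re (qv (v p.1) + (p.2 : ℝ) • d p.1), by
    refine continuous_lf.comp (Continuous.prodMk (by fun_prop) ?_)
    have h9 : Continuous fun p : X × I => (p.2 : ℝ) := by fun_prop
    exact (hqc.comp continuous_fst).add (h9.smul (hdc.comp continuous_fst))⟩
  obtain ⟨f1, hf1, hf1c⟩ := colMove S f none h1 (by
      rintro ⟨x, t⟩ h
      simp only [h1, ContinuousMap.coe_mk, lf_eq_zero] at h
      obtain ⟨ha, hb⟩ := h
      have h2 := hδ2 x ha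
      have h3 := hu2 x
      rw [eq_neg_of_add_eq_zero_left hb, norm_neg, norm_smul] at h2
      simp only [d] at h2
      rw [hχa x ha.le, one_smul, Real.norm_eq_abs, abs_of_nonneg t.2.1] at h2
      have h4 : (t : ℝ) * ‖u' x - qv (v x)‖ ≤ 1 * ‖u' x - qv (v x)‖ :=
        mul_le_mul_of_nonneg_right t.2.2 (norm_nonneg _)
      linarith)
    (by
      intro x a
      simp only [h1, ContinuousMap.coe_mk, Set.Icc.coe_zero, zero_smul, add_zero, lf_qv]
      rfl)
    (by
      intro x hx t
      simp only [h1, ContinuousMap.coe_mk, d, hχS x hx, zero_smul, smul_zero])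
  -- second move
  let w : X → (ι → ℂ) × ℝ := fun x => qv (v x) + d x
  have hwc : Continuous w := hqc.add hdc
  have hwS : ∀ x ∈ S, w x = 0 := by
    intro x hx
    simp only [w, d, hχS x hx, hvS x hx, zero_smul, add_zero]
    rfl
  let h2 : C(X × I, Option ι → ℂ) := ⟨fun p =>
      lf ((1 - (p.2 : ℝ)) * (v p.1 none).re + p.2) ((1 - (p.2 : ℝ)) • w p.1), by
    refine continuous_lf.comp (Continuous.prodMk (by fun_prop) ?_)
    have h9 : Continuous fun p : X × I => 1 - (p.2 : ℝ) := by fun_prop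
    exact h9.smul (hwc.comp continuous_fst)⟩
  obtain ⟨f2, hf2, hf2c⟩ := colMove S f1 none h2 (by
      rintro ⟨x, t⟩ h
      simp only [h2, ContinuousMap.coe_mk, lf_eq_zero] at h
      obtain ⟨ha, hb⟩ := h
      have t0 : (0 : ℝ) ≤ t := t.2.1
      have t1 : (t : ℝ) ≤ 1 := t.2.2
      have ht : (t : ℝ) ≠ 1 := by
        intro ht
        rw [ht] at ha
        norm_num at ha
      have ht' : 0 < 1 - (t : ℝ) := by
        have := lt_of_le_of_ne t1 ht
        linarith
      have hre : (v x none).re ≤ 0 := by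
        by_contra hcon
        push Not at hcon
        have := mul_pos ht' hcon
        linarith
      rcases smul_eq_zero.1 hb with hb | hb
      · linarith
      · simp only [w, d, hχa x hre, one_smul, add_sub_cancel] at hb
        exact hu1 x hb)
    (by
      intro x a
      rw [hf1c]
      simp [h1, h2, w])
    (by
      intro x hx t
      have : (v x none).re = 1 := by rw [hvS x hx]; rfl
      simp [h2, hwS x hx, this])
  have hS2 : ∀ x ∈ S, f2 x = f x := by
    intro x hx
    have := Nul_le_Lp _ (hf1.trans hf2) x hx
    simp only [ContinuousMap.mul_apply, ContinuousMap.inv_apply] at this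
    exact (inv_mul_eq_one.1 this).symm
  obtain ⟨g, hg⟩ := rowKill S f2 (by
      intro x a
      rw [hf2c]
      simp only [h2, ContinuousMap.coe_mk, Set.Icc.coe_one]
      rcases a with _ | a
      · simp [lf]; rfl
      · simp [lf])
    (by
      intro x hx a
      obtain ⟨g, hg⟩ := hS x hx
      rw [hS2 x hx, hg, ext_val, extM_apply_left _ _ _ _ (by simp)])
  exact ⟨g, (hf1.trans hf2).trans hg⟩

theorem Ht.apply_eq {G : Type} [Group G] [TopologicalSpace G] [IsTopologicalGroup G]
    {S : Set X} {f g : C(X, G)} (h : Ht S f g) {x : X} (hx : x ∈ S) :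
    f x = g x := by
  have := Nul_le_Lp _ h x hx
  simp only [ContinuousMap.mul_apply, ContinuousMap.inv_apply] at this
  exact (inv_mul_eq_one.1 this)

theorem one_surj [CompactSpace X] {n : ℕ} (hX : DimLE X n) (hn : n ≤ 2 * Fintype.card ι) (S : Set X)
    (f : C(X, GL (Option ι) ℂ)) (hf : f ∈ Lp S _) :
    ∃ g ∈ Lp S (GL ι ℂ), Ht S f (pe Function.Embedding.some g) := by
  obtain ⟨g, hg⟩ := reduce hX hn S f (fun x hx => ⟨1, by rw [hf x hx, map_one]⟩)
  refine ⟨g, ?_, hg⟩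
  intro x hx
  have := hg.apply_eq hx
  rw [hf x hx] at this
  apply ext_injective (Function.Embedding.some)
  rw [map_one, this]
  rfl

theorem one_inj [CompactSpace X] {n : ℕ} (hX : DimLE (X × I) n) (hn : n ≤ 2 * Fintype.card ι)
    (S : Set X) (f : C(X, GL ι ℂ)) (hf : f ∈ Lp S _)
    (h : pe Function.Embedding.some f ∈ Nul S (GL (Option ι) ℂ)) : f ∈ Nul S (GL ι ℂ) := by
  obtain ⟨K, h1, h2, h3⟩ := h
  obtain ⟨g, hg⟩ := reduce hX hn (bd S) K (by
    rintro ⟨x, t⟩ hx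
    rcases hx with hx | hx | hx
    · exact ⟨1, by rw [h3 x hx, map_one]⟩
    · simp only at hx; subst hx
      exact ⟨1, by rw [h1, map_one]⟩
    · simp only at hx; subst hx
      exact ⟨f x, by rw [h2]; rfl⟩)
  refine ⟨g, ?_, ?_, ?_⟩
  · intro x
    have := hg.apply_eq (x := (x, 0)) (Or.inr (Or.inl rfl))
    apply ext_injective (Function.Embedding.some)
    rw [map_one, ← h1 x, this]
    rfl
  · intro x
    have := hg.apply_eq (x := (x, 1)) (Or.inr (Or.inr rfl))
    apply ext_injective (Function.Embedding.some)
    change _ = pe Function.Embedding.some f x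
    rw [← h2 x, this]
    rfl
  · intro x hx t
    have := hg.apply_eq (x := (x, t)) (Or.inl hx)
    apply ext_injective (Function.Embedding.some)
    rw [map_one, ← h3 x hx t, this]
    rfl

theorem ext_refl (g : GL ι ℂ) : ext (Function.Embedding.refl ι) g = g := by
  apply Units.ext
  ext i j
  exact extM_apply (Function.Embedding.refl ι) _ i j

theorem pe_equiv (e : ι ≃ κ) (f : C(X, GL κ ℂ)) :
    pe e.toEmbedding (pe e.symm.toEmbedding f) = f := by
  rw [pe_comp]
  ext1 x
  have : e.symm.toEmbedding.trans e.toEmbedding = Function.Embedding.refl κ := by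
    ext; simp
  rw [pe_apply, this, ext_refl]

theorem pe_Lp (e : ι ↪ κ) {S : Set X} {f : C(X, GL ι ℂ)} (hf : f ∈ Lp S _) :
    pe e f ∈ Lp S (GL κ ℂ) := pc_Lp _ _ hf

theorem pe_Nul (e : ι ↪ κ) {S : Set X} {f : C(X, GL ι ℂ)} (hf : f ∈ Nul S _) :
    pe e f ∈ Nul S (GL κ ℂ) := pc_Nul _ _ hf

theorem pe_Ht (e : ι ↪ κ) {S : Set X} {f g : C(X, GL ι ℂ)} (hf : Ht S f g) :
    Ht S (pe e f) (pe e g) := pc_Ht _ _ hf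

theorem stab_aux [CompactSpace X] {n : ℕ} (S : Set X) : ∀ (d : ℕ) (ι κ : Type) [Fintype ι]
    [DecidableEq ι] [Fintype κ] [DecidableEq κ] (e : ι ↪ κ),
    Fintype.card κ = Fintype.card ι + d → n ≤ 2 * Fintype.card ι →
    (DimLE X n → ∀ f ∈ Lp S (GL κ ℂ), ∃ g ∈ Lp S (GL ι ℂ), Ht S f (pe e g)) ∧
    (DimLE (X × I) n → ∀ f ∈ Lp S (GL ι ℂ), pe e f ∈ Nul S (GL κ ℂ) → f ∈ Nul S (GL ι ℂ)) := by
  intro d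
  induction d with
  | zero =>
    intro ι κ _ _ _ _ e hd hn
    have hb : Function.Bijective e :=
      (Fintype.bijective_iff_injective_and_card e).2 ⟨e.injective, by omega⟩
    let q : ι ≃ κ := Equiv.ofBijective e hb
    have hq : e = q.toEmbedding := by ext i; rfl
    constructor
    · intro _ f hf
      refine ⟨pe q.symm.toEmbedding f, pe_Lp _ hf, ?_⟩
      rw [hq, pe_equiv]
      exact Ht.refl _ _
    · intro _ f hf hfe
      have := pe_Nul q.symm.toEmbedding hfe
      have h5 := pe_equiv q.symm f
      rw [Equiv.symm_symm] at h5
      rwa [hq, h5] at this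
  | succ d ih =>
    intro ι κ _ _ _ _ e hd hn
    have hns : ¬ Function.Surjective e := by
      intro h
      have := Fintype.card_le_of_surjective _ h
      omega
    simp only [Function.Surjective, not_forall] at hns
    obtain ⟨a, ha⟩ := hns
    let e' : Option ι ↪ κ := Function.Embedding.optionElim e a (by simpa using ha)
    have he : e = Function.Embedding.some.trans e' := by ext i; rfl
    obtain ⟨ih1, ih2⟩ := ih (Option ι) κ e' (by rw [Fintype.card_option]; omega)
      (by rw [Fintype.card_option]; omega)
    constructor
    · intro hX f hf
      obtain ⟨g, hg, hfg⟩ := ih1 hX f hf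
      obtain ⟨g', hg', hgg⟩ := one_surj hX hn S g hg
      refine ⟨g', hg', hfg.trans ?_⟩
      rw [he, ← pe_comp]
      exact pe_Ht _ hgg
    · intro hX f hf hfe
      rw [he, ← pe_comp] at hfe
      exact one_inj hX hn S f hf (ih2 hX _ (pe_Lp _ hf) hfe)

theorem stab_surj [CompactSpace X] {n : ℕ} (hX : DimLE X n) (e : ι ↪ κ)
    (hn : n ≤ 2 * Fintype.card ι) {S : Set X} {f : C(X, GL κ ℂ)} (hf : f ∈ Lp S _) :
    ∃ g ∈ Lp S (GL ι ℂ), Ht S f (pe e g) :=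
  (stab_aux S (Fintype.card κ - Fintype.card ι) ι κ e
    (by have := Fintype.card_le_of_embedding e; omega) hn).1 hX f hf

theorem stab_inj [CompactSpace X] {n : ℕ} (hX : DimLE (X × I) n) (e : ι ↪ κ)
    (hn : n ≤ 2 * Fintype.card ι) {S : Set X} {f : C(X, GL ι ℂ)} (hf : f ∈ Lp S _)
    (h : pe e f ∈ Nul S _) : f ∈ Nul S (GL ι ℂ) :=
  (stab_aux S (Fintype.card κ - Fintype.card ι) ι κ e
    (by have := Fintype.card_le_of_embedding e; omega) hn).2 hX f hf h

end stab
end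
end BP
end Part4

section Part5
open Matrix Kronecker Topology
namespace BP
set_option linter.unusedSectionVars false
set_option linter.unusedSimpArgs false
noncomputable section
open unitInterval

section laurent
variable {Y : Type} [TopologicalSpace Y]

/-- Laurent monomials -/
def mono (c : C(Y, ℂ)) (j : ℤ) : C(Y × Circle, ℂ) :=
  ⟨fun p => c p.1 * ((p.2 : Circle) ^ j : Circle), by
    have h1 : Continuous fun p : Y × Circle => p.2 ^ j := (continuous_zpow j).comp continuous_snd
    have h2 : Continuous fun p : Y × Circle => ((p.2 ^ j : Circle) : ℂ) :=
      continuous_induced_dom.comp h1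
    exact (c.continuous.comp continuous_fst).mul h2⟩

/-- evaluation of Laurent polynomials -/
def ev (c : ℤ →₀ C(Y, ℂ)) (y : Y) (z : Circle) : ℂ := c.sum fun j a => a y * ((z ^ j : Circle) : ℂ)

theorem ev_add (c c' : ℤ →₀ C(Y, ℂ)) (y : Y) (z : Circle) :
    ev (c + c') y z = ev c y z + ev c' y z := by
  unfold ev
  rw [Finsupp.sum_add_index'] <;> simp [add_mul]

theorem ev_smul (a : C(Y, ℂ)) (c : ℤ →₀ C(Y, ℂ)) (y : Y) (z : Circle) :
    ev (a • c) y z = a y * ev c y z := by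
  unfold ev
  rw [Finsupp.sum_smul_index', Finsupp.mul_sum]
  · simp [mul_assoc]
  · simp

theorem ev_single (a : C(Y, ℂ)) (j : ℤ) (y : Y) (z : Circle) :
    ev (Finsupp.single j a) y z = a y * ((z ^ j : Circle) : ℂ) := by
  unfold ev
  rw [Finsupp.sum_single_index]
  simp

theorem ev_zero (y : Y) (z : Circle) : ev (0 : ℤ →₀ C(Y, ℂ)) y z = 0 := by
  simp [ev]

theorem ev_sum (c : ℤ →₀ C(Y, ℂ)) (s : Finset ℤ) (hs : c.support ⊆ s) (y : Y) (z : Circle) :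
    ev c y z = ∑ j ∈ s, c j y * ((z ^ j : Circle) : ℂ) := by
  unfold ev
  rw [Finsupp.sum_of_support_subset c hs]
  simp

/-- submonoid of monomials -/
def monos (Y : Type) [TopologicalSpace Y] : Submonoid C(Y × Circle, ℂ) where
  carrier := {f | ∃ c j, f = mono c j}
  one_mem' := ⟨1, 0, by ext; simp [mono]⟩
  mul_mem' := by
    rintro _ _ ⟨c, j, rfl⟩ ⟨c', j', rfl⟩
    refine ⟨c * c', j + j', ?_⟩
    ext p
    simp only [mono, ContinuousMap.mul_apply, ContinuousMap.coe_mk, _root_.zpow_add, Circle.coe_mul]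
    ring

/-- star algebra of Laurent polynomials -/
def monoAlg (Y : Type) [TopologicalSpace Y] : StarSubalgebra ℂ C(Y × Circle, ℂ) where
  toSubalgebra := Algebra.adjoin ℂ (monos Y : Set C(Y × Circle, ℂ))
  star_mem' := by
    intro a ha
    change star a ∈ Algebra.adjoin ℂ (monos Y : Set C(Y × Circle, ℂ))
    induction ha using Algebra.adjoin_induction with
    | mem x hx =>
      apply Algebra.subset_adjoin
      obtain ⟨c, j, rfl⟩ := hx
      refine ⟨star c, -j, ?_⟩
      ext p
      simp [mono]
      left; rw [← Circle.coe_inv_eq_conj, Circle.coe_inv, _root_.inv_zpow]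
    | algebraMap r =>
      rw [← algebraMap_star_comm]
      exact Subalgebra.algebraMap_mem _ _
    | add x y _ _ h1 h2 => rw [star_add]; exact add_mem h1 h2
    | mul x y _ _ h1 h2 => rw [star_mul]; exact mul_mem h2 h1

theorem mem_monoAlg {f : C(Y × Circle, ℂ)} (hf : f ∈ monoAlg Y) :
    ∃ c : ℤ →₀ C(Y, ℂ), ∀ y z, f (y, z) = ev c y z := by
  have h1 : f ∈ Submodule.span ℂ (monos Y : Set C(Y × Circle, ℂ)) := by
    have := Algebra.adjoin_eq_span (R := ℂ) (s := (monos Y : Set C(Y × Circle, ℂ)))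
    rw [Submonoid.closure_eq] at this
    rw [← this]
    exact hf
  induction h1 using Submodule.span_induction with
  | mem x hx =>
    obtain ⟨c, j, rfl⟩ := hx
    exact ⟨Finsupp.single j c, fun y z => by rw [ev_single]; rfl⟩
  | zero => exact ⟨0, fun y z => by simp [ev_zero]⟩
  | add f g hf' hg' h1 h2 =>
    have hf'' : f ∈ monoAlg Y := by
      have := Algebra.adjoin_eq_span (R := ℂ) (s := (monos Y : Set C(Y × Circle, ℂ)))
      rw [Submonoid.closure_eq] at this
      rw [← this] at hf'
      exact hf'
    have hg'' : g ∈ monoAlg Y := by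
      have := Algebra.adjoin_eq_span (R := ℂ) (s := (monos Y : Set C(Y × Circle, ℂ)))
      rw [Submonoid.closure_eq] at this
      rw [← this] at hg'
      exact hg'
    obtain ⟨c, hc⟩ := h1 hf''
    obtain ⟨c', hc'⟩ := h2 hg''
    exact ⟨c + c', fun y z => by rw [ev_add, ← hc, ← hc']; rfl⟩
  | smul a f hf' h1 =>
    have hf'' : f ∈ monoAlg Y := by
      have := Algebra.adjoin_eq_span (R := ℂ) (s := (monos Y : Set C(Y × Circle, ℂ)))
      rw [Submonoid.closure_eq] at this
      rw [← this] at hf'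
      exact hf'
    obtain ⟨c, hc⟩ := h1 hf''
    exact ⟨(ContinuousMap.const Y a) • c, fun y z => by rw [ev_smul, ← hc]; rfl⟩

theorem monoAlg_sep [CompactSpace Y] [T2Space Y] : (monoAlg Y).SeparatesPoints := by
  rintro ⟨y, z⟩ ⟨y', z'⟩ h
  by_cases hz : z = z'
  · have hy : y ≠ y' := by
      rintro rfl; exact h (by rw [hz])
    obtain ⟨g, h0, h1, -⟩ := exists_continuous_zero_one_of_isClosed (isClosed_singleton (x := y))
      (isClosed_singleton (x := y')) (by simpa using hy)
    refine ⟨_, ⟨mono ⟨fun y => (g y : ℂ), by fun_prop⟩ 0,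
      Algebra.subset_adjoin ⟨_, _, rfl⟩, rfl⟩, ?_⟩
    have h0' := h0 (Set.mem_singleton y)
    have h1' := h1 (Set.mem_singleton y')
    simp [mono, h0', h1']
  · refine ⟨_, ⟨mono 1 1, Algebra.subset_adjoin ⟨_, _, rfl⟩, rfl⟩, ?_⟩
    simp [mono]
    exact fun h => hz (Circle.ext h)

theorem laurent_approx [CompactSpace Y] [T2Space Y] (F : C(Y × Circle, ℂ)) {ε : ℝ} (hε : 0 < ε) :
    ∃ c : ℤ →₀ C(Y, ℂ), ∀ y z, ‖ev c y z - F (y, z)‖ < ε := by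
  have h := ContinuousMap.starSubalgebra_topologicalClosure_eq_top_of_separatesPoints (monoAlg Y)
    monoAlg_sep
  have h1 : F ∈ (monoAlg Y).topologicalClosure := by rw [h]; trivial
  have h2 : F ∈ closure (monoAlg Y : Set C(Y × Circle, ℂ)) := h1
  rw [Metric.mem_closure_iff] at h2
  obtain ⟨G, hG, hd⟩ := h2 ε hε
  obtain ⟨c, hc⟩ := mem_monoAlg hG
  refine ⟨c, fun y z => ?_⟩
  rw [← hc, ← dist_eq_norm, dist_comm]
  exact lt_of_le_of_lt (ContinuousMap.dist_apply_le_dist _) hd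

theorem continuous_ev (c : ℤ →₀ C(Y, ℂ)) : Continuous fun p : Y × Circle => ev c p.1 p.2 := by
  unfold ev Finsupp.sum
  refine continuous_finsetSum _ fun j _ => ?_
  exact (mono (c j) j).continuous

theorem laurent_rel [CompactSpace Y] [T2Space Y] (S : Set Y) (F : C(Y × Circle, ℂ))
    (c0 : ℤ →₀ C(Y, ℂ)) (hS : ∀ y ∈ S, ∀ z, F (y, z) = ev c0 y z) {ε : ℝ} (hε : 0 < ε) :
    ∃ c : ℤ →₀ C(Y, ℂ), (∀ y ∈ S, ∀ j, c j y = c0 j y) ∧ ∀ y z, ‖ev c y z - F (y, z)‖ < ε := by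
  obtain ⟨g, hg⟩ := laurent_approx F (half_pos hε)
  let Dm : C(Y × Circle, ℂ) := ⟨fun p => F p - ev c0 p.1 p.2, F.continuous.sub (continuous_ev c0)⟩
  let n : Y → ℝ := fun y => ‖Dm.curry y‖
  have hnc : Continuous n := by simp only [n]; fun_prop
  have hn : ∀ y z, ‖F (y, z) - ev c0 y z‖ ≤ n y := fun y z => (Dm.curry y).norm_coe_le_norm z
  have hnS : ∀ y ∈ S, n y = 0 := by
    intro y hy
    simp only [n, norm_eq_zero]
    ext z
    simp [Dm, hS y hy]
  let χr : Y → ℝ := fun y => min 1 (n y / (ε / 2))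
  have hχ0 : ∀ y, 0 ≤ χr y := fun y => le_min zero_le_one
    (div_nonneg (norm_nonneg _) (by positivity))
  have hχ1 : ∀ y, χr y ≤ 1 := fun y => min_le_left _ _
  let χ : C(Y, ℂ) := ⟨fun y => (χr y : ℂ), by simp only [χr]; fun_prop⟩
  refine ⟨(1 - χ) • c0 + χ • g, ?_, ?_⟩
  · intro y hy j
    have : χ y = 0 := by simp [χ, χr, hnS y hy]
    simp [this]
  · intro y z
    rw [ev_add, ev_smul, ev_smul]
    have e1 : (1 - χ) y * ev c0 y z + χ y * ev g y z - F (y, z) =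
      ((1 - χr y : ℝ) : ℂ) * (ev c0 y z - F (y, z)) + ((χr y : ℝ) : ℂ) * (ev g y z - F (y, z)) := by
      simp [χ]
      ring
    rw [e1]
    refine lt_of_le_of_lt (norm_add_le _ _) ?_
    rw [norm_mul, norm_mul, Complex.norm_real, Complex.norm_real, Real.norm_eq_abs, Real.norm_eq_abs,
      abs_of_nonneg (hχ0 y), abs_of_nonneg (by linarith [hχ1 y])]
    have ha : (1 - χr y) * ‖ev c0 y z - F (y, z)‖ ≤ (1 - χr y) * (ε / 2) := by
      by_cases hc : n y ≤ ε / 2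
      · apply mul_le_mul_of_nonneg_left _ (by linarith [hχ1 y])
        rw [norm_sub_rev]
        exact (hn y z).trans hc
      · have : χr y = 1 := by
          simp only [χr]
          rw [min_eq_left]
          rw [le_div_iff₀ (by positivity)]
          linarith
        rw [this]; simp
    have hb : χr y * ‖ev g y z - F (y, z)‖ ≤ 1 * (ε / 2) :=
      mul_le_mul (hχ1 y) (hg y z).le (norm_nonneg _) zero_le_one
    have hh := hχ0 y
    by_cases hc : χr y = 0
    · rw [hc] at ha ⊢
      simp at ha ⊢
      linarith
    · have : 0 < χr y := lt_of_le_of_ne hh (Ne.symm hc)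
      nlinarith

variable {ι : Type} [Fintype ι] [DecidableEq ι]

theorem laurent_mat [CompactSpace Y] [T2Space Y] (S : Set Y) (F : Y × Circle → Matrix ι ι ℂ)
    (hF : Continuous F)
    (Q : Y → Matrix ι ι ℂ) (hQ : Continuous Q)
    (hS : ∀ y ∈ S, ∀ z : Circle, F (y, z) = 1 + ((z : ℂ) - 1) • Q y) {ε : ℝ} (hε : 0 < ε) :
    ∃ (d : ℕ) (p : ℕ → Y → Matrix ι ι ℂ), 1 ≤ d ∧ (∀ k, Continuous (p k)) ∧
      (∀ y ∈ S, ∀ k, p k y = if k = d then 1 - Q y else if k = d + 1 then Q y else 0) ∧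
      ∀ y (z : Circle) i j, ‖(((z : ℂ) ^ d)⁻¹ • ∑ k ∈ Finset.range (2 * d + 1), (z : ℂ) ^ k • p k y) i j
        - F (y, z) i j‖ < ε := by
  let a0 : ι → ι → C(Y, ℂ) := fun i j => ⟨fun y => (1 - Q y) i j,
    Continuous.matrix_elem (by fun_prop) _ _⟩
  let a1 : ι → ι → C(Y, ℂ) := fun i j => ⟨fun y => Q y i j,
    Continuous.matrix_elem (by fun_prop) _ _⟩
  have key : ∀ i j, ∃ c : ℤ →₀ C(Y, ℂ), (∀ y ∈ S, ∀ k, c k y =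
      (Finsupp.single 0 (a0 i j) + Finsupp.single 1 (a1 i j) : ℤ →₀ C(Y, ℂ)) k y) ∧
      ∀ y z, ‖ev c y z - F (y, z) i j‖ < ε := by
    intro i j
    refine laurent_rel S ⟨fun p => F p i j, Continuous.matrix_elem hF _ _⟩ _ ?_ hε
    intro y hy z
    rw [ev_add, ev_single, ev_single]
    simp [a0, a1, hS y hy]
    ring
  choose c hc1 hc2 using key
  let s : Finset ℤ := Finset.univ.biUnion fun i : ι => Finset.univ.biUnion fun j : ι => (c i j).support
  obtain ⟨d, hd1, hd⟩ : ∃ d : ℕ, 1 ≤ d ∧ ∀ k ∈ s, |k| ≤ d := by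
    refine ⟨1 + ∑ k ∈ s, k.natAbs, by omega, fun k hk => ?_⟩
    have := Finset.single_le_sum (f := fun k : ℤ => k.natAbs) (fun _ _ => Nat.zero_le _) hk
    rw [← Int.natCast_natAbs k]
    have h3 : k.natAbs ≤ 1 + ∑ k ∈ s, k.natAbs := this.trans (Nat.le_add_left _ _)
    exact_mod_cast h3
  obtain ⟨em, hem⟩ : ∃ em : ℕ ↪ ℤ, ∀ k, em k = (k : ℤ) - d :=
    ⟨⟨fun k : ℕ => (k : ℤ) - d, by intro a b h; simpa using h⟩, fun _ => rfl⟩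
  have hsup : ∀ i j, (c i j).support ⊆ (Finset.range (2 * d + 1)).map em := by
    intro i j k hk
    have := hd k (by simp only [s, Finset.mem_biUnion, Finset.mem_univ, true_and]; exact ⟨i, j, hk⟩)
    rw [abs_le] at this
    simp only [Finset.mem_map, Finset.mem_range, hem]
    exact ⟨(k + d).toNat, by omega, by omega⟩
  refine ⟨d, fun k y => Matrix.of fun i j => c i j ((k : ℤ) - d) y, hd1, ?_, ?_, ?_⟩
  · intro k
    refine continuous_matrix fun i j => ?_
    exact (c i j _).continuous
  · intro y hy k
    ext i j
    simp only [of_apply]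
    rw [hc1 i j y hy]
    by_cases h1 : k = d
    · subst h1
      simp [a0]
    · by_cases h2 : k = d + 1
      · subst h2
        simp [a1]
      · have h3 : (0 : ℤ) ≠ (k : ℤ) - d := by omega
        have h4 : (1 : ℤ) ≠ (k : ℤ) - d := by omega
        simp [h1, h2, Finsupp.single_apply, h3, h4]
  · intro y z i j
    have : (((z : ℂ) ^ d)⁻¹ • ∑ k ∈ Finset.range (2 * d + 1), (z : ℂ) ^ k •
        (Matrix.of fun i j => c i j ((k : ℤ) - d) y : Matrix ι ι ℂ)) i j = ev (c i j) y z := by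
      rw [ev_sum _ _ (hsup i j), Finset.sum_map, Matrix.smul_apply, Matrix.sum_apply, Finset.smul_sum]
      refine Finset.sum_congr rfl fun k _ => ?_
      have hz : (z : ℂ) ≠ 0 := z.coe_ne_zero
      simp only [hem, Matrix.smul_apply, of_apply, smul_eq_mul, Circle.coe_zpow]
      rw [zpow_sub₀ hz]
      simp only [zpow_natCast]
      field_simp
    rw [this]
    exact hc2 i j y z

theorem isUnit_near {Z : Type} [TopologicalSpace Z] [CompactSpace Z] (F : Z → Matrix ι ι ℂ)
    (hF : Continuous F) (hu : ∀ z, IsUnit (F z)) :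
    ∃ ε > (0 : ℝ), ∀ z (M : Matrix ι ι ℂ), (∀ i j, ‖M i j - F z i j‖ < ε) → IsUnit M := by
  let V : Set (Z × (ι → ι → ℂ)) := {p | (F p.1 + Matrix.of p.2).det ≠ 0}
  have hV : IsOpen V := by
    refine isOpen_ne_fun ?_ continuous_const
    apply Continuous.matrix_det
    refine (hF.comp continuous_fst).add ?_
    exact continuous_snd
  have hc := (isClosedMap_snd_of_compactSpace (X := Z) (Y := ι → ι → ℂ)) _ hV.isClosed_compl
  have ho : (Prod.snd '' Vᶜ)ᶜ ∈ 𝓝 (0 : ι → ι → ℂ) := by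
    refine hc.isOpen_compl.mem_nhds ?_
    rintro ⟨⟨x, s⟩, hs, h0⟩
    apply hs
    simp only at h0
    subst h0
    have := ((Matrix.isUnit_iff_isUnit_det _).1 (hu x)).ne_zero
    simpa [V] using this
  rw [Metric.mem_nhds_iff] at ho
  obtain ⟨ε, hε, h2⟩ := ho
  refine ⟨ε, hε, fun z M hM => ?_⟩
  have h3 : (fun i j => M i j - F z i j) ∈ Metric.ball (0 : ι → ι → ℂ) ε := by
    rw [mem_ball_zero_iff, pi_norm_lt_iff hε]
    intro i
    rw [pi_norm_lt_iff hε]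
    exact hM i
  have h4 := h2 h3
  rw [Matrix.isUnit_iff_isUnit_det, isUnit_iff_ne_zero]
  intro h5
  apply h4
  refine ⟨(z, fun i j => M i j - F z i j), ?_, rfl⟩
  simp only [V, Set.mem_compl_iff, Set.mem_ofPred_eq, not_not]
  rw [← h5]
  congr 1
  ext i j
  simp

/-- the loop -/
def ec : C(I, Circle) := ⟨fun t => Circle.exp (2 * Real.pi * t), by fun_prop⟩

theorem ec_zero : ec 0 = 1 := by simp [ec]
theorem ec_one : ec 1 = 1 := by simp [ec]

theorem ec_eq {t t' : I} (h : ec t = ec t') : t = t' ∨ (t = 0 ∧ t' = 1) ∨ (t = 1 ∧ t' = 0) := by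
  simp only [ec, ContinuousMap.coe_mk] at h
  rw [Circle.exp_eq_exp] at h
  obtain ⟨m, hm⟩ := h
  have hpi := Real.pi_pos
  have h1 : (t : ℝ) = t' + m := by
    have : 2 * Real.pi * (t : ℝ) = 2 * Real.pi * (t' + m) := by rw [hm]; ring
    exact mul_left_cancel₀ (by positivity) this
  have a1 := t.2.1
  have a2 := t.2.2
  have b1 := t'.2.1
  have b2 := t'.2.2
  have m1 : (m : ℝ) ≤ 1 := by linarith
  have m2 : (-1 : ℝ) ≤ m := by linarith
  have m1' : m ≤ 1 := by exact_mod_cast m1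
  have m2' : -1 ≤ m := by exact_mod_cast m2
  have : m = -1 ∨ m = 0 ∨ m = 1 := by omega
  rcases this with rfl | rfl | rfl
  · right; left
    push_cast at h1
    exact ⟨Subtype.ext (by change (t : ℝ) = 0; linarith), Subtype.ext (by change (t' : ℝ) = 1; linarith)⟩
  · left
    exact Subtype.ext (by simpa using h1)
  · right; right
    push_cast at h1
    exact ⟨Subtype.ext (by change (t : ℝ) = 1; linarith), Subtype.ext (by change (t' : ℝ) = 0; linarith)⟩

theorem ec_surj : Function.Surjective ec := by
  intro z
  have hpi := Real.pi_pos
  let x : ℝ := Complex.arg z / (2 * Real.pi)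
  refine ⟨⟨Int.fract x, Int.fract_nonneg x, (Int.fract_lt_one x).le⟩, ?_⟩
  have h1 : Circle.exp (Complex.arg z) = z := Circle.exp_arg z
  rw [← h1]
  simp only [ec, ContinuousMap.coe_mk]
  rw [Circle.exp_eq_exp]
  refine ⟨-⌊x⌋, ?_⟩
  have h2 : Int.fract x = x - ⌊x⌋ := rfl
  rw [h2]
  push_cast
  have h3 : 2 * Real.pi * x = Complex.arg z := by simp only [x]; field_simp
  rw [← h3]; ring

theorem to_circle [CompactSpace Y] [T2Space Y] {B : Type} [TopologicalSpace B] (F : C(Y × I, B))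
    (h : ∀ y, F (y, 0) = F (y, 1)) : ∃ G : C(Y × Circle, B), ∀ y t, G (y, ec t) = F (y, t) := by
  let q : C(Y × I, Y × Circle) := ⟨fun p => (p.1, ec p.2), by fun_prop⟩
  have hq : IsQuotientMap q := by
    apply IsClosedMap.isQuotientMap q.continuous.isClosedMap q.continuous
    rintro ⟨y, z⟩
    obtain ⟨t, ht⟩ := ec_surj z
    exact ⟨(y, t), by simp [q, ht]⟩
  have hfac : Function.FactorsThrough F q := by
    rintro ⟨y, t⟩ ⟨y', t'⟩ hyt
    simp only [q, ContinuousMap.coe_mk, Prod.mk.injEq] at hyt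
    obtain ⟨rfl, h2⟩ := hyt
    rcases ec_eq h2 with rfl | ⟨rfl, rfl⟩ | ⟨rfl, rfl⟩
    · rfl
    · exact h y
    · exact (h y).symm
  refine ⟨hq.lift F hfac, fun y t => ?_⟩
  have := DFunLike.congr_fun (hq.lift_comp F hfac) (y, t)
  exact this

end laurent
end
end BP
end Part5

section Part6
open Matrix Kronecker Topology
namespace BP
set_option linter.unusedSectionVars false
set_option linter.unusedSimpArgs false
noncomputable section
open unitInterval

section spectral
variable {κ : Type} [Fintype κ] [DecidableEq κ]

/-- circle-regular matrices -/
def Reg (b : Matrix κ κ ℂ) : Prop := ∀ z : Circle, IsUnit (1 + ((z : ℂ) - 1) • b)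

/-- parametrised circle -/
def zc (t : ℝ) : Circle := Circle.exp (2 * Real.pi * t)

theorem zc_continuous : Continuous zc := by unfold zc; fun_prop

/-- resolvent -/
def rs (b : Matrix κ κ ℂ) (t : ℝ) : Matrix κ κ ℂ := (1 + ((zc t : ℂ) - 1) • b)⁻¹

theorem rs_continuous' {Y : Type} [TopologicalSpace Y] {b : Y → Matrix κ κ ℂ} (hb : Continuous b)
    (h : ∀ y, Reg (b y)) : Continuous fun p : Y × ℝ => rs (b p.1) p.2 := by
  refine continuous_inv_mat ?_ (fun p => h p.1 _)
  have h1 : Continuous fun p : Y × ℝ => ((zc p.2 : ℂ) - 1) :=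
    ((continuous_induced_dom.comp (zc_continuous.comp continuous_snd))).sub continuous_const
  have h2 : Continuous fun p : Y × ℝ => b p.1 := hb.comp continuous_fst
  exact continuous_const.add (h1.smul h2)

theorem rs_continuous {b : Matrix κ κ ℂ} (h : Reg b) : Continuous (rs b) := by
  have := rs_continuous' (Y := Unit) (b := fun _ => b) continuous_const (fun _ => h)
  exact this.comp (f := fun t : ℝ => ((), t)) (by fun_prop)

/-- Fourier coefficients of the resolvent -/
def cf (b : Matrix κ κ ℂ) (k : ℤ) : Matrix κ κ ℂ :=
  Matrix.of fun i j => ∫ t in (0 : ℝ)..1, ((zc t ^ (-k) : Circle) : ℂ) * rs b t i j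

theorem zk_continuous (k : ℤ) : Continuous fun t => ((zc t ^ k : Circle) : ℂ) :=
  have h1 : Continuous fun z : Circle => z ^ k := continuous_zpow k
  have h2 : Continuous fun t => zc t ^ k := h1.comp zc_continuous
  continuous_induced_dom.comp h2

theorem cf_continuous {Y : Type} [TopologicalSpace Y] {b : Y → Matrix κ κ ℂ} (hb : Continuous b)
    (h : ∀ y, Reg (b y)) (k : ℤ) : Continuous fun y => cf (b y) k := by
  refine continuous_matrix fun i j => ?_
  change Continuous fun y => ∫ t in (0 : ℝ)..1, ((zc t ^ (-k) : Circle) : ℂ) * rs (b y) t i j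
  refine intervalIntegral.continuous_parametric_intervalIntegral_of_continuous' ?_ 0 1
  have h1 : Continuous fun p : Y × ℝ => ((zc p.2 ^ (-k) : Circle) : ℂ) :=
    (zk_continuous (-k)).comp continuous_snd
  have h2 : Continuous fun p : Y × ℝ => rs (b p.1) p.2 i j :=
    (rs_continuous' hb h).matrix_elem i j
  exact h1.mul h2

theorem mul_cf {b : Matrix κ κ ℂ} (h : Reg b) (k : ℤ) (A : Matrix κ κ ℂ) (i j : κ) :
    (A * cf b k) i j = ∫ t in (0 : ℝ)..1, ((zc t ^ (-k) : Circle) : ℂ) * (A * rs b t) i j := by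
  have hc : ∀ l, Continuous fun t => rs b t l j := fun l => (rs_continuous h).matrix_elem l j
  rw [Matrix.mul_apply]
  simp only [cf, of_apply]
  simp_rw [Matrix.mul_apply, Finset.mul_sum]
  rw [intervalIntegral.integral_finsetSum]
  · refine Finset.sum_congr rfl fun l _ => ?_
    rw [← intervalIntegral.integral_const_mul]
    congr 1
    ext t
    ring
  · intro l _
    apply Continuous.intervalIntegrable
    exact (zk_continuous _).mul (continuous_const.mul (hc l))

theorem cf_mul {b : Matrix κ κ ℂ} (h : Reg b) (k : ℤ) (A : Matrix κ κ ℂ) (i j : κ) :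
    (cf b k * A) i j = ∫ t in (0 : ℝ)..1, ((zc t ^ (-k) : Circle) : ℂ) * (rs b t * A) i j := by
  have hc : ∀ l, Continuous fun t => rs b t i l := fun l => (rs_continuous h).matrix_elem i l
  rw [Matrix.mul_apply]
  simp only [cf, of_apply]
  simp_rw [Matrix.mul_apply, Finset.mul_sum]
  rw [intervalIntegral.integral_finsetSum]
  · refine Finset.sum_congr rfl fun l _ => ?_
    rw [← intervalIntegral.integral_mul_const]
    congr 1
    ext t
    ring
  · intro l _
    apply Continuous.intervalIntegrable
    exact (zk_continuous _).mul ((hc l).mul continuous_const)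

theorem cf_comm {b : Matrix κ κ ℂ} (h : Reg b) (k : ℤ) {A : Matrix κ κ ℂ} (hA : A * b = b * A) :
    A * cf b k = cf b k * A := by
  ext i j
  rw [mul_cf h, cf_mul h]
  congr 1
  ext t
  congr 1
  refine congrFun (congrFun ?_ i) j
  have hu := h (zc t)
  have hd : IsUnit (1 + ((zc t : ℂ) - 1) • b).det := (Matrix.isUnit_iff_isUnit_det _).1 hu
  have hc : A * (1 + ((zc t : ℂ) - 1) • b) = (1 + ((zc t : ℂ) - 1) • b) * A := by
    simp [mul_add, add_mul, hA]
  unfold rs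
  calc A * (1 + ((zc t : ℂ) - 1) • b)⁻¹
      = (1 + ((zc t : ℂ) - 1) • b)⁻¹ * ((1 + ((zc t : ℂ) - 1) • b) * A)
        * (1 + ((zc t : ℂ) - 1) • b)⁻¹ := by
        rw [← Matrix.mul_assoc, Matrix.nonsing_inv_mul _ hd, Matrix.one_mul]
    _ = _ := by
        rw [← hc, Matrix.mul_assoc, Matrix.mul_assoc, Matrix.mul_nonsing_inv _ hd, Matrix.mul_one]

theorem integral_zk (k : ℤ) : ∫ t in (0 : ℝ)..1, ((zc t ^ k : Circle) : ℂ) = if k = 0 then 1 else 0 := by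
  split_ifs with h
  · subst h; simp
  · have h1 : ∀ t : ℝ, ((zc t ^ k : Circle) : ℂ) = Complex.exp ((2 * Real.pi * k * Complex.I) * t) := by
      intro t
      rw [Circle.coe_zpow, zc, Circle.coe_exp, ← Complex.exp_int_mul]
      congr 1
      push_cast
      ring
    simp_rw [h1]
    have hk : (k : ℂ) ≠ 0 := by exact_mod_cast h
    rw [integral_exp_mul_complex]
    · have h2 : Complex.exp (2 * Real.pi * k * Complex.I * (1 : ℝ)) = 1 := by
        rw [Complex.exp_eq_one_iff]
        exact ⟨k, by push_cast; ring⟩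
      rw [h2]
      simp
    · simp [hk, Real.pi_ne_zero]

theorem cf_rec {b : Matrix κ κ ℂ} (h : Reg b) (k : ℤ) :
    (1 - b) * cf b k + b * cf b (k - 1) = if k = 0 then 1 else 0 := by
  ext i j
  have hc : Continuous (rs b) := rs_continuous h
  rw [Matrix.add_apply, mul_cf h, mul_cf h, ← intervalIntegral.integral_add]
  · have : ∀ t, ((zc t ^ (-k) : Circle) : ℂ) * ((1 - b) * rs b t) i j +
      ((zc t ^ (-(k - 1)) : Circle) : ℂ) * (b * rs b t) i j =
      ((zc t ^ (-k) : Circle) : ℂ) * (1 : Matrix κ κ ℂ) i j := by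
      intro t
      have hd : IsUnit (1 + ((zc t : ℂ) - 1) • b).det := (Matrix.isUnit_iff_isUnit_det _).1 (h (zc t))
      have h1 : (1 + ((zc t : ℂ) - 1) • b) * rs b t = 1 := Matrix.mul_nonsing_inv _ hd
      have h2 : ((zc t ^ (-(k - 1)) : Circle) : ℂ) = ((zc t ^ (-k) : Circle) : ℂ) * zc t := by
        rw [← Circle.coe_mul]
        congr 1
        rw [show -(k - 1) = -k + 1 by ring, _root_.zpow_add, zpow_one]
      have h3 := congrFun (congrFun h1 i) j
      rw [h2, ← h3]
      simp only [sub_mul, add_mul, Matrix.add_apply, Matrix.sub_apply, Matrix.smul_mul,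
        Matrix.smul_apply, smul_eq_mul, Matrix.one_mul]
      ring
    simp_rw [this]
    rw [intervalIntegral.integral_mul_const, integral_zk]
    by_cases hk : k = 0 <;> simp [hk]
  · apply Continuous.intervalIntegrable
    exact (zk_continuous _).mul (Continuous.matrix_elem (continuous_const.mul hc) i j)
  · apply Continuous.intervalIntegrable
    exact (zk_continuous _).mul (Continuous.matrix_elem (continuous_const.mul hc) i j)

theorem cf_tendsto (b : Matrix κ κ ℂ) (i j : κ) :
    Filter.Tendsto (fun k => cf b k i j) Filter.cofinite (𝓝 0) := by
  have h1 := Real.tendsto_integral_exp_smul_cocompact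
    (fun t : ℝ => (Set.Ioc (0 : ℝ) 1).indicator (fun t => rs b t i j) t)
  have h2 := h1.comp Int.tendsto_coe_cofinite
  refine h2.congr fun k => ?_
  simp only [Function.comp, cf, of_apply]
  rw [intervalIntegral.integral_of_le zero_le_one, ← MeasureTheory.integral_indicator measurableSet_Ioc]
  congr 1
  ext t
  by_cases ht : t ∈ Set.Ioc (0 : ℝ) 1
  · rw [Set.indicator_of_mem ht, Set.indicator_of_mem ht, Circle.smul_def, smul_eq_mul]
    congr 2
    rw [zc, ← Circle.exp_zsmul]
    change Circle.exp (2 * Real.pi * (-(t * k))) = _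
    congr 1
    rw [zsmul_eq_mul]
    push_cast
    ring
  · rw [Set.indicator_of_notMem ht, Set.indicator_of_notMem ht, smul_zero]

/-- spectral idempotent -/
def sp (b : Matrix κ κ ℂ) : Matrix κ κ ℂ := b * cf b (-1)

theorem sp_continuous {Y : Type} [TopologicalSpace Y] {b : Y → Matrix κ κ ℂ} (hb : Continuous b)
    (h : ∀ y, Reg (b y)) : Continuous fun y => sp (b y) :=
  hb.mul (cf_continuous hb h _)

theorem sp_comm {b : Matrix κ κ ℂ} (h : Reg b) {A : Matrix κ κ ℂ} (hA : A * b = b * A) :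
    A * sp b = sp b * A := by
  unfold sp
  rw [← Matrix.mul_assoc, hA, Matrix.mul_assoc, cf_comm h _ hA, Matrix.mul_assoc]

theorem sp_compl {b : Matrix κ κ ℂ} (h : Reg b) : 1 - sp b = (1 - b) * cf b 0 := by
  have := cf_rec h 0
  rw [if_pos rfl] at this
  rw [zero_sub] at this
  rw [sp, sub_eq_iff_eq_add]
  exact this.symm

theorem cf_cf {b : Matrix κ κ ℂ} (h : Reg b) (k l : ℤ) : cf b k * cf b l = cf b l * cf b k :=
  cf_comm h l (cf_comm h k rfl).symm

theorem sp_sq {b : Matrix κ κ ℂ} (h : Reg b) : sp b * sp b = sp b := by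
  have hb : ∀ k, b * cf b k = cf b k * b := fun k => cf_comm h k rfl
  have ha : ∀ k, (1 - b) * cf b k = cf b k * (1 - b) := fun k => cf_comm h k (by noncomm_ring)
  have key : ∀ n : ℕ, ((1 - b) * cf b n) * (b * cf b (-n - 1)) = (1 - sp b) * sp b := by
    intro n
    induction n with
    | zero => rw [sp_compl h]; simp [sp]
    | succ n ih =>
      rw [← ih]
      have h1 := cf_rec h (n + 1)
      have h2 := cf_rec h (-n - 1)
      rw [if_neg (by omega), add_sub_cancel_right] at h1
      rw [if_neg (by omega)] at h2
      rw [add_eq_zero_iff_eq_neg] at h1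
      rw [add_comm, add_eq_zero_iff_eq_neg] at h2
      push_cast
      rw [h1, show (-((n : ℤ) + 1) - 1) = (-n - 1 - 1) by ring, h2, neg_mul_neg]
      have e1 : b * cf b n * ((1 - b) * cf b (-n - 1)) = (b * (1 - b)) * (cf b n * cf b (-n - 1)) := by
        rw [Matrix.mul_assoc, ← Matrix.mul_assoc (cf b n), ← ha, Matrix.mul_assoc (1 - b),
          ← Matrix.mul_assoc b]
      have e2 : (1 - b) * cf b n * (b * cf b (-n - 1)) = (b * (1 - b)) * (cf b n * cf b (-n - 1)) := by
        rw [Matrix.mul_assoc, ← Matrix.mul_assoc (cf b n), ← hb, Matrix.mul_assoc b,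
          ← Matrix.mul_assoc (1 - b), show (1 - b) * b = b * (1 - b) by noncomm_ring]
      rw [e1, e2]
  have lim : Filter.Tendsto (fun n : ℕ => ((1 - b) * cf b n) * (b * cf b (-n - 1))) Filter.atTop
      (𝓝 0) := by
    have t1 : Filter.Tendsto (fun n : ℕ => cf b n) Filter.atTop (𝓝 0) := by
      refine tendsto_pi_nhds.2 fun i => tendsto_pi_nhds.2 fun j => ?_
      refine (cf_tendsto b i j).comp ?_
      rw [← Nat.cofinite_eq_atTop]
      exact Function.Injective.tendsto_cofinite (fun a b h => by simpa using h)
    have t2 : Filter.Tendsto (fun n : ℕ => cf b (-n - 1)) Filter.atTop (𝓝 0) := by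
      refine tendsto_pi_nhds.2 fun i => tendsto_pi_nhds.2 fun j => ?_
      refine (cf_tendsto b i j).comp (f := fun n : ℕ => (-n - 1 : ℤ)) ?_
      rw [← Nat.cofinite_eq_atTop]
      exact Function.Injective.tendsto_cofinite (fun a b h => by simpa using h)
    have := ((tendsto_const_nhds (x := 1 - b)).mul t1).mul ((tendsto_const_nhds (x := b)).mul t2)
    simpa using this
  simp_rw [key] at lim
  have h3 := tendsto_nhds_unique tendsto_const_nhds lim
  have h4 : sp b - sp b * sp b = 0 := by rw [← h3]; noncomm_ring
  exact (sub_eq_zero.1 h4).symm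

theorem exists_eig (b : Matrix κ κ ℂ) (K : Submodule ℂ (κ → ℂ)) (hK : K ≠ ⊥)
    (hb : ∀ v ∈ K, b *ᵥ v ∈ K) : ∃ (μ : ℂ) (v : κ → ℂ), v ∈ K ∧ v ≠ 0 ∧ b *ᵥ v = μ • v := by
  have : Nontrivial K := Submodule.nontrivial_iff_ne_bot.2 hK
  let f : Module.End ℂ K := (Matrix.toLin' b).restrict (p := K) (q := K)
    (fun v hv => by simpa using hb v hv)
  obtain ⟨μ, hμ⟩ := Module.End.exists_eigenvalue f
  obtain ⟨v, hv⟩ := hμ.exists_hasEigenvector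
  refine ⟨μ, v, v.2, fun h => hv.2 (Subtype.ext h), ?_⟩
  have := congrArg (Subtype.val) hv.apply_eq_smul
  simpa [f] using this

theorem exists_eig' (b Q : Matrix κ κ ℂ) (hQ : Q * Q = Q) (hc : Q * b = b * Q) (h0 : Q ≠ 0) :
    ∃ (μ : ℂ) (v : κ → ℂ), Q *ᵥ v = v ∧ v ≠ 0 ∧ b *ᵥ v = μ • v := by
  obtain ⟨μ, v, hv, h1, h2⟩ := exists_eig b (LinearMap.range (Matrix.toLin' Q)) (by
    rw [Ne, LinearMap.range_eq_bot]
    intro h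
    apply h0
    exact (Matrix.toLin').injective (by rw [h, map_zero])) (by
    rintro _ ⟨w, rfl⟩
    refine ⟨b *ᵥ w, ?_⟩
    simp [hc])
  refine ⟨μ, v, ?_, h1, h2⟩
  obtain ⟨w, rfl⟩ := hv
  simp [hQ]

theorem eig_ne_half {b : Matrix κ κ ℂ} (h : Reg b) {μ : ℂ} {v : κ → ℂ} (hv : v ≠ 0)
    (hb : b *ᵥ v = μ • v) : μ.re ≠ 1 / 2 := by
  intro hre
  have hμ : μ ≠ 0 := by
    rintro rfl
    norm_num at hre
  have hn : ‖μ - 1‖ = ‖μ‖ := by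
    rw [← sq_eq_sq₀ (norm_nonneg _) (norm_nonneg _), ← Complex.normSq_eq_norm_sq,
      ← Complex.normSq_eq_norm_sq, Complex.normSq_apply, Complex.normSq_apply]
    simp [hre]
    norm_num
  let z : Circle := ⟨(μ - 1) / μ, by
    have hh : ‖(μ - 1) / μ‖ = 1 := by rw [norm_div, hn, div_self (norm_ne_zero_iff.2 hμ)]
    exact mem_sphere_zero_iff_norm.2 hh⟩
  have hz : (z : ℂ) = (μ - 1) / μ := rfl
  have hd : IsUnit (1 + ((z : ℂ) - 1) • b).det := (Matrix.isUnit_iff_isUnit_det _).1 (h z)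
  have h1 : (1 + ((z : ℂ) - 1) • b) *ᵥ v = 0 := by
    rw [Matrix.add_mulVec, Matrix.one_mulVec, Matrix.smul_mulVec, hb, smul_smul, hz]
    have : ((μ - 1) / μ - 1) * μ = -1 := by field_simp; ring
    rw [this]
    simp
  apply hv
  have h2 : (1 + ((z : ℂ) - 1) • b)⁻¹ *ᵥ ((1 + ((z : ℂ) - 1) • b) *ᵥ v) = v := by
    rw [Matrix.mulVec_mulVec, Matrix.nonsing_inv_mul _ hd, Matrix.one_mulVec]
  rw [← h2, h1, Matrix.mulVec_zero]

theorem tendsto_vec (b : Matrix κ κ ℂ) (v : κ → ℂ) (g : ℕ → ℤ) (hg : Function.Injective g) :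
    Filter.Tendsto (fun n => ‖cf b (g n) *ᵥ v‖) Filter.atTop (𝓝 0) := by
  rw [← norm_zero (E := κ → ℂ)]
  refine Filter.Tendsto.norm ?_
  refine tendsto_pi_nhds.2 fun i => ?_
  simp only [Matrix.mulVec, dotProduct]
  have : (0 : κ → ℂ) i = ∑ j : κ, 0 * v j := by simp
  rw [this]
  refine tendsto_finsetSum _ fun j _ => Filter.Tendsto.mul ?_ tendsto_const_nhds
  refine (cf_tendsto b i j).comp ?_
  rw [← Nat.cofinite_eq_atTop]
  exact hg.tendsto_cofinite

theorem norm_le_aux {p q : ℂ} {x y : κ → ℂ} (hpq : ‖q‖ < ‖p‖) (h : p • x + q • y = 0) : ‖x‖ ≤ ‖y‖ := by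
  rw [add_eq_zero_iff_eq_neg] at h
  have h1 : ‖p‖ * ‖x‖ = ‖q‖ * ‖y‖ := by
    rw [← norm_smul, ← norm_smul, h, norm_neg]
  have h2 := norm_nonneg q
  have h3 := norm_nonneg y
  have h4 := norm_nonneg x
  by_contra hc
  push Not at hc
  nlinarith

theorem rec_vec {b : Matrix κ κ ℂ} (h : Reg b) {μ : ℂ} {v : κ → ℂ}
    (hb : b *ᵥ v = μ • v) (k : ℤ) (hk : k ≠ 0) :
    (1 - μ) • (cf b k *ᵥ v) + μ • (cf b (k - 1) *ᵥ v) = 0 := by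
  have h1 := congrArg (fun M => M *ᵥ v) (cf_rec h k)
  simp only [if_neg hk, Matrix.add_mulVec, Matrix.zero_mulVec] at h1
  rw [cf_comm h k (A := 1 - b) (by noncomm_ring), cf_comm h (k - 1) (A := b) rfl,
    ← Matrix.mulVec_mulVec, ← Matrix.mulVec_mulVec, Matrix.sub_mulVec, Matrix.one_mulVec, hb,
    Matrix.mulVec_smul] at h1
  rw [← h1]
  congr 1
  rw [sub_smul, one_smul, Matrix.mulVec_sub, Matrix.mulVec_smul]

theorem norm_lt_aux (μ : ℂ) : ‖μ‖ < ‖1 - μ‖ ↔ μ.re < 1 / 2 := by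
  rw [← sq_lt_sq₀ (norm_nonneg _) (norm_nonneg _), ← Complex.normSq_eq_norm_sq,
      ← Complex.normSq_eq_norm_sq, Complex.normSq_apply, Complex.normSq_apply]
  simp
  constructor <;> intro h <;> nlinarith

theorem norm_gt_aux (μ : ℂ) : ‖1 - μ‖ < ‖μ‖ ↔ 1 / 2 < μ.re := by
  rw [← sq_lt_sq₀ (norm_nonneg _) (norm_nonneg _), ← Complex.normSq_eq_norm_sq,
      ← Complex.normSq_eq_norm_sq, Complex.normSq_apply, Complex.normSq_apply]
  simp
  constructor <;> intro h <;> nlinarith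

theorem sp_vec_lt {b : Matrix κ κ ℂ} (h : Reg b) {μ : ℂ} {v : κ → ℂ}
    (hb : b *ᵥ v = μ • v) (hm : μ.re < 1 / 2) : sp b *ᵥ v = 0 := by
  have hn := (norm_lt_aux μ).2 hm
  have h1 : ∀ n : ℕ, ‖cf b (-1) *ᵥ v‖ ≤ ‖cf b (-1 - n) *ᵥ v‖ := by
    intro n
    induction n with
    | zero => simp
    | succ n ih =>
      refine ih.trans ?_
      have := norm_le_aux hn (rec_vec h hb (-1 - n) (by omega))
      push_cast
      rwa [show (-1 - ((n : ℤ) + 1)) = -1 - n - 1 by ring]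
  have h2 := ge_of_tendsto (tendsto_vec b v (fun n => -1 - n) (fun a b h => by simpa using h))
    (Filter.Eventually.of_forall h1)
  have h3 : cf b (-1) *ᵥ v = 0 := norm_le_zero_iff.1 h2
  rw [sp, ← Matrix.mulVec_mulVec, h3, Matrix.mulVec_zero]

theorem sp_vec_gt {b : Matrix κ κ ℂ} (h : Reg b) {μ : ℂ} {v : κ → ℂ}
    (hb : b *ᵥ v = μ • v) (hm : 1 / 2 < μ.re) : sp b *ᵥ v = v := by
  have hn := (norm_gt_aux μ).2 hm
  have h1 : ∀ n : ℕ, ‖cf b 0 *ᵥ v‖ ≤ ‖cf b n *ᵥ v‖ := by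
    intro n
    induction n with
    | zero => simp
    | succ n ih =>
      refine ih.trans ?_
      have h4 := rec_vec h hb (n + 1) (by omega)
      rw [add_comm] at h4
      have := norm_le_aux hn h4
      push_cast
      rwa [add_sub_cancel_right] at this
  have h2 := ge_of_tendsto (tendsto_vec b v (fun n => (n : ℤ)) (fun a b h => by simpa using h))
    (Filter.Eventually.of_forall h1)
  have h3 : cf b 0 *ᵥ v = 0 := norm_le_zero_iff.1 h2
  have h5 : (1 - sp b) *ᵥ v = 0 := by
    rw [sp_compl h, ← Matrix.mulVec_mulVec, h3, Matrix.mulVec_zero]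
  rw [Matrix.sub_mulVec, Matrix.one_mulVec] at h5
  exact (sub_eq_zero.1 h5).symm

theorem sp_re {b : Matrix κ κ ℂ} (h : Reg b) {μ : ℂ} {v : κ → ℂ} (hv : v ≠ 0)
    (hb : b *ᵥ v = μ • v) (hs : sp b *ᵥ v = v) : 1 / 2 < μ.re := by
  rcases lt_trichotomy μ.re (1 / 2) with h1 | h1 | h1
  · rw [sp_vec_lt h hb h1] at hs
    exact absurd hs.symm hv
  · exact absurd h1 (eig_ne_half h hv hb)
  · exact h1

theorem sp_re' {b : Matrix κ κ ℂ} (h : Reg b) {μ : ℂ} {v : κ → ℂ} (hv : v ≠ 0)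
    (hb : b *ᵥ v = μ • v) (hs : sp b *ᵥ v = 0) : μ.re < 1 / 2 := by
  rcases lt_trichotomy μ.re (1 / 2) with h1 | h1 | h1
  · exact h1
  · exact absurd h1 (eig_ne_half h hv hb)
  · rw [sp_vec_gt h hb h1] at hs
    exact absurd hs hv

theorem sp_unique {b E : Matrix κ κ ℂ} (h : Reg b) (hE : E * E = E) (hc : E * b = b * E)
    (h1 : ∀ (μ : ℂ) v, E *ᵥ v = v → v ≠ 0 → b *ᵥ v = μ • v → μ = 1)
    (h0 : ∀ (μ : ℂ) v, E *ᵥ v = 0 → v ≠ 0 → b *ᵥ v = μ • v → μ = 0) : sp b = E := by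
  have hP := sp_sq h
  have hPE : E * sp b = sp b * E := sp_comm h hc
  have hPb : sp b * b = b * sp b := (sp_comm h rfl).symm
  have e1 : (1 - sp b) * E = 0 := by
    by_contra hne
    obtain ⟨μ, v, hv, hv0, hbv⟩ := exists_eig' b ((1 - sp b) * E) (by
      calc (1 - sp b) * E * ((1 - sp b) * E) = E * E - E * (sp b * E) - sp b * (E * E)
            + sp b * (E * sp b) * E := by noncomm_ring
        _ = (1 - sp b) * E := by
          rw [← Matrix.mul_assoc E, hPE, ← Matrix.mul_assoc (sp b) (sp b), hP, Matrix.mul_assoc, hE]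
          noncomm_ring) (by
      rw [Matrix.mul_assoc, hc, ← Matrix.mul_assoc, ← Matrix.mul_assoc]
      congr 1
      simp [sub_mul, mul_sub, hPb]) hne
    have a1 : E *ᵥ v = v := by
      conv_lhs => rw [← hv]
      rw [Matrix.mulVec_mulVec, ← Matrix.mul_assoc]
      have : E * (1 - sp b) * E = (1 - sp b) * E := by
        rw [mul_sub, hPE, sub_mul, sub_mul, Matrix.mul_assoc (sp b), hE, Matrix.mul_one, hE,
          Matrix.one_mul]
      rw [this, hv]
    have a2 : sp b *ᵥ v = 0 := by
      rw [← hv, Matrix.mulVec_mulVec, ← Matrix.mul_assoc, mul_sub, hP]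
      simp
    have a3 := h1 μ v a1 hv0 hbv
    have a4 := sp_re' h hv0 hbv a2
    rw [a3] at a4
    norm_num at a4
  have e2 : sp b * (1 - E) = 0 := by
    by_contra hne
    have hPE' : (1 - E) * sp b = sp b * (1 - E) := by simp [sub_mul, mul_sub, hPE]
    have hE' : (1 - E) * (1 - E) = 1 - E := by simp [sub_mul, mul_sub, hE]
    obtain ⟨μ, v, hv, hv0, hbv⟩ := exists_eig' b (sp b * (1 - E)) (by
      rw [Matrix.mul_assoc, ← Matrix.mul_assoc (1 - E), hPE', Matrix.mul_assoc, hE',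
        ← Matrix.mul_assoc, hP]) (by
      rw [Matrix.mul_assoc, show (1 - E) * b = b * (1 - E) by simp [sub_mul, mul_sub, hc],
        ← Matrix.mul_assoc, ← Matrix.mul_assoc, hPb]) hne
    have a1 : E *ᵥ v = 0 := by
      rw [← hv, Matrix.mulVec_mulVec, ← Matrix.mul_assoc, hPE, Matrix.mul_assoc, mul_sub, hE]
      simp
    have a2 : sp b *ᵥ v = v := by
      conv_lhs => rw [← hv]
      rw [Matrix.mulVec_mulVec, ← Matrix.mul_assoc, hP, hv]
    have a3 := h0 μ v a1 hv0 hbv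
    have a4 := sp_re h hv0 hbv a2
    rw [a3] at a4
    norm_num at a4
  have e3 : sp b = sp b * E := by
    rw [mul_sub, Matrix.mul_one] at e2
    exact sub_eq_zero.1 e2
  rw [sub_mul, Matrix.one_mul] at e1
  rw [e3]
  exact (sub_eq_zero.1 e1).symm

/-- the straight line from `b` to its spectral idempotent stays regular -/
theorem sp_line {b : Matrix κ κ ℂ} (h : Reg b) (s : ℝ) (h0 : 0 ≤ s) (h1 : s ≤ 1) :
    Reg (((1 - s : ℝ) : ℂ) • b + (s : ℂ) • sp b) := by
  intro z
  have hPb : sp b * b = b * sp b := (sp_comm h rfl).symm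
  have hP := sp_sq h
  by_contra hu
  rw [Matrix.isUnit_iff_isUnit_det, isUnit_iff_ne_zero, not_not, ← Matrix.exists_mulVec_eq_zero_iff] at hu
  set c := ((1 - s : ℝ) : ℂ) • b + (s : ℂ) • sp b with hc
  obtain ⟨w, hw0, hw⟩ := hu
  have hcb : c * b = b * c := by simp [hc, add_mul, mul_add, hPb]
  have hcP : c * sp b = sp b * c := by simp [hc, add_mul, mul_add, hPb]
  let K : Submodule ℂ (κ → ℂ) := LinearMap.ker (Matrix.toLin' (1 + ((z : ℂ) - 1) • c))
  have hK : ∀ v, v ∈ K ↔ (1 + ((z : ℂ) - 1) • c) *ᵥ v = 0 := fun v => by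
    simp only [K, LinearMap.mem_ker, Matrix.toLin'_apply]
  have hKb : ∀ v ∈ K, ∀ M : Matrix κ κ ℂ, c * M = M * c → M *ᵥ v ∈ K := by
    intro v hv M hM
    rw [hK] at hv ⊢
    rw [Matrix.mulVec_mulVec, show (1 + ((z : ℂ) - 1) • c) * M = M * (1 + ((z : ℂ) - 1) • c) by
      simp [add_mul, mul_add, hM], ← Matrix.mulVec_mulVec, hv, Matrix.mulVec_zero]
  -- key contradiction
  have hre : ∀ x : ℂ, x.re ≠ 1 / 2 → ∀ v ∈ K, c *ᵥ v = x • v → v = 0 := by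
    intro x hx v hv hcv
    rw [hK, Matrix.add_mulVec, Matrix.one_mulVec, Matrix.smul_mulVec, hcv, smul_smul] at hv
    have h2 : (1 + ((z : ℂ) - 1) * x) • v = 0 := by rw [add_smul, one_smul]; exact hv
    rcases smul_eq_zero.1 h2 with h3 | h3
    · exfalso
      apply hx
      have hx0 : x ≠ 0 := by rintro rfl; simp at h3
      have h4 : (z : ℂ) * x = -(1 - x) := by linear_combination h3
      have h5 : ‖x‖ = ‖1 - x‖ := by
        have := congrArg norm h4
        rwa [norm_mul, norm_neg, Circle.norm_coe, one_mul] at this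
      have h6 : ¬ x.re < 1 / 2 := fun h => by
        have := (norm_lt_aux x).2 h; linarith
      have h7 : ¬ 1 / 2 < x.re := fun h => by
        have := (norm_gt_aux x).2 h; linarith
      exact le_antisymm (not_lt.1 h7) (not_lt.1 h6)
    · exact h3
  have hall : ∀ v ∈ K, sp b *ᵥ v = v → v = 0 := by
    by_contra hne
    push Not at hne
    obtain ⟨v, hvK, hv1, hv0⟩ := hne
    obtain ⟨μ, u, hu, hu0, hbu⟩ := exists_eig b (K ⊓ LinearMap.ker (Matrix.toLin' (1 - sp b))) (by
      intro hbot
      have : v ∈ K ⊓ LinearMap.ker (Matrix.toLin' (1 - sp b)) := ⟨hvK, by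
        simp [Matrix.sub_mulVec, hv1]⟩
      rw [hbot] at this
      exact hv0 (by simpa using this)) (by
      rintro x ⟨hx1, hx2⟩
      refine ⟨hKb x hx1 b hcb, ?_⟩
      simp only [SetLike.mem_coe, LinearMap.mem_ker, Matrix.toLin'_apply] at hx2 ⊢
      rw [Matrix.mulVec_mulVec, show (1 - sp b) * b = b * (1 - sp b) by
        simp [sub_mul, mul_sub, hPb], ← Matrix.mulVec_mulVec, hx2, Matrix.mulVec_zero])
    obtain ⟨hu1, hu2⟩ := hu
    simp only [SetLike.mem_coe, LinearMap.mem_ker, Matrix.toLin'_apply, Matrix.sub_mulVec,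
      Matrix.one_mulVec] at hu2
    have hu3 : sp b *ᵥ u = u := (sub_eq_zero.1 hu2).symm
    have hm := sp_re h hu0 hbu hu3
    apply hu0
    refine hre (((1 - s : ℝ) : ℂ) * μ + s) ?_ u hu1 ?_
    · simp only [Complex.add_re, Complex.re_ofReal_mul, Complex.ofReal_re]
      by_cases hs : s = 1
      · subst hs; norm_num
      · have : s < 1 := lt_of_le_of_ne h1 hs
        nlinarith
    · rw [hc, Matrix.add_mulVec, Matrix.smul_mulVec, Matrix.smul_mulVec, hbu, hu3, add_smul, smul_smul]
  have hall' : ∀ v ∈ K, sp b *ᵥ v = 0 → v = 0 := by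
    by_contra hne
    push Not at hne
    obtain ⟨v, hvK, hv1, hv0⟩ := hne
    obtain ⟨μ, u, hu, hu0, hbu⟩ := exists_eig b (K ⊓ LinearMap.ker (Matrix.toLin' (sp b))) (by
      intro hbot
      have : v ∈ K ⊓ LinearMap.ker (Matrix.toLin' (sp b)) := ⟨hvK, by simp [hv1]⟩
      rw [hbot] at this
      exact hv0 (by simpa using this)) (by
      rintro x ⟨hx1, hx2⟩
      refine ⟨hKb x hx1 b hcb, ?_⟩
      simp only [SetLike.mem_coe, LinearMap.mem_ker, Matrix.toLin'_apply] at hx2 ⊢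
      rw [Matrix.mulVec_mulVec, hPb, ← Matrix.mulVec_mulVec, hx2, Matrix.mulVec_zero])
    obtain ⟨hu1, hu2⟩ := hu
    simp only [SetLike.mem_coe, LinearMap.mem_ker, Matrix.toLin'_apply] at hu2
    have hm := sp_re' h hu0 hbu hu2
    apply hu0
    refine hre (((1 - s : ℝ) : ℂ) * μ) ?_ u hu1 ?_
    · simp only [Complex.re_ofReal_mul]
      by_cases hs : s = 1
      · subst hs; norm_num
      · have : s < 1 := lt_of_le_of_ne h1 hs
        nlinarith
    · rw [hc, Matrix.add_mulVec, Matrix.smul_mulVec, Matrix.smul_mulVec, hbu, hu2, smul_smul]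
      simp
  have hwK : w ∈ K := (hK w).2 hw
  apply hw0
  apply hall' w hwK
  apply hall _ (hKb w hwK _ hcP)
  rw [Matrix.mulVec_mulVec, hP]

end spectral
end
end BP
end Part6

section Part7
open Matrix Kronecker Topology
namespace BP
set_option linter.unusedSectionVars false
set_option linter.unusedSimpArgs false
noncomputable section
open unitInterval

section pencil
variable {ι : Type} [Fintype ι] [DecidableEq ι] {D : ℕ}

/-- evaluation of polynomial -/
def pz (D : ℕ) (p : ℕ → Matrix ι ι ℂ) (z : ℂ) : Matrix ι ι ℂ := ∑ k ∈ Finset.range (D + 1), z ^ k • p k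

/-- tails -/
def tl (D : ℕ) (p : ℕ → Matrix ι ι ℂ) (j : ℕ) : Matrix ι ι ℂ :=
  ∑ k ∈ Finset.range (D + 1), if j < k then p k else 0

/-- the lower triangular matrix -/
def Nm (ι : Type) [DecidableEq ι] (D : ℕ) : Matrix (ι × Fin (D + 1)) (ι × Fin (D + 1)) ℂ :=
  Matrix.of fun a b => if b.2 < a.2 then (1 : Matrix ι ι ℂ) a.1 b.1 else 0

/-- normalised companion pencil -/
def bP (D : ℕ) (p : ℕ → Matrix ι ι ℂ) : Matrix (ι × Fin (D + 1)) (ι × Fin (D + 1)) ℂ :=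
  Matrix.of (fun a b => tl D p b.2 a.1 b.1) - Nm ι D

/-- column -/
def xm (ι : Type) [DecidableEq ι] (D : ℕ) (z : ℂ) : Matrix (ι × Fin (D + 1)) ι ℂ :=
  Matrix.of fun a c => z ^ (a.2 : ℕ) * (1 : Matrix ι ι ℂ) a.1 c

/-- row -/
def ym (D : ℕ) (p : ℕ → Matrix ι ι ℂ) (z : ℂ) : Matrix ι (ι × Fin (D + 1)) ℂ :=
  Matrix.of fun a b => (z - 1) * tl D p b.2 a b.1

/-- first block -/
def e0 (ι : Type) (D : ℕ) : ι ↪ ι × Fin (D + 1) := ⟨fun a => (a, 0), fun a b h => by simpa using h⟩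

theorem e0_apply (a : ι) : e0 ι D a = (a, 0) := rfl

theorem tl_sum (p : ℕ → Matrix ι ι ℂ) (z : ℂ) :
    ∑ j ∈ Finset.range (D + 1), ((z - 1) * z ^ j) • tl D p j = pz D p z - pz D p 1 := by
  simp only [tl, pz, Finset.smul_sum]
  rw [Finset.sum_comm, ← Finset.sum_sub_distrib]
  refine Finset.sum_congr rfl fun k hk => ?_
  have h1 : ∀ j, ((z - 1) * z ^ j) • (if j < k then p k else 0) =
      (if j < k then ((z - 1) * z ^ j) else 0) • p k := by
    intro j; split_ifs <;> simp
  simp_rw [h1]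
  rw [← Finset.sum_smul, ← Finset.sum_filter]
  have h2 : Finset.filter (fun j => j < k) (Finset.range (D + 1)) = Finset.range k := by
    ext j
    simp at hk ⊢
    omega
  rw [h2, ← Finset.mul_sum, ← sub_smul, one_pow, mul_geom_sum]

theorem yx (p : ℕ → Matrix ι ι ℂ) (z : ℂ) (hp : pz D p 1 = 1) :
    ym D p z * xm ι D z = pz D p z - 1 := by
  rw [← hp, ← tl_sum]
  ext a c
  simp only [Matrix.mul_apply, ym, xm, of_apply, Fintype.sum_prod_type, Matrix.sum_apply,
    Matrix.smul_apply, smul_eq_mul]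
  rw [Finset.sum_comm, Fin.sum_univ_eq_sum_range (n := D + 1)
    (f := fun j => ∑ x, (z - 1) * tl D p j a x * (z ^ j * (1 : Matrix ι ι ℂ) x c))]
  refine Finset.sum_congr rfl fun j _ => ?_
  simp only [Matrix.one_apply, mul_ite, mul_one, mul_zero, Finset.sum_ite_eq', Finset.mem_univ, if_true]
  ring

/-- column of ones -/
def em (ι : Type) [DecidableEq ι] (D : ℕ) : Matrix (ι × Fin (D + 1)) ι ℂ :=
  Matrix.of fun a c => (1 : Matrix ι ι ℂ) a.1 c

theorem Nx (z : ℂ) : (1 - (z - 1) • Nm ι D) * xm ι D z = em ι D := by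
  rw [Matrix.sub_mul, Matrix.one_mul, sub_eq_iff_eq_add, Matrix.smul_mul]
  ext ⟨a, i⟩ c
  simp only [Matrix.add_apply, Matrix.smul_apply, Matrix.mul_apply, Nm, xm, em, of_apply,
    Fintype.sum_prod_type, smul_eq_mul]
  rw [Finset.sum_comm]
  have : ∀ j : Fin (D + 1), (∑ x, (if j < i then (1 : Matrix ι ι ℂ) a x else 0) *
      (z ^ (j : ℕ) * (1 : Matrix ι ι ℂ) x c)) = (if (j : ℕ) < i then z ^ (j : ℕ) else 0) *
        (1 : Matrix ι ι ℂ) a c := by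
    intro j
    by_cases h : j < i
    · have h' : (j : ℕ) < i := h
      simp [h, h', Matrix.one_apply]
    · have h' : ¬ (j : ℕ) < i := h
      simp [h, h']
  simp_rw [this]
  rw [← Finset.sum_mul, Fin.sum_univ_eq_sum_range (n := D + 1)
    (f := fun j => if j < (i : ℕ) then z ^ j else 0), ← Finset.sum_filter]
  have h2 : Finset.filter (fun j => j < (i : ℕ)) (Finset.range (D + 1)) = Finset.range i := by
    ext j
    simp
    omega
  rw [h2, ← mul_assoc, mul_geom_sum]
  ring

theorem ey (p : ℕ → Matrix ι ι ℂ) (z : ℂ) :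
    em ι D * ym D p z = (z - 1) • (Matrix.of fun a b : ι × Fin (D + 1) => tl D p b.2 a.1 b.1) := by
  ext ⟨a, i⟩ ⟨c, j⟩
  simp [em, ym, Matrix.mul_apply, Matrix.one_apply]

theorem N_unit (w : ℂ) : IsUnit (1 - w • Nm ι D) := by
  rw [Matrix.isUnit_iff_isUnit_det, isUnit_iff_ne_zero, Ne, ← Matrix.exists_mulVec_eq_zero_iff]
  rintro ⟨v, hv0, hv⟩
  apply hv0
  have key : ∀ n : ℕ, ∀ a (i : Fin (D + 1)), (i : ℕ) = n → v (a, i) = 0 := by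
    intro n
    induction n using Nat.strong_induction_on with
    | _ n ih =>
      intro a i hi
      have h1 := congrFun hv (a, i)
      rw [Matrix.sub_mulVec, Matrix.one_mulVec, Matrix.smul_mulVec] at h1
      simp only [Pi.sub_apply, Pi.smul_apply, Pi.zero_apply] at h1
      have h2 : (Nm ι D *ᵥ v) (a, i) = 0 := by
        simp only [Matrix.mulVec, dotProduct]
        refine Finset.sum_eq_zero fun b _ => ?_
        obtain ⟨c, j⟩ := b
        simp only [Nm, of_apply]
        by_cases h : j < i
        · rw [ih j (by rw [← hi]; exact h) c j rfl, mul_zero]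
        · simp [h]
      rw [h2] at h1
      simpa using h1
  ext ⟨a, i⟩
  exact key i a i rfl

/-- homotopy from the stabilised polynomial to the pencil -/
def Phi (D : ℕ) (p : ℕ → Matrix ι ι ℂ) (z τ : ℂ) : Matrix (ι × Fin (D + 1)) (ι × Fin (D + 1)) ℂ :=
  (1 - (τ * (z - 1)) • Nm ι D) * (1 + τ • ((xm ι D z - J (e0 ι D)) * (J (e0 ι D))ᵀ)) *
    (1 + τ • (J (e0 ι D) * (ym D p z * (1 + (xm ι D z - J (e0 ι D)) * (J (e0 ι D))ᵀ)) *
      (1 - J (e0 ι D) * (J (e0 ι D))ᵀ))) * extM (e0 ι D) (pz D p z) *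
    (1 - τ • ((xm ι D z - J (e0 ι D)) * (J (e0 ι D))ᵀ))

theorem Phi_zero (p : ℕ → Matrix ι ι ℂ) (z : ℂ) : Phi D p z 0 = extM (e0 ι D) (pz D p z) := by
  simp [Phi]

theorem JX (z : ℂ) : (J (e0 ι D))ᵀ * (xm ι D z - J (e0 ι D)) = 0 := by
  rw [Matrix.mul_sub, JT_J, sub_eq_zero]
  ext a c
  simp only [Matrix.mul_apply, J, xm, e0_apply, Matrix.one_apply, of_apply, transpose_apply]
  rw [Finset.sum_eq_single (a, 0)]
  · simp
  · intro b _ hb; simp [hb]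
  · simp

theorem UU (z τ : ℂ) : (1 + τ • ((xm ι D z - J (e0 ι D)) * (J (e0 ι D))ᵀ)) *
    (1 - τ • ((xm ι D z - J (e0 ι D)) * (J (e0 ι D))ᵀ)) = 1 := by
  have h : ((xm ι D z - J (e0 ι D)) * (J (e0 ι D))ᵀ) * ((xm ι D z - J (e0 ι D)) * (J (e0 ι D))ᵀ) = 0 := by
    rw [Matrix.mul_assoc, ← Matrix.mul_assoc _ _ (J (e0 ι D))ᵀ, JX]
    simp
  simp only [mul_sub, add_mul, mul_one, one_mul, Matrix.smul_mul, Matrix.mul_smul, h, smul_zero]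
  abel

theorem Phi_unit (p : ℕ → Matrix ι ι ℂ) (z τ : ℂ) (h : IsUnit (pz D p z)) : IsUnit (Phi D p z τ) := by
  have h1 := UU (ι := ι) (D := D) z τ
  have h2 := mul_eq_one_comm.1 h1
  refine IsUnit.mul (IsUnit.mul (IsUnit.mul (IsUnit.mul (N_unit _) ?_) ?_) (h.map _)) ?_
  · exact ⟨⟨_, _, h1, h2⟩, rfl⟩
  · set c := ym D p z * (1 + (xm ι D z - J (e0 ι D)) * (J (e0 ι D))ᵀ)
    have h3 : (1 - J (e0 ι D) * (J (e0 ι D))ᵀ) * J (e0 ι D) = 0 := by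
      rw [Matrix.sub_mul, Matrix.mul_assoc, JT_J]; simp
    have h4 : (J (e0 ι D) * c * (1 - J (e0 ι D) * (J (e0 ι D))ᵀ)) *
        (J (e0 ι D) * c * (1 - J (e0 ι D) * (J (e0 ι D))ᵀ)) = 0 := by
      rw [Matrix.mul_assoc (J (e0 ι D) * c), Matrix.mul_assoc (J (e0 ι D)) c (1 - J (e0 ι D) * (J (e0 ι D))ᵀ),
        ← Matrix.mul_assoc (1 - J (e0 ι D) * (J (e0 ι D))ᵀ) (J (e0 ι D)), h3]
      simp
    set W := J (e0 ι D) * c * (1 - J (e0 ι D) * (J (e0 ι D))ᵀ)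
    have h5 : (1 + τ • W) * (1 - τ • W) = 1 := by
      simp only [mul_sub, add_mul, mul_one, one_mul, Matrix.smul_mul, Matrix.mul_smul, h4, smul_zero]
      abel
    exact ⟨⟨_, _, h5, mul_eq_one_comm.1 h5⟩, rfl⟩
  · exact ⟨⟨_, _, h2, h1⟩, rfl⟩

theorem Phi_at_one (p : ℕ → Matrix ι ι ℂ) (τ : ℂ) (hp : pz D p 1 = 1) : Phi D p 1 τ = 1 := by
  have hy : ym D p 1 = 0 := by ext; simp [ym]
  have := UU (ι := ι) (D := D) 1 τ
  simp only [Phi, hp, hy, sub_self, mul_zero, zero_smul, sub_zero, Matrix.zero_mul, Matrix.mul_zero,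
    smul_zero, add_zero, mul_one, one_mul, map_one]
  exact this

theorem Phi_one (p : ℕ → Matrix ι ι ℂ) (z : ℂ) (hp : pz D p 1 = 1) :
    Phi D p z 1 = 1 + (z - 1) • bP D p := by
  unfold Phi
  simp only [one_mul, one_smul]
  have hU := UU (ι := ι) (D := D) z 1
  simp only [one_smul] at hU
  set Jm := J (e0 ι D) with hJm
  have hJ : Jmᵀ * Jm = 1 := JT_J _
  set X := xm ι D z - Jm with hX
  have hUJ : (1 + X * Jmᵀ) * Jm = xm ι D z := by
    rw [Matrix.add_mul, Matrix.mul_assoc, hJ]; simp [hX]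
  set U := 1 + X * Jmᵀ with hUd
  have h1 : (1 + Jm * (ym D p z * U) * (1 - Jm * Jmᵀ)) * extM (e0 ι D) (pz D p z) =
      1 + Jm * (ym D p z * U) := by
    have h2 : (1 - Jm * Jmᵀ) * extM (e0 ι D) (pz D p z) = 1 - Jm * Jmᵀ := by
      rw [extM_def, mul_add, ← Matrix.mul_assoc, ← Matrix.mul_assoc]
      have : (1 - Jm * Jmᵀ) * Jm = 0 := by rw [Matrix.sub_mul, Matrix.mul_assoc, hJ]; simp
      rw [this]
      simp
    rw [add_mul, Matrix.mul_assoc, h2, extM_def, ← yx p z hp, ← hUJ, ← hJm]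
    simp only [Matrix.mul_sub, Matrix.mul_one, Matrix.one_mul, Matrix.mul_assoc]
    abel
  calc (1 - (z - 1) • Nm ι D) * U * (1 + Jm * (ym D p z * U) * (1 - Jm * Jmᵀ)) *
        extM (e0 ι D) (pz D p z) * (1 - X * Jmᵀ)
      = (1 - (z - 1) • Nm ι D) * (U * (1 + Jm * (ym D p z * U)) * (1 - X * Jmᵀ)) := by
        rw [← h1]; simp only [Matrix.mul_assoc]
    _ = (1 - (z - 1) • Nm ι D) * (1 + xm ι D z * ym D p z) := by
        congr 1
        rw [mul_add, add_mul, mul_one, hU, ← hUJ]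
        congr 1
        calc U * (Jm * (ym D p z * U)) * (1 - X * Jmᵀ) = U * Jm * ym D p z * (U * (1 - X * Jmᵀ)) := by
              simp only [Matrix.mul_assoc]
          _ = _ := by rw [hU, Matrix.mul_one]
    _ = 1 + (z - 1) • bP D p := by
        rw [mul_add, ← Matrix.mul_assoc, Nx, ey, mul_one, bP, smul_sub]
        abel

theorem bP_Reg (p : ℕ → Matrix ι ι ℂ) (hp : pz D p 1 = 1) (h : ∀ z : Circle, IsUnit (pz D p z)) :
    Reg (bP D p) := by
  intro z
  rw [← Phi_one p z hp]
  exact Phi_unit p z 1 (h z)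

section cont
variable {Z : Type} [TopologicalSpace Z] {p : ℕ → Z → Matrix ι ι ℂ}

theorem tl_cont (hp : ∀ k, Continuous (p k)) (j : ℕ) : Continuous fun y => tl D (fun k => p k y) j := by
  unfold tl
  refine continuous_finsetSum _ fun k _ => ?_
  by_cases h : j < k
  · simpa [h] using hp k
  · simpa [h] using continuous_const

theorem pz_cont (hp : ∀ k, Continuous (p k)) {z : Z → ℂ} (hz : Continuous z) : Continuous fun y => pz D (fun k => p k y) (z y) := by
  unfold pz
  refine continuous_finsetSum _ fun k _ => ?_
  exact (hz.pow k).smul (hp k)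

theorem bP_cont (hp : ∀ k, Continuous (p k)) : Continuous fun y => bP D (fun k => p k y) := by
  unfold bP
  refine Continuous.sub ?_ continuous_const
  refine continuous_matrix fun a b => ?_
  exact (tl_cont hp _).matrix_elem _ _

theorem Phi_cont (hp : ∀ k, Continuous (p k)) {z τ : Z → ℂ} (hz : Continuous z) (hτ : Continuous τ) :
    Continuous fun y => Phi D (fun k => p k y) (z y) (τ y) := by
  have h1 : Continuous fun y => xm ι D (z y) := by
    refine continuous_matrix fun a b => ?_
    simp only [xm, of_apply]
    fun_prop
  have h2 : Continuous fun y => ym D (fun k => p k y) (z y) := by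
    refine continuous_matrix fun a b => ?_
    simp only [ym, of_apply]
    exact (hz.sub continuous_const).mul ((tl_cont hp _).matrix_elem _ _)
  have h3 : Continuous fun y => extM (e0 ι D) (pz D (fun k => p k y) (z y)) :=
    (extM_continuous _).comp (pz_cont hp hz)
  have h4 : Continuous fun y => (xm ι D (z y) - J (e0 ι D)) * (J (e0 ι D))ᵀ :=
    (h1.sub continuous_const).matrix_mul continuous_const
  have h5 : Continuous fun y => τ y • ((xm ι D (z y) - J (e0 ι D)) * (J (e0 ι D))ᵀ) := hτ.smul h4
  have h6 : Continuous fun y => (1 - (τ y * (z y - 1)) • Nm ι D) :=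
    continuous_const.sub ((hτ.mul (hz.sub continuous_const)).smul continuous_const)
  have h7 : Continuous fun y => τ y • (J (e0 ι D) * (ym D (fun k => p k y) (z y) *
      (1 + (xm ι D (z y) - J (e0 ι D)) * (J (e0 ι D))ᵀ)) * (1 - J (e0 ι D) * (J (e0 ι D))ᵀ)) :=
    hτ.smul ((continuous_const.matrix_mul (h2.matrix_mul (continuous_const.add h4))).matrix_mul
      continuous_const)
  unfold Phi
  exact (((h6.mul (continuous_const.add h5)).mul (continuous_const.add h7)).mul h3).mul
    (continuous_const.sub h5)

end cont

/-- block diagonal coordinate idempotent -/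
def Ed (D d : ℕ) (Q : Matrix ι ι ℂ) : Matrix (ι × Fin (D + 1)) (ι × Fin (D + 1)) ℂ :=
  Matrix.of fun a b => if a.2 = b.2 then
    (if (a.2 : ℕ) < d then (1 : Matrix ι ι ℂ) else if (a.2 : ℕ) = d then Q else 0) a.1 b.1 else 0

theorem tl_bdry (d : ℕ) (hd : d + 1 ≤ D) (Q : Matrix ι ι ℂ) (p : ℕ → Matrix ι ι ℂ)
    (hp : ∀ k, p k = if k = d then 1 - Q else if k = d + 1 then Q else 0) (j : ℕ) :
    tl D p j = if j < d then (1 : Matrix ι ι ℂ) else if j = d then Q else 0 := by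
  unfold tl
  have h1 : ∀ k, (if j < k then p k else 0) = (if d = k then (if j < d then 1 - Q else 0) else 0) +
      (if d + 1 = k then (if j < d + 1 then Q else 0) else 0) := by
    intro k
    rw [hp]
    by_cases h1 : k = d
    · subst h1; simp
    · by_cases h2 : k = d + 1
      · subst h2; simp
      · have h3 : ¬ d = k := fun h => h1 h.symm
        have h4 : ¬ d + 1 = k := fun h => h2 h.symm
        simp [h1, h2, h3, h4]
  simp_rw [h1]
  rw [Finset.sum_add_distrib, Finset.sum_ite_eq, Finset.sum_ite_eq]
  have a1 : d ∈ Finset.range (D + 1) := by simp; omega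
  have a2 : d + 1 ∈ Finset.range (D + 1) := by simp; omega
  simp only [a1, a2, if_true]
  by_cases h2 : j < d
  · have : j < d + 1 := by omega
    simp [h2, this]
  · by_cases h3 : j = d
    · subst h3; simp
    · have : ¬ j < d + 1 := by omega
      simp [h2, h3, this]

theorem sp_bdry (d : ℕ) (hd : d + 1 ≤ D) (Q : Matrix ι ι ℂ) (hQ : Q * Q = Q) (p : ℕ → Matrix ι ι ℂ)
    (hp : ∀ k, p k = if k = d then 1 - Q else if k = d + 1 then Q else 0)
    (hr : Reg (bP D p)) : sp (bP D p) = Ed D d Q := by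
  let T : ℕ → Matrix ι ι ℂ := fun j => if j < d then (1 : Matrix ι ι ℂ) else if j = d then Q else 0
  have hT : ∀ j, tl D p j = T j := tl_bdry d hd Q p hp
  have hTT : ∀ i j, T i * T j = T (max i j) := by
    intro i j
    simp only [T]
    rcases lt_trichotomy i d with h1 | h1 | h1 <;> rcases lt_trichotomy j d with h2 | h2 | h2
    all_goals
      simp only [h1, h2, if_true, max_lt_iff, lt_irrefl, if_false, true_and, and_true, false_and, and_false,
        one_mul, mul_one, max_self, hQ]
    all_goals try
      have h1' := h1.not_gt
    all_goals try
      have h2' := h2.not_gt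
    all_goals try
      have h1'' := h1.ne
    all_goals try
      have h2'' := h2.ne
    all_goals try
      have h1''' := h1.ne'
    all_goals try
      have h2''' := h2.ne'
    all_goals
      simp [*, max_eq_left, max_eq_right, le_of_lt]
    all_goals
      grind
  have hE : ∀ a b : ι × Fin (D + 1), Ed D d Q a b = if a.2 = b.2 then T a.2 a.1 b.1 else 0 := fun a b => rfl
  have hb : ∀ a b : ι × Fin (D + 1), bP D p a b = T b.2 a.1 b.1 -
      if b.2 < a.2 then (1 : Matrix ι ι ℂ) a.1 b.1 else 0 := by
    intro a b
    simp only [bP, Matrix.sub_apply, of_apply, hT, Nm]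
  have hEl : ∀ (M : Matrix (ι × Fin (D + 1)) (ι × Fin (D + 1)) ℂ) a i b,
      (Ed D d Q * M) (a, i) b = ∑ c, T i a c * M (c, i) b := by
    intro M a i b
    rw [Matrix.mul_apply, Fintype.sum_prod_type]
    refine Finset.sum_congr rfl fun c _ => ?_
    rw [Finset.sum_eq_single i]
    · simp [hE]
    · intro j _ hj; simp [hE, hj.symm]
    · simp
  have hEr : ∀ (M : Matrix (ι × Fin (D + 1)) (ι × Fin (D + 1)) ℂ) a b j,
      (M * Ed D d Q) a (b, j) = ∑ c, M a (c, j) * T j c b := by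
    intro M a b j
    rw [Matrix.mul_apply, Fintype.sum_prod_type]
    refine Finset.sum_congr rfl fun c _ => ?_
    rw [Finset.sum_eq_single j]
    · simp [hE]
    · intro i _ hi; simp [hE, hi]
    · simp
  have hEv : ∀ (v : ι × Fin (D + 1) → ℂ) a i, (Ed D d Q *ᵥ v) (a, i) = ∑ c, T i a c * v (c, i) := by
    intro v a i
    rw [Matrix.mulVec, dotProduct, Fintype.sum_prod_type]
    refine Finset.sum_congr rfl fun c _ => ?_
    rw [Finset.sum_eq_single i]
    · simp [hE]
    · intro j _ hj; simp [hE, hj.symm]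
    · simp
  have hbv : ∀ (v : ι × Fin (D + 1) → ℂ) a i, (bP D p *ᵥ v) (a, i) =
      ∑ j, (Ed D d Q *ᵥ v) (a, j) - ∑ j, if j < i then v (a, j) else 0 := by
    intro v a i
    rw [Matrix.mulVec, dotProduct, Fintype.sum_prod_type, Finset.sum_comm, ← Finset.sum_sub_distrib]
    refine Finset.sum_congr rfl fun j _ => ?_
    rw [hEv]
    simp only [hb, sub_mul, Finset.sum_sub_distrib]
    congr 1
    by_cases h : j < i
    · simp [h, Matrix.one_apply]
    · simp [h]
  apply sp_unique hr
  · ext ⟨a, i⟩ ⟨b, j⟩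
    rw [hEl]
    simp only [hE]
    by_cases h : i = j
    · subst h
      simp only [if_true]
      rw [← Matrix.mul_apply, hTT, max_self]
    · simp [h]
  · ext ⟨a, i⟩ ⟨b, j⟩
    rw [hEl, hEr]
    simp only [hb, mul_sub, sub_mul, Finset.sum_sub_distrib]
    rw [← Matrix.mul_apply, ← Matrix.mul_apply, hTT, hTT, max_self]
    by_cases h : j < i
    · have h' : max (i : ℕ) (j : ℕ) = i := max_eq_left (le_of_lt h)
      simp [h, h', Matrix.one_apply]
    · have h' : max (i : ℕ) (j : ℕ) = j := max_eq_right (not_lt.1 h)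
      simp [h, h']
  · intro μ v hEv1 hv0 hbv1
    by_contra hμ
    apply hv0
    have key : ∀ n : ℕ, ∀ a (i : Fin (D + 1)), D - (i : ℕ) = n → v (a, i) = 0 := by
      intro n
      induction n using Nat.strong_induction_on with
      | _ n ih =>
        intro a i hi
        have h1 := hbv v a i
        rw [hbv1, hEv1, ← Finset.sum_sub_distrib] at h1
        rw [Finset.sum_eq_single i] at h1
        · simp only [Pi.smul_apply, smul_eq_mul, lt_irrefl, if_false, sub_zero] at h1
          have h2 : (μ - 1) * v (a, i) = 0 := by rw [sub_mul, h1]; ring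
          rcases mul_eq_zero.1 h2 with h3 | h3
          · exact absurd (sub_eq_zero.1 h3) hμ
          · exact h3
        · intro j _ hj
          by_cases hlt : j < i
          · simp [hlt]
          · have hij : i < j := lt_of_le_of_ne (not_lt.1 hlt) hj.symm
            have hij' : (i : ℕ) < j := hij
            rw [ih (D - j) (by omega) a j rfl]
            simp
        · simp
    ext ⟨a, i⟩
    exact key _ a i rfl
  · intro μ v hEv1 hv0 hbv1
    by_contra hμ
    apply hv0
    have key : ∀ n : ℕ, ∀ a (i : Fin (D + 1)), (i : ℕ) = n → v (a, i) = 0 := by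
      intro n
      induction n using Nat.strong_induction_on with
      | _ n ih =>
        intro a i hi
        have h1 := hbv v a i
        rw [hbv1, hEv1] at h1
        rw [Finset.sum_eq_zero (f := fun j => if j < i then v (a, j) else 0)] at h1
        · simpa [hμ] using h1
        · intro j _
          by_cases hlt : j < i
          · rw [if_pos hlt]
            exact ih j (by rw [← hi]; exact hlt) a j rfl
          · simp [hlt]
    ext ⟨a, i⟩
    exact key _ a i rfl

end pencil
end
end BP
end Part7

section Part8
open Matrix Kronecker Topology
namespace BP
set_option linter.unusedSectionVars false
set_option linter.unusedSimpArgs false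
noncomputable section
open unitInterval

section zeta
variable {ι : Type} [Fintype ι] [DecidableEq ι] {κ : Type} [Fintype κ] [DecidableEq κ]
variable {Y : Type} [TopologicalSpace Y]

theorem ec_cont_coe : Continuous fun t : I => ((ec t : Circle) : ℂ) :=
  continuous_induced_dom.comp ec.continuous

theorem Ht_ratio {Z : Type} [TopologicalSpace Z] {S : Set Z} (M N : C(Z × I, GL κ ℂ))
    (h : ∀ z ∈ S, ∀ t, M (z, t) = N (z, t)) {f g : C(Z, GL κ ℂ)}
    (hf : ∀ z, f z = M (z, 0) * (N (z, 0))⁻¹) (hg : ∀ z, g z = M (z, 1) * (N (z, 1))⁻¹) : Ht S f g := by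
  refine Ht.of_homotopy (M * N⁻¹) ?_ ?_ ?_
  · intro z; simp [hf]
  · intro z; simp [hg]
  · intro z hz t
    simp [hf, h z hz]

/-- the clutching family `1 + (z-1) b` -/
def zt (b : Y → Matrix κ κ ℂ) (hb : Continuous b) (h : ∀ y, Reg (b y)) : C(Y × I, GL κ ℂ) :=
  mkGL (fun p => 1 + ((ec p.2 : ℂ) - 1) • b p.1) (by
    have h1 : Continuous fun p : Y × I => ((ec p.2 : Circle) : ℂ) := ec_cont_coe.comp continuous_snd
    have h2 : Continuous fun p : Y × I => b p.1 := hb.comp continuous_fst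
    exact continuous_const.add ((h1.sub continuous_const).smul h2)) (fun p => h p.1 _)

theorem zt_val (b : Y → Matrix κ κ ℂ) (hb : Continuous b) (h : ∀ y, Reg (b y)) (y : Y) (t : I) :
    ((zt b hb h (y, t) : GL κ ℂ) : Matrix κ κ ℂ) = 1 + ((ec t : ℂ) - 1) • b y := mkGL_val _ _ _ _

theorem Reg_idem {P : Matrix κ κ ℂ} (hP : P * P = P) : Reg P := by
  intro z
  have hz : (z : ℂ) ≠ 0 := Circle.coe_ne_zero z
  have : (1 + ((z : ℂ) - 1) • P) * (1 + ((z : ℂ)⁻¹ - 1) • P) = 1 := by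
    simp only [mul_add, add_mul, mul_one, one_mul, Matrix.smul_mul, Matrix.mul_smul, hP, smul_smul]
    have : ((z : ℂ) - 1) + ((z : ℂ)⁻¹ - 1) + ((z : ℂ)⁻¹ - 1) * ((z : ℂ) - 1) = 0 := by
      field_simp
      ring
    calc _ = 1 + (((z : ℂ) - 1) + ((z : ℂ)⁻¹ - 1) + ((z : ℂ)⁻¹ - 1) * ((z : ℂ) - 1)) • P := by
          module
      _ = 1 := by rw [this]; simp
  exact ⟨⟨_, _, this, mul_eq_one_comm.1 this⟩, rfl⟩

/-- polynomial family -/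
def pzG (D : ℕ) (p : ℕ → Y → Matrix ι ι ℂ) (hp : ∀ k, Continuous (p k))
    (hu : ∀ y (z : Circle), IsUnit (pz D (fun k => p k y) z)) : C(Y × I, GL ι ℂ) :=
  mkGL (fun q => pz D (fun k => p k q.1) (ec q.2 : ℂ))
    (pz_cont (p := fun k (q : Y × I) => p k q.1) (fun k => (hp k).comp continuous_fst)
      (ec_cont_coe.comp continuous_snd)) (fun q => hu q.1 _)

theorem pencil_ratio {D : ℕ} {T : Set Y} (p q : ℕ → Y → Matrix ι ι ℂ) (hp : ∀ k, Continuous (p k))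
    (hq : ∀ k, Continuous (q k)) (hpu : ∀ y (z : Circle), IsUnit (pz D (fun k => p k y) z))
    (hqu : ∀ y (z : Circle), IsUnit (pz D (fun k => q k y) z))
    (hp1 : ∀ y, pz D (fun k => p k y) 1 = 1) (hq1 : ∀ y, pz D (fun k => q k y) 1 = 1)
    (hT : ∀ y ∈ T, ∀ k, p k y = q k y) (b c : Y → Matrix (ι × Fin (D + 1)) (ι × Fin (D + 1)) ℂ)
    (hb : Continuous b) (hc : Continuous c) (hbr : ∀ y, Reg (b y)) (hcr : ∀ y, Reg (c y))
    (hbs : ∀ y, b y = sp (bP D (fun k => p k y))) (hcs : ∀ y, c y = sp (bP D (fun k => q k y))) :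
    Ht (bd T) (pe (e0 ι D) (pzG D p hp hpu * (pzG D q hq hqu)⁻¹)) (zt b hb hbr * (zt c hc hcr)⁻¹) := by
  have hec : Continuous fun w : (Y × I) × I => ((ec w.1.2 : Circle) : ℂ) :=
    ec_cont_coe.comp (continuous_snd.comp continuous_fst)
  have hτ : Continuous fun w : (Y × I) × I => (((w.2 : I) : ℝ) : ℂ) := by fun_prop
  have hτ' : Continuous fun w : (Y × I) × I => ((1 - ((w.2 : I) : ℝ) : ℝ) : ℂ) := by fun_prop
  -- first homotopy
  let M1 : (p : ℕ → Y → Matrix ι ι ℂ) → (hp : ∀ k, Continuous (p k)) →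
      (hpu : ∀ y (z : Circle), IsUnit (pz D (fun k => p k y) z)) →
      C((Y × I) × I, GL (ι × Fin (D + 1)) ℂ) := fun p hp hpu =>
    mkGL (fun w => Phi D (fun k => p k w.1.1) (ec w.1.2 : ℂ) ((w.2 : ℝ) : ℂ))
      (Phi_cont (p := fun k (w : (Y × I) × I) => p k w.1.1)
        (fun k => (hp k).comp (continuous_fst.comp continuous_fst)) hec hτ)
      (fun w => Phi_unit _ _ _ (hpu _ _))
  have hM1 : ∀ p hp hpu w, ((M1 p hp hpu w : GL (ι × Fin (D + 1)) ℂ) : Matrix _ _ ℂ) =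
      Phi D (fun k => p k w.1.1) (ec w.1.2 : ℂ) ((w.2 : ℝ) : ℂ) := fun p hp hpu w => mkGL_val _ _ _ _
  let M2 : (p : ℕ → Y → Matrix ι ι ℂ) → (hp : ∀ k, Continuous (p k)) →
      (hpu : ∀ y (z : Circle), IsUnit (pz D (fun k => p k y) z)) →
      (hp1 : ∀ y, pz D (fun k => p k y) 1 = 1) →
      C((Y × I) × I, GL (ι × Fin (D + 1)) ℂ) := fun p hp hpu hp1 =>
    mkGL (fun w => 1 + ((ec w.1.2 : ℂ) - 1) • (((1 - (w.2 : ℝ) : ℝ) : ℂ) • bP D (fun k => p k w.1.1) +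
        ((w.2 : ℝ) : ℂ) • sp (bP D (fun k => p k w.1.1))))
      (by
        have h1 : Continuous fun w : (Y × I) × I => bP D (fun k => p k w.1.1) :=
          (bP_cont hp).comp (continuous_fst.comp continuous_fst)
        have h2 : Continuous fun w : (Y × I) × I => sp (bP D (fun k => p k w.1.1)) :=
          (sp_continuous (bP_cont hp) (fun y => bP_Reg _ (hp1 y) (hpu y))).comp
            (continuous_fst.comp continuous_fst)
        exact continuous_const.add ((hec.sub continuous_const).smul ((hτ'.smul h1).add (hτ.smul h2))))
      (fun w => sp_line (bP_Reg _ (hp1 _) (hpu _)) _ w.2.2.1 w.2.2.2 _)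
  have hM2 : ∀ p hp hpu hp1 w, ((M2 p hp hpu hp1 w : GL (ι × Fin (D + 1)) ℂ) : Matrix _ _ ℂ) =
      1 + ((ec w.1.2 : ℂ) - 1) • (((1 - (w.2 : ℝ) : ℝ) : ℂ) • bP D (fun k => p k w.1.1) +
        ((w.2 : ℝ) : ℂ) • sp (bP D (fun k => p k w.1.1))) := fun p hp hpu hp1 w => mkGL_val _ _ _ _
  have hpzG : ∀ p hp hpu w, ((pzG D p hp hpu w : GL ι ℂ) : Matrix ι ι ℂ) =
      pz D (fun k => p k (w : Y × I).1) (ec w.2 : ℂ) := fun p hp hpu w => mkGL_val _ _ _ _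
  have e1 : ∀ p hp hpu z, ext (e0 ι D) (pzG D p hp hpu z) = M1 p hp hpu (z, 0) := by
    intro p hp hpu z
    apply Units.ext
    rw [hM1 p hp hpu, ext_val, hpzG p hp hpu]
    simp [Phi_zero]
  have e2 : ∀ p hp hpu hp1 z, M1 p hp hpu (z, 1) = M2 p hp hpu hp1 (z, 0) := by
    intro p hp hpu hp1 z
    apply Units.ext
    rw [hM1 p hp hpu, hM2 p hp hpu hp1]
    simp [Phi_one _ _ (hp1 _)]
  have hbdry : ∀ z ∈ bd T, (∀ k, p k z.1 = q k z.1) ∨ ec z.2 = 1 := by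
    rintro ⟨y, t⟩ (h | h | h)
    · exact Or.inl (hT y h)
    · right; simp only at h; subst h; exact ec_zero
    · right; simp only at h; subst h; exact ec_one
  refine Ht.trans (g := ⟨fun z => M1 p hp hpu (z, 1) * (M1 q hq hqu (z, 1))⁻¹, by fun_prop⟩) ?_ ?_
  · refine Ht_ratio (M1 p hp hpu) (M1 q hq hqu) ?_ ?_ ?_
    · intro z hz t
      apply Units.ext
      rw [hM1 p hp hpu, hM1 q hq hqu]
      rcases hbdry z hz with h | h
      · simp [h]
      · simp only [h, Circle.coe_one]
        rw [Phi_at_one _ _ (hp1 _), Phi_at_one _ _ (hq1 _)]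
    · intro z
      simp [← e1]
    · intro z; rfl
  · refine Ht_ratio (M2 p hp hpu hp1) (M2 q hq hqu hq1) ?_ ?_ ?_
    · intro z hz t
      apply Units.ext
      rw [hM2 p hp hpu hp1, hM2 q hq hqu hq1]
      rcases hbdry z hz with h | h
      · simp [h]
      · simp [h]
    · intro z
      simp [e2 p hp hpu hp1, e2 q hq hqu hq1]
    · rintro ⟨y, t⟩
      have a1 : zt b hb hbr (y, t) = M2 p hp hpu hp1 ((y, t), 1) := by
        apply Units.ext
        rw [hM2 p hp hpu hp1, zt_val]
        simp [hbs]
      have a2 : zt c hc hcr (y, t) = M2 q hq hqu hq1 ((y, t), 1) := by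
        apply Units.ext
        rw [hM2 q hq hqu hq1, zt_val]
        simp [hcs]
      simp [a1, a2]

theorem laurent_norm [CompactSpace Y] [T2Space Y] (T : Set Y) (F : Y × Circle → Matrix ι ι ℂ)
    (hF : Continuous F) (hFu : ∀ w, IsUnit (F w)) (hF1 : ∀ y, F (y, 1) = 1)
    (Q : Y → Matrix ι ι ℂ) (hQ : Continuous Q)
    (hS : ∀ y ∈ T, ∀ z : Circle, F (y, z) = 1 + ((z : ℂ) - 1) • Q y) :
    ∃ (d : ℕ) (p : ℕ → Y → Matrix ι ι ℂ), 1 ≤ d ∧ (∀ k, Continuous (p k)) ∧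
      (∀ y ∈ T, ∀ k, p k y = if k = d then 1 - Q y else if k = d + 1 then Q y else 0) ∧
      (∀ y, pz (2 * d) (fun k => p k y) 1 = 1) ∧
      (∀ y (z : Circle), IsUnit (pz (2 * d) (fun k => p k y) z)) ∧
      ∃ K : (Y × Circle) × I → Matrix ι ι ℂ, Continuous K ∧ (∀ w, IsUnit (K w)) ∧
        (∀ w, K (w, 0) = F w) ∧
        (∀ y (z : Circle), K ((y, z), 1) = ((z : ℂ) ^ d)⁻¹ • pz (2 * d) (fun k => p k y) z) ∧
        (∀ y t, K ((y, 1), t) = 1) ∧ (∀ y ∈ T, ∀ z t, K ((y, z), t) = F (y, z)) := by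
  obtain ⟨ε, hε, hunit⟩ := isUnit_near F hF hFu
  obtain ⟨d, p, hd, hpc, hpT, happ⟩ := laurent_mat T F hF Q hQ hS hε
  let L : Y × Circle → Matrix ι ι ℂ := fun w => ((w.2 : ℂ) ^ d)⁻¹ • pz (2 * d) (fun k => p k w.1) w.2
  have hcz : Continuous fun w : Y × Circle => (w.2 : ℂ) := continuous_induced_dom.comp continuous_snd
  have hLc : Continuous L := by
    refine Continuous.smul ((hcz.pow d).inv₀ fun w => pow_ne_zero _ (Circle.coe_ne_zero _)) ?_
    exact pz_cont (p := fun k (w : Y × Circle) => p k w.1) (fun k => (hpc k).comp continuous_fst) hcz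
  let K0 : (Y × Circle) × I → Matrix ι ι ℂ := fun w =>
    ((1 - (w.2 : ℝ) : ℝ) : ℂ) • F w.1 + ((w.2 : ℝ) : ℂ) • L w.1
  have hK0c : Continuous K0 := by
    have h1 : Continuous fun w : (Y × Circle) × I => ((1 - (w.2 : ℝ) : ℝ) : ℂ) := by fun_prop
    have h2 : Continuous fun w : (Y × Circle) × I => ((w.2 : ℝ) : ℂ) := by fun_prop
    exact (h1.smul (hF.comp continuous_fst)).add (h2.smul (hLc.comp continuous_fst))
  have hK0u : ∀ w, IsUnit (K0 w) := by
    rintro ⟨⟨y, z⟩, t⟩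
    apply hunit (y, z)
    intro i j
    have : K0 ((y, z), t) i j - F (y, z) i j = ((t : ℝ) : ℂ) * (L (y, z) i j - F (y, z) i j) := by
      simp only [K0, Matrix.add_apply, Matrix.smul_apply, smul_eq_mul]
      push_cast
      ring
    rw [this, norm_mul]
    have h1 := happ y z i j
    have h2 : ‖((t : ℝ) : ℂ)‖ ≤ 1 := by
      rw [Complex.norm_real, Real.norm_eq_abs, abs_of_nonneg t.2.1]; exact t.2.2
    exact lt_of_le_of_lt (mul_le_of_le_one_left (norm_nonneg _) h2) h1
  have hK0T : ∀ y ∈ T, ∀ z t, K0 ((y, z), t) = F (y, z) := by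
    intro y hy z t
    have : L (y, z) = F (y, z) := by
      rw [hS y hy]
      simp only [L, pz, hpT y hy]
      have h1 : ∀ k, (z : ℂ) ^ k • (if k = d then 1 - Q y else if k = d + 1 then Q y else 0) =
        (if d = k then (z : ℂ) ^ d • (1 - Q y) else 0) +
          (if d + 1 = k then (z : ℂ) ^ (d + 1) • Q y else 0) := by
        intro k
        by_cases h1 : k = d
        · subst h1; simp
        · by_cases h2 : k = d + 1
          · subst h2; simp
          · have h3 : ¬ d = k := fun h => h1 h.symm
            have h4 : ¬ d + 1 = k := fun h => h2 h.symm
            simp [h1, h2, h3, h4]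
      simp_rw [h1]
      rw [Finset.sum_add_distrib, Finset.sum_ite_eq, Finset.sum_ite_eq]
      have a1 : d ∈ Finset.range (2 * d + 1) := by simp; omega
      have a2 : d + 1 ∈ Finset.range (2 * d + 1) := by simp; omega
      simp only [a1, a2, if_true]
      rw [smul_add, smul_smul, smul_smul, pow_succ, ← mul_assoc,
        inv_mul_cancel₀ (pow_ne_zero _ (Circle.coe_ne_zero _))]
      module
    simp only [K0, this]
    rw [← add_smul]
    simp
  have hLu : ∀ w, IsUnit (L w) := by
    intro w
    have := hK0u (w, 1)
    simpa [K0] using this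
  have hcc : Continuous fun w : (Y × Circle) × I => (((w.1.1, 1), w.2) : (Y × Circle) × I) := by fun_prop
  have hL1 : ∀ y, L (y, 1) = pz (2 * d) (fun k => p k y) 1 := by intro y; simp [L]
  have hLz : ∀ y (z : Circle), pz (2 * d) (fun k => p k y) z = (z : ℂ) ^ d • L (y, z) := by
    intro y z
    simp only [L]
    rw [smul_smul, mul_inv_cancel₀ (pow_ne_zero _ (Circle.coe_ne_zero _)), one_smul]
  have hpz' : ∀ y (z : ℂ), pz (2 * d) (fun k => p k y * (L (y, 1))⁻¹) z =
      pz (2 * d) (fun k => p k y) z * (L (y, 1))⁻¹ := by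
    intro y z
    simp only [pz, Finset.sum_mul, Matrix.smul_mul]
  have hdet : ∀ w, IsUnit (L w).det := fun w => (Matrix.isUnit_iff_isUnit_det _).1 (hLu w)
  refine ⟨d, fun k y => p k y * (L (y, 1))⁻¹, hd, ?_, ?_, ?_, ?_,
    fun w => K0 w * (K0 ((w.1.1, 1), w.2))⁻¹, ?_, ?_, ?_, ?_, ?_, ?_⟩
  · intro k
    have : Continuous fun y => L (y, 1) := hLc.comp (by fun_prop)
    exact (hpc k).mul (continuous_inv_mat this (fun y => hLu _))
  · intro y hy k
    have : L (y, 1) = 1 := by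
      have := hK0T y hy 1 1
      rw [hF1] at this
      simpa [K0] using this
    beta_reduce
    rw [this, hpT y hy]
    simp
  · intro y
    rw [hpz', ← hL1, Matrix.mul_nonsing_inv _ (hdet _)]
  · intro y z
    rw [hpz', hLz]
    refine IsUnit.mul ?_ ?_
    · have : ((z : ℂ) ^ d • L (y, z)) = ((Units.mk0 (z : ℂ) (Circle.coe_ne_zero z)) ^ d) • L (y, z) := by
        ext; simp [Units.smul_def]
      rw [this]
      exact (hLu _).smul _
    · rw [Matrix.isUnit_nonsing_inv_iff]; exact hLu _
  · exact hK0c.mul (continuous_inv_mat (hK0c.comp hcc) (fun w => hK0u _))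
  · intro w
    refine (hK0u w).mul ?_
    rw [Matrix.isUnit_nonsing_inv_iff]; exact hK0u _
  · rintro ⟨y, z⟩
    simp [K0, hF1]
  · intro y z
    rw [hpz', hLz, smul_mul_assoc, smul_smul, inv_mul_cancel₀ (pow_ne_zero _ (Circle.coe_ne_zero _))]
    simp [K0]
  · intro y t
    exact Matrix.mul_nonsing_inv _ ((Matrix.isUnit_iff_isUnit_det _).1 (hK0u _))
  · intro y hy z t
    simp only [hK0T y hy, hF1]
    simp

theorem idem_transport {X : Type} [TopologicalSpace X] [CompactSpace X] (R : X × I → Matrix κ κ ℂ)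
    (hR : Continuous R) (hi : ∀ w, R w * R w = R w) :
    ∃ g : C(X × I, GL κ ℂ), (∀ x, g (x, 0) = 1) ∧
      (∀ x t, (g (x, t) : Matrix κ κ ℂ) * R (x, 0) = R (x, t) * (g (x, t) : Matrix κ κ ℂ)) ∧
      ∀ x, (∀ t, R (x, t) = R (x, 0)) → ∀ t, g (x, t) = 1 := by
  let B := {P : Matrix κ κ ℂ // P * P = P}
  let m : B × B → Matrix κ κ ℂ := fun b => b.2.1 * b.1.1 + (1 - b.2.1) * (1 - b.1.1)
  have hm : Continuous m := by
    have h1 : Continuous fun b : B × B => b.1.1 := continuous_subtype_val.comp continuous_fst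
    have h2 : Continuous fun b : B × B => b.2.1 := continuous_subtype_val.comp continuous_snd
    exact (h2.mul h1).add ((continuous_const.sub h2).mul (continuous_const.sub h1))
  have hm1 : ∀ b : B, m (b, b) = 1 := by
    intro b
    simp only [m, mul_sub, sub_mul, b.2, one_mul, mul_one]
    abel
  let h : C(X × I, B) := ⟨fun w => ⟨R w, hi w⟩, by fun_prop⟩
  obtain ⟨g, h0, hT, hc⟩ := transport (X := X) (B := B) (G := GL κ ℂ)
    (fun g b b' => (g : Matrix κ κ ℂ) * b.1 = b'.1 * (g : Matrix κ κ ℂ))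
    (by intro b; simp)
    (by
      intro g g' b b' b'' h1 h2
      rw [Units.val_mul, Matrix.mul_assoc, h1, ← Matrix.mul_assoc, h2, Matrix.mul_assoc])
    {b | IsUnit (m b)}
    (by
      have : {b | IsUnit (m b)} = (fun b => (m b).det) ⁻¹' {0}ᶜ := by
        ext b
        simp [Matrix.isUnit_iff_isUnit_det]
      rw [this]
      exact isOpen_compl_singleton.preimage hm.matrix_det)
    (by intro b; simp [hm1])
    (fun b => glOf (m b))
    (continuousOn_glOf hm.continuousOn (fun w hw => hw))
    (by intro b; rw [hm1, glOf_one])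
    (by
      rintro ⟨b, b'⟩ hb
      rw [glOf_val hb]
      simp only [m, mul_sub, sub_mul, add_mul, mul_add, one_mul, mul_one, Matrix.mul_assoc, b.2]
      simp only [← Matrix.mul_assoc, b'.2]
      abel)
    h
  refine ⟨g, h0, hT, ?_⟩
  intro x hx t
  exact hc x (fun t => Subtype.ext (hx t)) t

end zeta
end
end BP
end Part8

section Part9
open Matrix Kronecker Topology
namespace BP
set_option linter.unusedSectionVars false
set_option linter.unusedSimpArgs false
noncomputable section
open unitInterval

section blocks
variable {ι : Type} [Fintype ι] [DecidableEq ι] {κ : Type} [Fintype κ] [DecidableEq κ]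
variable {κ' : Type} [Fintype κ'] [DecidableEq κ']

/-- coordinate projection -/
def Pc (c : Finset κ) : Matrix κ κ ℂ := Matrix.diagonal fun a => if a ∈ c then 1 else 0

/-- inclusion -/
def ic (c : Finset κ) : c ↪ κ := Function.Embedding.subtype _

theorem ic_apply (c : Finset κ) (a : c) : ic c a = a.1 := rfl

theorem Pc_sq (c : Finset κ) : Pc c * Pc c = Pc c := by
  simp [Pc, Matrix.diagonal_mul_diagonal]

theorem Pc_compl (c : Finset κ) : Pc cᶜ = 1 - Pc c := by
  unfold Pc
  rw [← Matrix.diagonal_one, Matrix.diagonal_sub]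
  congr 1
  ext a
  by_cases h : a ∈ c <;> simp [h]

theorem Pc_J (c : Finset κ) (e : ι ↪ κ) (h : ∀ a, e a ∈ c) : Pc c * J e = J e := by
  ext a b
  rw [Pc, Matrix.diagonal_mul, J]
  by_cases h1 : a = e b
  · simp [h1, h]
  · simp [h1]

theorem Pc_J' (c : Finset κ) (e : ι ↪ κ) (h : ∀ a, e a ∉ c) : Pc c * J e = 0 := by
  ext a b
  rw [Pc, Matrix.diagonal_mul, J]
  by_cases h1 : a = e b
  · simp [h1, h]
  · simp [h1]

theorem Pc_T (c : Finset κ) : (Pc c)ᵀ = Pc c := by simp [Pc]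

theorem JT_Pc (c : Finset κ) (e : ι ↪ κ) (h : ∀ a, e a ∈ c) : (J e)ᵀ * Pc c = (J e)ᵀ := by
  rw [← Pc_T, ← Matrix.transpose_mul, Pc_J c e h]

theorem JT_Pc' (c : Finset κ) (e : ι ↪ κ) (h : ∀ a, e a ∉ c) : (J e)ᵀ * Pc c = 0 := by
  rw [← Pc_T, ← Matrix.transpose_mul, Pc_J' c e h, Matrix.transpose_zero]

theorem ic_JJ (c : Finset κ) : J (ic c) * (J (ic c))ᵀ = Pc c := by
  ext a b
  rw [Pc, Matrix.diagonal_apply]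
  by_cases h : b ∈ c
  · have := mul_JT_apply (ic c) (J (ic c)) ⟨b, h⟩ a
    rw [ic_apply] at this
    rw [this]
    simp only [J, ic_apply]
    by_cases h2 : a = b
    · subst h2; simp [h]
    · simp [h2]
  · rw [mul_JT_apply' (ic c) (J (ic c)) b a (by rintro ⟨i, hi⟩ h2; apply h; rw [h2]; exact hi)]
    by_cases h2 : a = b
    · subst h2; simp [h]
    · simp [h2]

/-- commuting with the projection -/
def Com (c : Finset κ) (M : Matrix κ κ ℂ) : Prop := M * Pc c = Pc c * M

theorem Com.one (c : Finset κ) : Com c 1 := by simp [Com]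

theorem Com.mul {c : Finset κ} {M N : Matrix κ κ ℂ} (h : Com c M) (h' : Com c N) : Com c (M * N) := by
  unfold Com at *
  rw [Matrix.mul_assoc, h', ← Matrix.mul_assoc, h, Matrix.mul_assoc]

theorem Com.inv {c : Finset κ} {g : GL κ ℂ} (h : Com c (g : Matrix κ κ ℂ)) :
    Com c ((g⁻¹ : GL κ ℂ) : Matrix κ κ ℂ) := by
  unfold Com at *
  have h1 : ((g⁻¹ : GL κ ℂ) : Matrix κ κ ℂ) * g = 1 := by rw [← Units.val_mul]; simp
  have h2 : (g : Matrix κ κ ℂ) * ((g⁻¹ : GL κ ℂ) : Matrix κ κ ℂ) = 1 := by rw [← Units.val_mul]; simp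
  calc ((g⁻¹ : GL κ ℂ) : Matrix κ κ ℂ) * Pc c
      = ((g⁻¹ : GL κ ℂ) : Matrix κ κ ℂ) * (Pc c * g) * ((g⁻¹ : GL κ ℂ) : Matrix κ κ ℂ) := by
        rw [Matrix.mul_assoc, Matrix.mul_assoc, h2, Matrix.mul_one]
    _ = _ := by rw [← h, ← Matrix.mul_assoc, h1, Matrix.one_mul]

theorem Com_ext_of {c : Finset κ} (e : ι ↪ κ) (h : ∀ a, e a ∈ c) (M : Matrix ι ι ℂ) : Com c (extM e M) := by
  unfold Com
  rw [extM_def, Matrix.add_mul, Matrix.mul_add, Matrix.mul_assoc, JT_Pc c e h, ← Matrix.mul_assoc,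
    ← Matrix.mul_assoc, Pc_J c e h]
  simp

theorem Com_ext_of' {c : Finset κ} (e : ι ↪ κ) (h : ∀ a, e a ∉ c) (M : Matrix ι ι ℂ) : Com c (extM e M) := by
  unfold Com
  rw [extM_def, Matrix.add_mul, Matrix.mul_add, Matrix.mul_assoc, JT_Pc' c e h, ← Matrix.mul_assoc,
    ← Matrix.mul_assoc, Pc_J' c e h]
  simp

/-- the block -/
def blk (c : Finset κ) (M : Matrix κ κ ℂ) : Matrix c c ℂ := (J (ic c))ᵀ * M * J (ic c)

theorem ic_mem (c : Finset κ) : ∀ a, ic c a ∈ c := fun a => a.2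

theorem blk_one (c : Finset κ) : blk c 1 = 1 := by simp [blk, JT_J]

theorem blk_mul {c : Finset κ} {M : Matrix κ κ ℂ} (h : Com c M) (N : Matrix κ κ ℂ) :
    blk c (M * N) = blk c M * blk c N := by
  have h1 : (J (ic c))ᵀ * M = (J (ic c))ᵀ * M * J (ic c) * (J (ic c))ᵀ := by
    rw [Matrix.mul_assoc _ (J (ic c)), ic_JJ, Matrix.mul_assoc, h, ← Matrix.mul_assoc,
      JT_Pc _ _ (ic_mem c)]
  unfold blk
  calc (J (ic c))ᵀ * (M * N) * J (ic c) = ((J (ic c))ᵀ * M) * (N * J (ic c)) := by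
        simp only [Matrix.mul_assoc]
    _ = ((J (ic c))ᵀ * M * J (ic c) * (J (ic c))ᵀ) * (N * J (ic c)) := by rw [← h1]
    _ = _ := by simp only [Matrix.mul_assoc]

theorem blk_continuous (c : Finset κ) : Continuous (blk c) := by
  unfold blk; fun_prop

theorem blk_unit {c : Finset κ} {g : GL κ ℂ} (h : Com c (g : Matrix κ κ ℂ)) : IsUnit (blk c (g : Matrix κ κ ℂ)) := by
  have h1 : blk c (g : Matrix κ κ ℂ) * blk c ((g⁻¹ : GL κ ℂ) : Matrix κ κ ℂ) = 1 := by
    rw [← blk_mul h, ← Units.val_mul]; simp [blk_one]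
  exact ⟨⟨_, _, h1, mul_eq_one_comm.1 h1⟩, rfl⟩

theorem blk_ext_ic (c : Finset κ) (M : Matrix c c ℂ) : blk c (extM (ic c) M) = M := by
  ext a b
  unfold blk
  rw [extM_def]
  have h := JT_J (ic c)
  rw [Matrix.mul_add, Matrix.add_mul]
  have : (J (ic c))ᵀ * (J (ic c) * (M - 1) * (J (ic c))ᵀ) * J (ic c) =
    ((J (ic c))ᵀ * J (ic c)) * (M - 1) * ((J (ic c))ᵀ * J (ic c)) := by simp only [Matrix.mul_assoc]
  rw [this, h]
  simp [h]

theorem blk_ext_of' {c : Finset κ} (e : ι ↪ κ) (h : ∀ a, e a ∉ c) (M : Matrix ι ι ℂ) :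
    blk c (extM e M) = 1 := by
  unfold blk
  have h2 : (J (ic c))ᵀ * J e = 0 := by
    rw [← JT_Pc c (ic c) (ic_mem c), Matrix.mul_assoc, Pc_J' c e h, Matrix.mul_zero]
  rw [extM_def, Matrix.mul_add, ← Matrix.mul_assoc, ← Matrix.mul_assoc, h2]
  simp [JT_J]

/-- restricted embedding -/
def rE (E : κ ↪ κ') (c : Finset κ) (c' : Finset κ') (h : ∀ a, E a ∈ c' ↔ a ∈ c) : c ↪ c' :=
  ⟨fun a => ⟨E a.1, (h _).2 a.2⟩, fun a b hab => by
    have := congrArg Subtype.val hab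
    exact Subtype.ext (E.injective this)⟩

theorem rE_apply (E : κ ↪ κ') (c : Finset κ) (c' : Finset κ') (h : ∀ a, E a ∈ c' ↔ a ∈ c) (a : c) :
    ((rE E c c' h a : c') : κ') = E a.1 := rfl

theorem J_rE (E : κ ↪ κ') (c : Finset κ) (c' : Finset κ') (h : ∀ a, E a ∈ c' ↔ a ∈ c) :
    (J (ic c'))ᵀ * J E = J (rE E c c' h) * (J (ic c))ᵀ := by
  ext k b
  have h1 : ((J (ic c'))ᵀ * J E) k b = J E k.1 b := by
    simp [Matrix.mul_apply, J, ic_apply, eq_comm]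
  rw [h1]
  by_cases hb : b ∈ c
  · have := mul_JT_apply (ic c) (J (rE E c c' h)) ⟨b, hb⟩ k
    rw [ic_apply] at this
    rw [this]
    simp only [J, Subtype.ext_iff, rE_apply]
  · rw [mul_JT_apply' (ic c) (J (rE E c c' h)) b k
      (by rintro ⟨i, hi⟩ h2; apply hb; rw [h2]; exact hi)]
    have : (k : κ') ≠ E b := by
      intro h2
      exact hb ((h b).1 (h2 ▸ k.2))
    simp [J, this]

theorem blk_ext (E : κ ↪ κ') (c : Finset κ) (c' : Finset κ') (h : ∀ a, E a ∈ c' ↔ a ∈ c)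
    (M : Matrix κ κ ℂ) : blk c' (extM E M) = extM (rE E c c' h) (blk c M) := by
  have h1 := J_rE E c c' h
  have h2 : (J E)ᵀ * J (ic c') = J (ic c) * (J (rE E c c' h))ᵀ := by
    have := congrArg Matrix.transpose h1
    simpa using this
  unfold blk
  rw [extM_def, extM_def, Matrix.mul_add, Matrix.add_mul, Matrix.mul_one, JT_J]
  congr 1
  calc (J (ic c'))ᵀ * (J E * (M - 1) * (J E)ᵀ) * J (ic c') =
        ((J (ic c'))ᵀ * J E) * (M - 1) * ((J E)ᵀ * J (ic c')) := by simp only [Matrix.mul_assoc]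
    _ = J (rE E c c' h) * ((J (ic c))ᵀ * (M - 1) * J (ic c)) * (J (rE E c c' h))ᵀ := by
        rw [h1, h2]; simp only [Matrix.mul_assoc]
    _ = _ := by
        rw [Matrix.mul_sub, Matrix.sub_mul, Matrix.mul_one, JT_J]

theorem Pc_JE (E : κ ↪ κ') (c : Finset κ) (c' : Finset κ') (h : ∀ a, E a ∈ c' ↔ a ∈ c) :
    Pc c' * J E = J E * Pc c := by
  ext a b
  rw [Pc, Pc, Matrix.diagonal_mul, Matrix.mul_diagonal, J]
  by_cases h1 : a = E b
  · simp [h1, h]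
  · simp [h1]

theorem JE_Pc (E : κ ↪ κ') (c : Finset κ) (c' : Finset κ') (h : ∀ a, E a ∈ c' ↔ a ∈ c) :
    (J E)ᵀ * Pc c' = Pc c * (J E)ᵀ := by
  have := congrArg Matrix.transpose (Pc_JE E c c' h)
  simpa [Pc_T] using this

theorem Com_ext (E : κ ↪ κ') (c : Finset κ) (c' : Finset κ') (h : ∀ a, E a ∈ c' ↔ a ∈ c)
    {M : Matrix κ κ ℂ} (hM : Com c M) : Com c' (extM E M) := by
  unfold Com at *
  have hM' : (M - 1) * Pc c = Pc c * (M - 1) := by rw [sub_mul, mul_sub, hM]; simp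
  rw [extM_def, Matrix.add_mul, Matrix.mul_add, Matrix.mul_assoc, JE_Pc E c c' h, ← Matrix.mul_assoc,
    ← Matrix.mul_assoc, ← Matrix.mul_assoc, Pc_JE E c c' h, Matrix.mul_assoc (J E), hM']
  simp [Matrix.mul_assoc]

theorem eq_ext_compl {c : Finset κ} {M : Matrix κ κ ℂ} (h : Com c M) (h1 : blk c M = 1) :
    M = extM (ic cᶜ) (blk cᶜ M) := by
  have hc := ic_JJ cᶜ
  rw [Pc_compl] at hc
  have h2 : Pc c * M * Pc c = Pc c := by
    rw [← ic_JJ]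
    calc J (ic c) * (J (ic c))ᵀ * M * (J (ic c) * (J (ic c))ᵀ) = J (ic c) * blk c M * (J (ic c))ᵀ := by
          unfold blk; simp only [Matrix.mul_assoc]
      _ = _ := by rw [h1, Matrix.mul_one]
  have h3 : (1 - Pc c) * M * (1 - Pc c) = J (ic cᶜ) * blk cᶜ M * (J (ic cᶜ))ᵀ := by
    rw [← hc]; unfold blk; simp only [Matrix.mul_assoc]
  rw [extM_def, Matrix.mul_sub, Matrix.sub_mul, ← h3, Matrix.mul_one, hc]
  have h4 : M * Pc c = Pc c := by
    have : Pc c * M * Pc c = M * Pc c := by rw [← h, Matrix.mul_assoc, Pc_sq]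
    rw [← this, h2]
  have h5 : Pc c * M = Pc c := by rw [← h, h4]
  simp only [sub_mul, mul_sub, one_mul, mul_one, h4, h5, Pc_sq]
  abel

theorem exists_E (c : Finset κ) (c' : Finset κ') (h1 : c.card ≤ c'.card) (h2 : cᶜ.card ≤ c'ᶜ.card) :
    ∃ E : κ ↪ κ', ∀ a, E a ∈ c' ↔ a ∈ c := by
  obtain ⟨e1⟩ : Nonempty (c ↪ c') := Function.Embedding.nonempty_of_card_le (by simpa using h1)
  obtain ⟨e2⟩ : Nonempty ((cᶜ : Finset κ) ↪ (c'ᶜ : Finset κ')) :=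
    Function.Embedding.nonempty_of_card_le (by simpa only [Fintype.card_coe] using h2)
  let E : κ → κ' := fun a => if h : a ∈ c then e1 ⟨a, h⟩ else e2 ⟨a, by simpa using h⟩
  have hE : ∀ a, E a ∈ c' ↔ a ∈ c := by
    intro a
    by_cases h : a ∈ c
    · simp only [E, h, dif_pos, iff_true]; exact (e1 _).2
    · simp only [E, h, dif_neg, not_false_eq_true, iff_false]
      exact Finset.mem_compl.1 (e2 _).2
  refine ⟨⟨E, ?_⟩, hE⟩
  intro a b hab
  have hab' : a ∈ c ↔ b ∈ c := by rw [← hE a, ← hE b, hab]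
  by_cases h : a ∈ c
  · have h' := hab'.1 h
    simp only [E, h, h', dif_pos] at hab
    simpa using e1.injective (Subtype.ext hab)
  · have h' : b ∉ c := fun h' => h (hab'.2 h')
    simp only [E, h, h', dif_neg, not_false_eq_true] at hab
    simpa using e2.injective (Subtype.ext hab)

end blocks
end
end BP
end Part9

section Part10
open Matrix Kronecker Topology
namespace BP
set_option linter.unusedSectionVars false
set_option linter.unusedSimpArgs false
noncomputable section
open unitInterval

section bott
variable {κ : Type} [Fintype κ] [DecidableEq κ]
variable {κ' : Type} [Fintype κ'] [DecidableEq κ']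
variable {X : Type} [TopologicalSpace X] {Y : Type} [TopologicalSpace Y]

/-- clutching of the coordinate projection -/
def Dg (c : Finset κ) : C(Y × I, GL κ ℂ) :=
  zt (fun _ => Pc c) continuous_const (fun _ => Reg_idem (Pc_sq c))

theorem Dg_val (c : Finset κ) (w : Y × I) :
    ((Dg c w : GL κ ℂ) : Matrix κ κ ℂ) = 1 + ((ec w.2 : ℂ) - 1) • Pc c := zt_val _ _ _ _ _

theorem Dg_comm {c : Finset κ} {g : GL κ ℂ} (h : Com c (g : Matrix κ κ ℂ)) (w : Y × I) :
    Dg c w * g = g * Dg c w := by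
  apply Units.ext
  rw [Units.val_mul, Units.val_mul, Dg_val]
  unfold Com at h
  simp only [add_mul, mul_add, one_mul, mul_one, Matrix.smul_mul, Matrix.mul_smul, h]

theorem Dg_one (c : Finset κ) (w : Y × I) (h : w.2 = 0 ∨ w.2 = 1) : Dg c w = 1 := by
  apply Units.ext
  rw [Dg_val]
  rcases h with h | h <;> simp [h, ec_zero, ec_one]

/-- pull back along the projection -/
def lft : C(Y, GL κ ℂ) →* C(Y × I, GL κ ℂ) := pre ⟨Prod.fst, continuous_fst⟩

@[simp] theorem lft_apply (V : C(Y, GL κ ℂ)) (w : Y × I) : lft V w = V w.1 := rfl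

/-- the commutator construction -/
def Gm (c : Finset κ) (V : C(Y, GL κ ℂ)) : C(Y × I, GL κ ℂ) := (lft V)⁻¹ * Dg c * lft V * (Dg c)⁻¹

theorem Gm_apply (c : Finset κ) (V : C(Y, GL κ ℂ)) (w : Y × I) :
    Gm c V w = (V w.1)⁻¹ * Dg c w * V w.1 * (Dg c w)⁻¹ := rfl

theorem Gm_eq_one {c : Finset κ} {V : C(Y, GL κ ℂ)} {w : Y × I}
    (h : Com c (V w.1 : Matrix κ κ ℂ) ∨ w.2 = 0 ∨ w.2 = 1) : Gm c V w = 1 := by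
  rw [Gm_apply]
  rcases h with h | h
  · rw [mul_assoc _ (Dg c w), Dg_comm h]
    group
  · rw [Dg_one c w h]
    simp

theorem Gm_Ht {c : Finset κ} {T : Set Y} {V W : C(Y, GL κ ℂ)} (h : Ht T V W)
    (hV : ∀ y ∈ T, Com c (V y : Matrix κ κ ℂ)) : Ht (bd T) (Gm c V) (Gm c W) := by
  obtain ⟨K, h0, h1, hT⟩ := h.exists_homotopy
  have e : ∀ (w : Y × I), w ∈ bd T → Com c (V w.1 : Matrix κ κ ℂ) ∨ w.2 = 0 ∨ w.2 = 1 := by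
    rintro w (h | h)
    · exact Or.inl (hV _ h)
    · exact Or.inr h
  refine Ht.of_homotopy ⟨fun w => (K (w.1.1, w.2))⁻¹ * Dg c w.1 * K (w.1.1, w.2) * (Dg c w.1)⁻¹,
    by fun_prop⟩ ?_ ?_ ?_
  · intro w; simp [h0, Gm_apply]
  · intro w; simp [h1, Gm_apply]
  · intro w hw t
    rw [Gm_eq_one (e w hw)]
    simp only [ContinuousMap.coe_mk]
    rcases hw with h | h
    · rw [hT _ h]
      have := Gm_eq_one (e w (Or.inl h))
      rwa [Gm_apply] at this
    · rw [Dg_one c _ h]; simp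

theorem Gm_mul_left {c : Finset κ} {C V : C(Y, GL κ ℂ)} (h : ∀ y, Com c (C y : Matrix κ κ ℂ)) :
    Gm c (C * V) = Gm c V := by
  ext1 w
  rw [Gm_apply, Gm_apply]
  simp only [ContinuousMap.mul_apply]
  have := Dg_comm (h w.1) w
  rw [_root_.mul_inv_rev]
  calc _ = (V w.1)⁻¹ * (C w.1)⁻¹ * (Dg c w * C w.1) * V w.1 * (Dg c w)⁻¹ := by group
    _ = _ := by rw [this]; group

/-- paths ending in block diagonal matrices -/
def VV (S : Set X) (c : Finset κ) : Subgroup C(X × I, GL κ ℂ) where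
  carrier := {V | (∀ x, V (x, 0) = 1) ∧ (∀ x ∈ S, ∀ t, V (x, t) = 1) ∧ ∀ x, Com c (V (x, 1) : Matrix κ κ ℂ)}
  mul_mem' := by
    rintro V W ⟨h1, h2, h3⟩ ⟨g1, g2, g3⟩
    exact ⟨fun x => by simp [h1, g1], fun x hx t => by simp [h2 x hx, g2 x hx],
      fun x => by simpa using (h3 x).mul (g3 x)⟩
  one_mem' := ⟨fun x => rfl, fun x hx t => rfl, fun x => by simpa using Com.one c⟩
  inv_mem' := by
    rintro V ⟨h1, h2, h3⟩
    exact ⟨fun x => by simp [h1], fun x hx t => by simp [h2 x hx], fun x => (h3 x).inv⟩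

theorem VV_Com {S : Set X} {c : Finset κ} {V : C(X × I, GL κ ℂ)} (hV : V ∈ VV S c) (y : X × I)
    (hy : y ∈ bd S) : Com c (V y : Matrix κ κ ℂ) := by
  obtain ⟨h1, h2, h3⟩ := hV
  obtain ⟨x, t⟩ := y
  rcases hy with h | h | h
  · rw [h2 x h]; simpa using Com.one c
  · simp only at h; subst h; rw [h1]; simpa using Com.one c
  · simp only at h; subst h; exact h3 x

theorem Gm_Lp {S : Set X} {c : Finset κ} {V : C(X × I, GL κ ℂ)} (hV : V ∈ VV S c) :
    Gm c V ∈ Lp (bd (bd S)) (GL κ ℂ) := by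
  rintro w (h | h)
  · exact Gm_eq_one (Or.inl (VV_Com hV _ h))
  · exact Gm_eq_one (Or.inr h)

theorem Gm_mul {S : Set X} {c : Finset κ} {V W : C(X × I, GL κ ℂ)} (hV : V ∈ VV S c) (hW : W ∈ VV S c) :
    Ht (bd (bd S)) (Gm c (V * W)) (Gm c V * Gm c W) := by
  have h1 : Gm c (V * W) = ((lft W)⁻¹ * Gm c V * lft W) * Gm c W := by
    unfold Gm
    rw [map_mul]
    group
  rw [h1]
  refine Ht.mul ?_ (Ht.refl _ _)
  refine Ht.symm (Ht.of_homotopy ⟨fun w => (W (w.1.1.1, w.1.1.2 * w.2))⁻¹ * Gm c V w.1 *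
    W (w.1.1.1, w.1.1.2 * w.2), by fun_prop⟩ ?_ ?_ ?_)
  · intro w
    simp [hW.1]
  · intro w
    simp
  · intro w hw t
    simp [Gm_Lp hV w hw]

/-- the end block -/
def resf {S : Set X} {c : Finset κ} (V : C(X × I, GL κ ℂ)) (hV : V ∈ VV S c) : C(X, GL c ℂ) :=
  mkGL (fun x => blk c (V (x, 1) : Matrix κ κ ℂ)) (by
    have : Continuous fun x => ((V (x, 1) : GL κ ℂ) : Matrix κ κ ℂ) :=
      Units.continuous_val.comp (by fun_prop)
    exact (blk_continuous c).comp this) (fun x => blk_unit (hV.2.2 x))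

theorem resf_val {S : Set X} {c : Finset κ} (V : C(X × I, GL κ ℂ)) (hV : V ∈ VV S c) (x : X) :
    ((resf V hV x : GL c ℂ) : Matrix c c ℂ) = blk c (V (x, 1) : Matrix κ κ ℂ) := mkGL_val _ _ _ _

theorem resf_Lp {S : Set X} {c : Finset κ} (V : C(X × I, GL κ ℂ)) (hV : V ∈ VV S c) :
    resf V hV ∈ Lp S (GL c ℂ) := by
  intro x hx
  apply Units.ext
  rw [resf_val, hV.2.1 x hx]
  simpa using blk_one c

theorem resf_mul {S : Set X} {c : Finset κ} (V W : C(X × I, GL κ ℂ)) (hV : V ∈ VV S c) (hW : W ∈ VV S c) :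
    resf (V * W) (mul_mem hV hW) = resf V hV * resf W hW := by
  ext1 x
  apply Units.ext
  rw [resf_val, ContinuousMap.mul_apply, ContinuousMap.mul_apply, Units.val_mul, Units.val_mul,
    blk_mul (hV.2.2 x), resf_val, resf_val]

/-- end block homomorphism -/
def resH (S : Set X) (c : Finset κ) : VV S c →* A S (GL c ℂ) :=
  MonoidHom.mk' (fun V => QuotientGroup.mk ⟨resf V.1 V.2, resf_Lp _ _⟩) (by
    intro V W
    rw [← QuotientGroup.mk_mul]
    congr 1
    exact Subtype.ext (resf_mul V.1 W.1 V.2 W.2))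

/-- clutching homomorphism -/
def GmH (S : Set X) (c : Finset κ) : VV S c →* A (bd (bd S)) (GL κ ℂ) :=
  MonoidHom.mk' (fun V => QuotientGroup.mk ⟨Gm c V.1, Gm_Lp V.2⟩) (by
    intro V W
    rw [← QuotientGroup.mk_mul, A_eq]
    exact Gm_mul V.2 W.2)

/-- step 1 -/
theorem res_surj {S : Set X} {c : Finset κ} (hc : c.card ≤ cᶜ.card) {f : C(X, GL c ℂ)}
    (hf : f ∈ Lp S (GL c ℂ)) : ∃ V, ∃ hV : V ∈ VV S c, resf V hV = f := by
  obtain ⟨e⟩ : Nonempty (c ↪ (cᶜ : Finset κ)) :=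
    Function.Embedding.nonempty_of_card_le (by simpa only [Fintype.card_coe] using hc)
  let i2 : c ↪ κ := e.trans (ic cᶜ)
  have hi2 : ∀ a, i2 a ∉ c := fun a => Finset.mem_compl.1 (e a).2
  obtain ⟨g, hg⟩ := ext_conj (ic c) i2
  obtain ⟨γ, h0, h1⟩ := GL_path g
  let V : C(X × I, GL κ ℂ) := ⟨fun w => pe (ic c) f w.1 * (γ w.2 * (pe (ic c) f w.1)⁻¹ * (γ w.2)⁻¹), by fun_prop⟩
  have hV1 : ∀ x, V (x, 1) = ext (ic c) (f x) * ext i2 (f x)⁻¹ := by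
    intro x
    simp [V, h1, hg]
  have hV1' : ∀ x, (V (x, 1) : Matrix κ κ ℂ) = extM (ic c) (f x : Matrix c c ℂ) *
      extM i2 ((f x)⁻¹ : GL c ℂ) := by
    intro x; rw [hV1]; rfl
  have hV : V ∈ VV S c := by
    refine ⟨?_, ?_, ?_⟩
    · intro x; simp [V, h0]
    · intro x hx t
      simp [V, hf x hx]
    · intro x
      rw [hV1']
      exact (Com_ext_of _ (ic_mem c) _).mul (Com_ext_of' _ hi2 _)
  refine ⟨V, hV, ?_⟩
  ext1 x
  apply Units.ext
  rw [resf_val, hV1', blk_mul (Com_ext_of _ (ic_mem c) _), blk_ext_ic, blk_ext_of' _ hi2, mul_one]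

/-- step 2 -/
theorem ker_res_le [CompactSpace X] {S : Set X} {c : Finset κ} {n : ℕ} (hX : DimLE (X × I) n)
    (hn : n ≤ 2 * cᶜ.card) {V : C(X × I, GL κ ℂ)} (hV : V ∈ VV S c)
    (h : resf V hV ∈ Nul S (GL c ℂ)) : Gm c V ∈ Nul (bd (bd S)) (GL κ ℂ) := by
  have hn' : n ≤ 2 * Fintype.card (cᶜ : Finset κ) := by simpa only [Fintype.card_coe] using hn
  have hcc : ∀ a, ic cᶜ a ∉ c := fun a => Finset.mem_compl.1 a.2
  obtain ⟨K, k0, k1, kS⟩ := h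
  let V1 := (pe (ic c) K)⁻¹ * V
  have hV1 : ∀ x, (V1 (x, 1) : Matrix κ κ ℂ) = extM (ic c) ((K (x, 1))⁻¹ : GL c ℂ) * V (x, 1) := by
    intro x
    simp only [V1, ContinuousMap.mul_apply, ContinuousMap.inv_apply, pe_apply, ← map_inv]
    rfl
  obtain ⟨h, hh⟩ := of_extM (ic cᶜ) (⟨fun x => V1 (x, 1), by fun_prop⟩ : C(X, GL κ ℂ)) (by
    intro x
    refine ⟨blk cᶜ (V1 (x, 1) : Matrix κ κ ℂ), ?_⟩
    refine eq_ext_compl ?_ ?_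
    · change Com c (V1 (x, 1) : Matrix κ κ ℂ)
      rw [hV1]
      exact (Com_ext_of _ (ic_mem c) _).mul (hV.2.2 x)
    · change blk c (V1 (x, 1) : Matrix κ κ ℂ) = 1
      rw [hV1, blk_mul (Com_ext_of _ (ic_mem c) _), blk_ext_ic, k1, ← resf_val V hV, ← Units.val_mul]
      simp)
  have hh' : ∀ x, V1 (x, 1) = ext (ic cᶜ) (h x) := fun x => DFunLike.congr_fun hh x
  have hnul : pe (ic cᶜ) h ∈ Nul S (GL κ ℂ) := by
    refine ⟨V1, ?_, ?_, ?_⟩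
    · intro x; simp [V1, k0, hV.1]
    · intro x; simp [hh']
    · intro x hx t; simp [V1, kS x hx, hV.2.1 x hx]
  have hLp : h ∈ Lp S _ := by
    intro x hx
    have := Nul_le_Lp S hnul x hx
    rw [pe_apply] at this
    exact ext_injective _ (this.trans (map_one _).symm)
  obtain ⟨K2, l0, l1, lS⟩ := stab_inj hX (ic cᶜ) hn' hLp hnul
  let V2 := (pe (ic cᶜ) K2)⁻¹ * V1
  have hV2 : V2 ∈ Lp (bd S) (GL κ ℂ) := by
    rintro ⟨x, t⟩ (hx | hx | hx)
    · simp [V2, V1, kS x hx, lS x hx, hV.2.1 x hx]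
    · simp only at hx; subst hx
      simp [V2, V1, k0, l0, hV.1]
    · simp only at hx; subst hx
      simp [V2, hh', l1]
  obtain ⟨w, hw, hVw⟩ := stab_surj hX (ic cᶜ) hn' hV2
  have e1 : Gm c V2 = Gm c V := by
    have a1 : Gm c V2 = Gm c V1 := Gm_mul_left (c := c) (C := (pe (ic cᶜ) K2)⁻¹) (fun y => by
      have : ((pe (ic cᶜ) K2)⁻¹) y = ext (ic cᶜ) (K2 y)⁻¹ := by simp
      rw [this]
      exact Com_ext_of' _ hcc _)
    have a2 : Gm c V1 = Gm c V := Gm_mul_left (c := c) (C := (pe (ic c) K)⁻¹) (fun y => by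
      have : ((pe (ic c) K)⁻¹) y = ext (ic c) (K y)⁻¹ := by simp
      rw [this]
      exact Com_ext_of _ (ic_mem c) _)
    rw [a1, a2]
  have e2 := Gm_Ht (c := c) hVw (fun y hy => by rw [hV2 y hy]; simpa using Com.one c)
  have e3 : Gm c (pe (ic cᶜ) w) = 1 := by
    ext1 y
    exact Gm_eq_one (Or.inl (Com_ext_of' _ hcc _))
  rw [e1, e3] at e2
  exact Ht.iff_one.1 e2

end bott
end
end BP
end Part10

section Part11
open Matrix Kronecker Topology
namespace BP
set_option linter.unusedSectionVars false
set_option linter.unusedSimpArgs false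
noncomputable section
open unitInterval

section bott2
variable {κ : Type} [Fintype κ] [DecidableEq κ]
variable {κ' : Type} [Fintype κ'] [DecidableEq κ']
variable {X : Type} [TopologicalSpace X] {Y : Type} [TopologicalSpace Y]

theorem Gm_pe (E : κ ↪ κ') (c : Finset κ) (c' : Finset κ') (h : ∀ a, E a ∈ c' ↔ a ∈ c) (V : C(Y, GL κ ℂ)) :
    Gm c' (pe E V) = pe E (Gm c V) := by
  ext1 w
  rw [pe_apply, Gm_apply, Gm_apply, pe_apply, map_mul, map_mul, map_mul, map_inv, map_inv]
  set v := V w.1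
  set N : Matrix κ' κ' ℂ := Pc c' - J E * Pc c * (J E)ᵀ with hN
  have hNJ : N * J E = 0 := by
    rw [hN, Matrix.sub_mul, Pc_JE E c c' h, Matrix.mul_assoc, JT_J, Matrix.mul_one, sub_self]
  have hJN : (J E)ᵀ * N = 0 := by
    rw [hN, Matrix.mul_sub, JE_Pc E c c' h, ← Matrix.mul_assoc, ← Matrix.mul_assoc, JT_J, Matrix.one_mul, sub_self]
  set z : ℂ := (ec w.2 : ℂ) - 1 with hz
  have hD : ((ext E (Dg c w) : GL κ' ℂ) : Matrix κ' κ' ℂ) = 1 + z • (J E * Pc c * (J E)ᵀ) := by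
    rw [ext_val, Dg_val, extM_def]
    simp [z]
  have hDC : ((ext E (Dg c w) : GL κ' ℂ) : Matrix κ' κ' ℂ) * (1 + z • N) = (Dg c' w : GL κ' ℂ) := by
    have e0 : (J E * Pc c * (J E)ᵀ) * N = 0 := by rw [Matrix.mul_assoc, hJN, Matrix.mul_zero]
    rw [hD, Dg_val]
    simp only [add_mul, mul_add, one_mul, mul_one, Matrix.smul_mul, Matrix.mul_smul, e0, smul_zero, add_zero]
    rw [add_assoc, ← smul_add, hN, add_sub_cancel]
  have hCM : (1 + z • N) * (ext E v : GL κ' ℂ) = (ext E v : GL κ' ℂ) * (1 + z • N) := by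
    have e1 : N * (J E * ((v : Matrix κ κ ℂ) - 1) * (J E)ᵀ) = 0 := by
      rw [← Matrix.mul_assoc, ← Matrix.mul_assoc, hNJ]; simp
    have e2 : (J E * ((v : Matrix κ κ ℂ) - 1) * (J E)ᵀ) * N = 0 := by
      rw [Matrix.mul_assoc, hJN]; simp
    rw [ext_val, extM_def]
    simp only [add_mul, mul_add, one_mul, mul_one, Matrix.smul_mul, Matrix.mul_smul, e1, e2]
    simp only [smul_zero, add_zero, zero_add]
    abel
  set D := ext E (Dg c w)
  set D' := Dg c' w
  have hC : (1 + z • N) = ((D⁻¹ * D' : GL κ' ℂ) : Matrix κ' κ' ℂ) := by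
    rw [Units.val_mul, ← hDC, ← mul_assoc, ← Units.val_mul]
    simp
  have hcom : (D⁻¹ * D') * ext E v = ext E v * (D⁻¹ * D') := by
    apply Units.ext
    rw [Units.val_mul _ (ext E v), Units.val_mul (ext E v), ← hC]
    exact hCM
  have : D' * ext E v = D * ext E v * D⁻¹ * D' := by
    calc D' * ext E v = D * ((D⁻¹ * D') * ext E v) := by group
      _ = _ := by rw [hcom]; group
  calc (ext E v)⁻¹ * D' * ext E v * D'⁻¹ = (ext E v)⁻¹ * (D' * ext E v) * D'⁻¹ := by group
    _ = _ := by rw [this]; group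

/-- slot embedding -/
def ed (κ : Type) (D d : ℕ) (h : d ≤ D) : κ ↪ κ × Fin (D + 1) :=
  ⟨fun a => (a, ⟨d, by omega⟩), fun a b h => by simpa using h⟩

theorem ed_apply (D d : ℕ) (h : d ≤ D) (a : κ) : ed κ D d h a = (a, ⟨d, by omega⟩) := rfl

/-- standard index set -/
def cE (D d : ℕ) (c : Finset κ) : Finset (κ × Fin (D + 1)) :=
  Finset.univ.filter fun a => (a.2 : ℕ) < d ∨ ((a.2 : ℕ) = d ∧ a.1 ∈ c)

theorem mem_cE {D d : ℕ} {c : Finset κ} {a : κ × Fin (D + 1)} :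
    a ∈ cE D d c ↔ (a.2 : ℕ) < d ∨ ((a.2 : ℕ) = d ∧ a.1 ∈ c) := by simp [cE]

theorem Ed_Pc (D d : ℕ) (c : Finset κ) : Ed D d (Pc c) = Pc (cE D d c) := by
  ext ⟨a, i⟩ ⟨b, j⟩
  simp only [Ed, Pc, Matrix.of_apply, Matrix.diagonal_apply, mem_cE, Prod.mk.injEq]
  by_cases hij : i = j
  · subst hij
    by_cases hab : a = b
    · subst hab
      rcases lt_trichotomy (i : ℕ) d with h | h | h
      · simp [h]
      · simp [h]
      · have h1 : ¬ (i : ℕ) < d := by omega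
        have h2 : ¬ (i : ℕ) = d := by omega
        simp [h1, h2]
    · rcases lt_trichotomy (i : ℕ) d with h | h | h
      · simp [h, hab]
      · simp [h, hab]
      · have h1 : ¬ (i : ℕ) < d := by omega
        have h2 : ¬ (i : ℕ) = d := by omega
        simp [h1, h2, hab]
  · simp [hij]

theorem Pc_empty : Pc (∅ : Finset κ) = 0 := by
  simp [Pc]

theorem Ed_eq (D d : ℕ) (h : d ≤ D) (Q : Matrix κ κ ℂ) :
    Ed D d Q = Ed D d 0 + J (ed κ D d h) * Q * (J (ed κ D d h))ᵀ := by
  ext ⟨a, i⟩ ⟨b, j⟩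
  rw [Matrix.add_apply]
  by_cases hi : (i : ℕ) = d
  · obtain rfl : (⟨d, Nat.lt_succ_of_le h⟩ : Fin (D + 1)) = i := Fin.ext hi.symm
    by_cases hj : (j : ℕ) = d
    · obtain rfl : (⟨d, Nat.lt_succ_of_le h⟩ : Fin (D + 1)) = j := Fin.ext hj.symm
      rw [← ed_apply D d h a, ← ed_apply D d h b, mul_JT_apply, J_mul_apply]
      simp [Ed, ed_apply]
    · rw [mul_JT_apply' _ _ _ _ (fun k hk => hj (by rw [ed_apply] at hk; simpa using congrArg (fun x => (x.2 : ℕ)) hk))]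
      have : ¬ (⟨d, by omega⟩ : Fin (D+1)) = j := fun hh => hj (by rw [← hh])
      simp [Ed, this]
  · rw [Matrix.mul_assoc, J_mul_apply' _ _ _ _ (fun k hk => hi (by rw [ed_apply] at hk; simpa using congrArg (fun x => (x.2 : ℕ)) hk))]
    simp [Ed, hi]

theorem Ed_zero_J (D d : ℕ) (h : d ≤ D) : Ed D d (0 : Matrix κ κ ℂ) * J (ed κ D d h) = 0 := by
  rw [← Pc_empty, Ed_Pc]
  ext a b
  rw [Pc, Matrix.diagonal_mul, J]
  by_cases h1 : a = ed κ D d h b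
  · simp [h1, ed_apply, mem_cE]
  · simp [h1]

theorem J_Ed_zero (D d : ℕ) (h : d ≤ D) : (J (ed κ D d h))ᵀ * Ed D d (0 : Matrix κ κ ℂ) = 0 := by
  have := congrArg Matrix.transpose (Ed_zero_J (κ := κ) D d h)
  rw [← Pc_empty, Ed_Pc] at *
  simpa [Pc_T] using this

theorem ext_mul_Ed (D d : ℕ) (h : d ≤ D) (M Q : Matrix κ κ ℂ) :
    extM (ed κ D d h) M * Ed D d Q = Ed D d (M * Q) := by
  rw [Ed_eq D d h Q, Ed_eq D d h (M * Q), extM_def]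
  have e1 := J_Ed_zero (κ := κ) D d h
  have e2 := JT_J (ed κ D d h)
  set j := J (ed κ D d h)
  rw [Matrix.add_mul, Matrix.one_mul, Matrix.mul_add, Matrix.mul_assoc _ _ (Ed D d 0), e1, Matrix.mul_zero, zero_add]
  have : j * (M - 1) * jᵀ * (j * Q * jᵀ) = j * (M - 1) * (jᵀ * j) * Q * jᵀ := by
    simp only [Matrix.mul_assoc]
  rw [this, e2, Matrix.mul_one, Matrix.mul_sub, Matrix.mul_one, Matrix.sub_mul, Matrix.sub_mul, Matrix.mul_assoc j M Q]
  abel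

theorem Ed_mul_ext (D d : ℕ) (h : d ≤ D) (M Q : Matrix κ κ ℂ) :
    Ed D d Q * extM (ed κ D d h) M = Ed D d (Q * M) := by
  rw [Ed_eq D d h Q, Ed_eq D d h (Q * M), extM_def]
  have e1 := Ed_zero_J (κ := κ) D d h
  have e2 := JT_J (ed κ D d h)
  set j := J (ed κ D d h)
  rw [Matrix.mul_add, Matrix.mul_one, Matrix.add_mul, Matrix.mul_assoc j (M - 1), ← Matrix.mul_assoc (Ed D d 0) j, e1, Matrix.zero_mul, zero_add]
  have : j * Q * jᵀ * (j * ((M - 1) * jᵀ)) = j * Q * (jᵀ * j) * (M - 1) * jᵀ := by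
    simp only [Matrix.mul_assoc]
  rw [this, e2, Matrix.mul_one, Matrix.mul_sub, Matrix.mul_one, Matrix.sub_mul, Matrix.mul_assoc j Q M]
  abel

/-- linearisation -/
theorem bott_lin [CompactSpace Y] [T2Space Y] (T : Set Y) {F : C(Y × I, GL κ ℂ)}
    (hF : F ∈ Lp (bd T) (GL κ ℂ)) :
    ∃ (d : ℕ) (R : Y → Matrix (κ × Fin (2 * d + 1)) (κ × Fin (2 * d + 1)) ℂ) (hR : Continuous R)
      (hRi : ∀ y, R y * R y = R y), 1 ≤ d ∧ (∀ y ∈ T, R y = Pc (cE (2 * d) d ∅)) ∧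
      Ht (bd T) (pe (e0 κ (2 * d)) F) (zt R hR (fun y => Reg_idem (hRi y)) * (Dg (cE (2 * d) d ∅))⁻¹) := by
  have hF0 : ∀ y, F (y, 0) = 1 := fun y => hF _ (Or.inr (Or.inl rfl))
  have hF1 : ∀ y, F (y, 1) = 1 := fun y => hF _ (Or.inr (Or.inr rfl))
  obtain ⟨G, hG⟩ := to_circle F (fun y => by rw [hF0, hF1])
  have hG1 : ∀ y, G (y, 1) = 1 := fun y => by
    have := hG y 0
    rwa [ec_zero, hF0] at this
  obtain ⟨d, p, hd, hp, hpT, hp1, hpu, K, hK, hKu, hK0, hK1, hKc, hKT⟩ :=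
    laurent_norm T (fun w => (G w : Matrix κ κ ℂ)) (Units.continuous_val.comp G.continuous)
      (fun w => (G w).isUnit) (fun y => by rw [hG1]; rfl) (fun _ => 0) continuous_const (by
        intro y hy z
        obtain ⟨t, rfl⟩ := ec_surj z
        rw [hG, hF _ (Or.inl hy)]
        simp)
  let q : ℕ → Y → Matrix κ κ ℂ := fun k _ => if k = d then 1 - 0 else if k = d + 1 then 0 else 0
  have hqz : ∀ y (z : ℂ), pz (2 * d) (fun k => q k y) z = z ^ d • 1 := by
    intro y z
    unfold pz
    rw [Finset.sum_eq_single d]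
    · simp [q]
    · intro k _ hk
      simp [q, hk]
    · intro h
      exact absurd (Finset.mem_range.2 (by omega)) h
  have hqu : ∀ y (z : Circle), IsUnit (pz (2 * d) (fun k => q k y) z) := by
    intro y z
    rw [hqz y]
    have hz : (z : ℂ) ^ d ≠ 0 := pow_ne_zero _ (Circle.coe_ne_zero z)
    exact (isUnit_one (M := Matrix κ κ ℂ)).smul (Units.mk0 _ hz)
  have hq1 : ∀ y, pz (2 * d) (fun k => q k y) 1 = 1 := by
    intro y; rw [hqz y]; simp
  have hq : ∀ k, Continuous (q k) := fun k => continuous_const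
  have hRr : ∀ y, Reg (bP (2 * d) (fun k => p k y)) := fun y => bP_Reg _ (hp1 y) (hpu y)
  have hqr : ∀ y, Reg (bP (2 * d) (fun k => q k y)) := fun y => bP_Reg _ (hq1 y) (hqu y)
  let R : Y → Matrix (κ × Fin (2 * d + 1)) (κ × Fin (2 * d + 1)) ℂ := fun y => sp (bP (2 * d) (fun k => p k y))
  have hR : Continuous R := sp_continuous (bP_cont hp) hRr
  have hRi : ∀ y, R y * R y = R y := fun y => sp_sq (hRr y)
  refine ⟨d, R, hR, hRi, hd, ?_, ?_⟩
  · intro y hy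
    rw [← Ed_Pc, Pc_empty]
    exact sp_bdry d (by omega) 0 (by simp) _ (hpT y hy) (hRr y)
  · have h1 := pencil_ratio (T := T) p q hp hq hpu hqu hp1 hq1 (fun y hy k => hpT y hy k) R
      (fun _ => Pc (cE (2 * d) d ∅)) hR continuous_const (fun y => Reg_idem (hRi y))
      (fun y => Reg_idem (Pc_sq _)) (fun y => rfl) (fun y => by
        rw [← Ed_Pc, Pc_empty]
        exact (sp_bdry d (by omega) 0 (by simp) _ (fun k => rfl) (hqr y)).symm)
    refine Ht.trans (pe_Ht (e0 κ (2 * d)) ?_) h1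
    refine Ht.of_homotopy (mkGL (fun w : (Y × I) × I => K ((w.1.1, ec w.1.2), w.2))
      (hK.comp (by fun_prop)) (fun w => hKu _)) ?_ ?_ ?_
    · rintro ⟨y, t⟩
      apply Units.ext
      rw [mkGL_val]
      change K ((y, ec t), 0) = _
      rw [hK0, hG]
    · rintro ⟨y, t⟩
      rw [ContinuousMap.mul_apply, ContinuousMap.inv_apply, eq_mul_inv_iff_mul_eq]
      apply Units.ext
      have hz : ((ec t : Circle) : ℂ) ^ d ≠ 0 := pow_ne_zero _ (Circle.coe_ne_zero _)
      rw [Units.val_mul, mkGL_val]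
      change K ((y, ec t), 1) * pz (2 * d) (fun k => q k y) (ec t : ℂ) = pz (2 * d) (fun k => p k y) (ec t : ℂ)
      rw [hK1, hqz y, Matrix.mul_smul, Matrix.mul_one, smul_smul, mul_inv_cancel₀ hz, one_smul]
    · rintro ⟨y, s⟩ hw t
      rw [hF _ hw]
      apply Units.ext
      rw [mkGL_val]
      change K ((y, ec s), t) = 1
      rcases hw with h | h | h
      · rw [hKT y h, hG, hF _ (Or.inl h)]; rfl
      · simp only at h; subst h; rw [ec_zero, hKc]
      · simp only at h; subst h; rw [ec_one, hKc]

/-- step 3 -/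
theorem Gm_surj [CompactSpace X] [T2Space X] {S : Set X} {c : Finset κ} {n : ℕ} (hX : DimLE X n)
    (hX1 : DimLE (X × I) n) (hX3 : DimLE (((X × I) × I) × I) n) (hn : n ≤ 2 * c.card)
    (hc : c.card ≤ cᶜ.card) {F : C((X × I) × I, GL κ ℂ)} (hF : F ∈ Lp (bd (bd S)) (GL κ ℂ)) :
    ∃ V, V ∈ VV S c ∧ Ht (bd (bd S)) F (Gm c V) := by
  obtain ⟨d, R, hR, hRi, hd, hRT, hH⟩ := bott_lin (bd S) hF
  set c' := cE (2 * d) d (∅ : Finset κ) with hc'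
  obtain ⟨g, hg0, hgR, hgS⟩ := idem_transport R hR hRi
  have hR0 : ∀ x, R (x, 0) = Pc c' := fun x => hRT _ (Or.inr (Or.inl rfl))
  have hR1 : ∀ x, R (x, 1) = Pc c' := fun x => hRT _ (Or.inr (Or.inr rfl))
  have hV' : g⁻¹ ∈ VV S c' := by
    refine inv_mem ⟨hg0, ?_, ?_⟩
    · intro x hx t
      exact hgS x (fun s => by rw [hR0]; exact hRT _ (Or.inl hx)) t
    · intro x
      have := hgR x 1
      rwa [hR0, hR1] at this
  have hGm : zt R hR (fun y => Reg_idem (hRi y)) * (Dg c')⁻¹ = Gm c' g⁻¹ := by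
    ext1 w
    obtain ⟨⟨x, s⟩, t⟩ := w
    rw [Gm_apply, ContinuousMap.mul_apply, ContinuousMap.inv_apply]
    congr 1
    rw [ContinuousMap.inv_apply, inv_inv, eq_mul_inv_iff_mul_eq]
    apply Units.ext
    rw [Units.val_mul, Units.val_mul, zt_val, Dg_val, Matrix.add_mul, Matrix.mul_add, Matrix.one_mul, Matrix.mul_one,
      Matrix.smul_mul, Matrix.mul_smul, ← hgR x s, hR0]
  rw [hGm] at hH
  let E : κ ↪ κ × Fin (2 * d + 1) := ⟨fun a => (a, if a ∈ c then 0 else Fin.last _), fun a b h => (Prod.mk.inj h).1⟩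
  have hE : ∀ a, E a ∈ c' ↔ a ∈ c := by
    intro a
    change (a, if a ∈ c then 0 else Fin.last _) ∈ c' ↔ a ∈ c
    rw [hc', mem_cE]
    by_cases h : a ∈ c
    · simp [h]; omega
    · simp [h]; omega
  have hcc : n ≤ 2 * c'ᶜ.card := by
    have := Fintype.card_le_of_embedding (rE E cᶜ c'ᶜ (fun a => by simp [hE]))
    simp only [Fintype.card_coe] at this
    omega
  have hnc : n ≤ 2 * Fintype.card c := by simpa using hn
  obtain ⟨f, hf, hff⟩ := stab_surj hX (rE E c c' hE) hnc (resf_Lp _ hV')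
  obtain ⟨V, hV, hVf⟩ := res_surj hc hf
  have hVE : pe E V ∈ VV S c' := by
    refine ⟨?_, ?_, ?_⟩
    · intro x; simp [hV.1]
    · intro x hx t; simp [hV.2.1 x hx]
    · intro x
      rw [pe_apply, ext_val]
      exact Com_ext E c c' hE (hV.2.2 x)
  have hres : resf (pe E V) hVE = pe (rE E c c' hE) f := by
    ext1 x
    apply Units.ext
    rw [resf_val, pe_apply, pe_apply, ext_val, ext_val, blk_ext E c c' hE, ← hVf, resf_val]
  have hW := mul_mem (inv_mem hVE) hV'
  have hWres : resf ((pe E V)⁻¹ * g⁻¹) hW ∈ Nul S (GL c' ℂ) := by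
    have e : resf (pe E V) hVE * resf ((pe E V)⁻¹ * g⁻¹) hW = resf g⁻¹ hV' := by
      rw [← resf_mul]
      congr 1
      group
    have e2 : resf ((pe E V)⁻¹ * g⁻¹) hW = (resf (pe E V) hVE)⁻¹ * resf g⁻¹ hV' := by
      rw [← e]; group
    rw [e2, hres]
    exact hff.symm
  have hWn := ker_res_le hX1 hcc hW hWres
  have h3 : Ht (bd (bd S)) (Gm c' g⁻¹) (pe E (Gm c V)) := by
    rw [← Gm_pe E c c' hE]
    have := Gm_mul hVE hW
    rw [mul_inv_cancel_left] at this
    refine this.trans ?_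
    have h4 := (Ht.refl (bd (bd S)) (Gm c' (pe E V))).mul (Ht.iff_one.2 hWn)
    rwa [mul_one] at h4
  have h5 : Ht (bd (bd S)) (pe E F) (pe E (Gm c V)) := ((pe_indep E _ hF).trans hH).trans h3
  refine ⟨V, hV, ?_⟩
  have hnk : n ≤ 2 * Fintype.card κ := by
    have := Finset.card_le_univ c
    omega
  refine stab_inj hX3 E hnk (mul_mem (inv_mem hF) (Gm_Lp hV)) ?_
  rw [map_mul, map_inv]
  exact h5

/-- conjugated projection -/
def cj (c : Finset κ) (V : C(Y, GL κ ℂ)) (y : Y) : Matrix κ κ ℂ :=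
  ((V y)⁻¹ : GL κ ℂ) * Pc c * (V y : Matrix κ κ ℂ)

theorem cj_cont (c : Finset κ) (V : C(Y, GL κ ℂ)) : Continuous (cj c V) := by
  have e1 : Continuous fun y => (((V y)⁻¹ : GL κ ℂ) : Matrix κ κ ℂ) := Units.continuous_val.comp (by fun_prop)
  have e2 : Continuous fun y => ((V y : GL κ ℂ) : Matrix κ κ ℂ) := Units.continuous_val.comp (by fun_prop)
  exact (e1.mul continuous_const).mul e2

theorem cj_eq {c : Finset κ} {V : C(Y, GL κ ℂ)} {y : Y} (h : Com c (V y : Matrix κ κ ℂ)) : cj c V y = Pc c := by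
  unfold Com at h
  unfold cj
  rw [Matrix.mul_assoc, ← h, ← Matrix.mul_assoc, ← Units.val_mul]
  simp

theorem mul_cj (c : Finset κ) (V : C(Y, GL κ ℂ)) (y : Y) :
    (V y : Matrix κ κ ℂ) * cj c V y = Pc c * (V y : Matrix κ κ ℂ) := by
  unfold cj
  rw [← Matrix.mul_assoc, ← Matrix.mul_assoc, ← Units.val_mul]
  simp

theorem cj_sq (c : Finset κ) (V : C(Y, GL κ ℂ)) (y : Y) : cj c V y * cj c V y = cj c V y := by
  unfold cj
  have e : (V y : Matrix κ κ ℂ) * ((V y)⁻¹ : GL κ ℂ) = 1 := by rw [← Units.val_mul]; simp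
  calc _ = ((V y)⁻¹ : GL κ ℂ) * Pc c * ((V y : Matrix κ κ ℂ) * ((V y)⁻¹ : GL κ ℂ)) * Pc c * (V y : Matrix κ κ ℂ) := by
        simp only [Matrix.mul_assoc]
    _ = _ := by rw [e, Matrix.mul_one, Matrix.mul_assoc _ (Pc c) (Pc c), Pc_sq]

theorem bott_lin2 [CompactSpace Y] [T2Space Y] (T : Set Y) (c : Finset κ) (V : C(Y, GL κ ℂ))
    (hV : ∀ y ∈ T, Com c (V y : Matrix κ κ ℂ)) (h : Gm c V ∈ Nul (bd T) (GL κ ℂ)) :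
    ∃ (d : ℕ) (R : Y × I → Matrix (κ × Fin (2 * d + 1)) (κ × Fin (2 * d + 1)) ℂ), Continuous R ∧
      (∀ y, R y * R y = R y) ∧ 1 ≤ d ∧ (∀ y, R (y, 0) = Pc (cE (2 * d) d c)) ∧
      (∀ y, R (y, 1) = Ed (2 * d) d (cj c V y)) ∧ ∀ y ∈ T, ∀ τ, R (y, τ) = Pc (cE (2 * d) d c) := by
  obtain ⟨H, h0, h1, hS⟩ := h
  let F0 : C((Y × I) × I, GL κ ℂ) := ⟨fun w => H ((w.1.1, w.2), w.1.2) * Dg c (w.1.1, w.2), by fun_prop⟩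
  have hF0 : ∀ y τ t, F0 ((y, τ), t) = H ((y, t), τ) * Dg c (y, t) := fun _ _ _ => rfl
  have hH1 : ∀ y τ t, (t = 0 ∨ t = 1) → H ((y, t), τ) = 1 := fun y τ t ht => hS (y, t) (Or.inr ht) τ
  have hF01 : ∀ y t, (t = 0 ∨ t = 1) → F0 (y, t) = 1 := by
    rintro ⟨y, τ⟩ t ht
    rw [hF0, hH1 _ _ _ ht, Dg_one c (y, t) ht, mul_one]
  obtain ⟨G, hG⟩ := to_circle F0 (fun y => by rw [hF01 _ _ (Or.inl rfl), hF01 _ _ (Or.inr rfl)])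
  have hG1 : ∀ y, G (y, 1) = 1 := fun y => by
    have := hG y 0
    rwa [ec_zero, hF01 _ _ (Or.inl rfl)] at this
  let Q : Y × I → Matrix κ κ ℂ := fun w => ((1 - (w.2 : ℝ) : ℝ) : ℂ) • Pc c + ((w.2 : ℝ) : ℂ) • cj c V w.1
  have hQc : Continuous Q := by
    have e1 : Continuous fun w : Y × I => ((1 - (w.2 : ℝ) : ℝ) : ℂ) := by fun_prop
    have e2 : Continuous fun w : Y × I => ((w.2 : ℝ) : ℂ) := by fun_prop
    exact (e1.smul continuous_const).add (e2.smul ((cj_cont c V).comp continuous_fst))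
  have hQ0 : ∀ y, Q (y, 0) = Pc c := by intro y; simp [Q]
  have hQ1 : ∀ y, Q (y, 1) = cj c V y := by intro y; simp [Q]
  have hQS : ∀ y ∈ T, ∀ τ, Q (y, τ) = Pc c := by
    intro y hy τ
    simp only [Q, cj_eq (hV y hy)]
    rw [← add_smul]
    simp
  have hQi : ∀ w ∈ bd T, Q w * Q w = Q w := by
    rintro ⟨y, τ⟩ (hw | hw | hw)
    · rw [hQS y hw, Pc_sq]
    · simp only at hw; subst hw; rw [hQ0, Pc_sq]
    · simp only at hw; subst hw; rw [hQ1, cj_sq]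
  obtain ⟨d, p, hd, hp, hpT, hp1, hpu, -⟩ :=
    laurent_norm (bd T) (fun w => (G w : Matrix κ κ ℂ)) (Units.continuous_val.comp G.continuous)
      (fun w => (G w).isUnit) (fun y => by rw [hG1]; rfl) Q hQc (by
        rintro ⟨y, τ⟩ hy z
        obtain ⟨t, rfl⟩ := ec_surj z
        rw [hG, hF0]
        rcases hy with hy | hy | hy
        · rw [hS (y, t) (Or.inl hy), one_mul, Dg_val, hQS y hy]
        · simp only at hy; subst hy; rw [h0, one_mul, Dg_val, hQ0]
        · simp only at hy; subst hy
          rw [h1, hQ1, Gm_apply, inv_mul_cancel_right, Units.val_mul, Units.val_mul, Dg_val,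
            Matrix.mul_add, Matrix.add_mul, Matrix.mul_one, ← Units.val_mul]
          simp [cj])
  have hRr : ∀ y, Reg (bP (2 * d) (fun k => p k y)) := fun y => bP_Reg _ (hp1 y) (hpu y)
  let R : Y × I → Matrix (κ × Fin (2 * d + 1)) (κ × Fin (2 * d + 1)) ℂ := fun y => sp (bP (2 * d) (fun k => p k y))
  have hR : Continuous R := sp_continuous (bP_cont hp) hRr
  have hRi : ∀ y, R y * R y = R y := fun y => sp_sq (hRr y)
  have hRT : ∀ w ∈ bd T, R w = Ed (2 * d) d (Q w) := fun w hw =>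
    sp_bdry d (by omega) _ (hQi w hw) _ (hpT w hw) (hRr w)
  refine ⟨d, R, hR, hRi, hd, ?_, ?_, ?_⟩
  · intro y
    rw [hRT _ (Or.inr (Or.inl rfl)), hQ0, Ed_Pc]
  · intro y
    rw [hRT _ (Or.inr (Or.inr rfl)), hQ1]
  · intro y hy τ
    rw [hRT _ (Or.inl hy), hQS y hy, Ed_Pc]

theorem blkC (c : Finset κ) (W : C(Y, GL κ ℂ)) (hW : ∀ y, Com c (W y : Matrix κ κ ℂ)) :
    ∃ K : C(Y, GL c ℂ), ∀ y, (K y : Matrix c c ℂ) = blk c (W y : Matrix κ κ ℂ) :=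
  ⟨mkGL (fun y => blk c (W y : Matrix κ κ ℂ)) ((blk_continuous c).comp (Units.continuous_val.comp W.continuous))
    (fun y => blk_unit (hW y)), fun y => rfl⟩

theorem ker_Gm_fin [CompactSpace X] [T2Space X] {S : Set X} {c : Finset κ} {n d D : ℕ}
    (hX1 : DimLE (X × I) n) (hn : n ≤ 2 * c.card) {V : C(X × I, GL κ ℂ)} (hV : V ∈ VV S c)
    (hdD : d ≤ D) (g : C((X × I) × I, GL (κ × Fin (D + 1)) ℂ))
    (hg1 : ∀ y ∈ bd S, ∀ t, g (y, t) = 1)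
    (hgR : ∀ y, (g (y, 1) : Matrix _ _ ℂ) * Pc (cE D d c) = Ed D d (cj c V y) * (g (y, 1) : Matrix _ _ ℂ)) :
    resf V hV ∈ Nul S (GL c ℂ) := by
  have hE : ∀ a, ed κ D d hdD a ∈ cE D d c ↔ a ∈ c := by
    intro a
    rw [mem_cE]
    simp [ed_apply]
  generalize hEE : ed κ D d hdD = E at hE
  generalize hcc : cE D d c = c' at hE hgR
  let W : C(X × I, GL (κ × Fin (D + 1)) ℂ) := pe E V * pre ⟨fun y => (y, 1), by fun_prop⟩ g
  have hWv : ∀ y, W y = ext E (V y) * g (y, 1) := fun _ => rfl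
  clear_value W
  have hW : ∀ y, Com c' (W y : Matrix _ _ ℂ) := by
    intro y
    unfold Com
    rw [hWv, Units.val_mul, ext_val, Matrix.mul_assoc, hgR y, ← Matrix.mul_assoc, ← Matrix.mul_assoc,
      ← hEE, ext_mul_Ed, ← hcc, ← Ed_Pc, Ed_mul_ext, mul_cj]
  have hnc : n ≤ 2 * Fintype.card c := by simpa using hn
  refine stab_inj hX1 (rE E c c' hE) hnc (resf_Lp V hV) ?_
  obtain ⟨K, hK⟩ := blkC c' W hW
  refine ⟨K, ?_, ?_, ?_⟩
  · intro x
    apply Units.ext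
    rw [hK, hWv, hg1 (x, 0) (Or.inr (Or.inl rfl)), hV.1, map_one, mul_one, Units.val_one, Units.val_one, blk_one]
  · intro x
    apply Units.ext
    rw [hK, hWv, hg1 (x, 1) (Or.inr (Or.inr rfl)), mul_one, pe_apply, ext_val, ext_val, blk_ext E c c' hE, resf_val]
  · intro x hx t
    apply Units.ext
    rw [hK, hWv, hg1 (x, t) (Or.inl hx), hV.2.1 x hx, map_one, mul_one, Units.val_one, Units.val_one, blk_one]

/-- step 4 -/
theorem ker_Gm_le [CompactSpace X] [T2Space X] {S : Set X} {c : Finset κ} {n : ℕ}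
    (hX1 : DimLE (X × I) n) (hn : n ≤ 2 * c.card) {V : C(X × I, GL κ ℂ)} (hV : V ∈ VV S c)
    (h : Gm c V ∈ Nul (bd (bd S)) (GL κ ℂ)) : resf V hV ∈ Nul S (GL c ℂ) := by
  obtain ⟨d, R, hR, hRi, hd, hR0, hR1, hRS⟩ := bott_lin2 (bd S) c V (VV_Com hV) h
  obtain ⟨g, hg0, hgR, hgS⟩ := idem_transport R hR hRi
  have hdD : d ≤ 2 * d := by omega
  have hg1 : ∀ y ∈ bd S, ∀ t, g (y, t) = 1 := fun y hy => hgS y (fun t => by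
    rw [hRS y hy, hRS y hy])
  exact ker_Gm_fin hX1 hn hV hdD g hg1 (fun y => by
    have := hgR y 1
    rwa [hR0, hR1] at this)

/-- Bott periodicity -/
theorem bott [CompactSpace X] [T2Space X] {S : Set X} {c : Finset κ} {n : ℕ} (hX : DimLE X n)
    (hX1 : DimLE (X × I) n) (hX3 : DimLE (((X × I) × I) × I) n) (hn : n ≤ 2 * c.card)
    (hc : c.card ≤ cᶜ.card) : Nonempty (A S (GL c ℂ) ≃* A (bd (bd S)) (GL κ ℂ)) := by
  have s1 : Function.Surjective (resH S c) := by
    intro a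
    induction a using QuotientGroup.induction_on with
    | H f =>
      obtain ⟨V, hV, hVf⟩ := res_surj hc f.2
      refine ⟨⟨V, hV⟩, ?_⟩
      change (QuotientGroup.mk (⟨resf V hV, resf_Lp _ _⟩ : Lp S (GL c ℂ)) : A S (GL c ℂ)) = _
      congr 1
      exact Subtype.ext hVf
  have s2 : Function.Surjective (GmH S c) := by
    intro a
    induction a using QuotientGroup.induction_on with
    | H f =>
      obtain ⟨V, hV, hVf⟩ := Gm_surj hX hX1 hX3 hn hc f.2
      refine ⟨⟨V, hV⟩, ?_⟩
      change (QuotientGroup.mk (⟨Gm c V, Gm_Lp hV⟩ : Lp (bd (bd S)) (GL κ ℂ)) : A (bd (bd S)) (GL κ ℂ)) = _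
      rw [A_eq]
      exact hVf.symm
  have hk : (resH S c).ker = (GmH S c).ker := by
    ext V
    rw [MonoidHom.mem_ker, MonoidHom.mem_ker]
    change (QuotientGroup.mk (⟨resf V.1 V.2, resf_Lp _ _⟩ : Lp S (GL c ℂ)) : A S (GL c ℂ)) = 1 ↔
      (QuotientGroup.mk (⟨Gm c V.1, Gm_Lp V.2⟩ : Lp (bd (bd S)) (GL κ ℂ)) : A (bd (bd S)) (GL κ ℂ)) = 1
    rw [A_eq_one, A_eq_one]
    exact ⟨ker_res_le hX1 (by omega) V.2, ker_Gm_le hX1 hn V.2⟩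
  exact ⟨(QuotientGroup.quotientKerEquivOfSurjective _ s1).symm.trans
    ((QuotientGroup.quotientMulEquivOfEq hk).trans (QuotientGroup.quotientKerEquivOfSurjective _ s2))⟩

end bott2
end
end BP
end Part11

section Part12
open Matrix Kronecker Topology
namespace BP
set_option linter.unusedSectionVars false
set_option linter.unusedSimpArgs false
noncomputable section
open unitInterval

section base
variable {X : Type} [TopologicalSpace X] {Y : Type} [TopologicalSpace Y]

theorem exp_lift [CompactSpace X] (h : X × I → ℂ) (hc : Continuous h) (hne : ∀ w, h w ≠ 0)
    (h1 : ∀ x, h (x, 0) = 1) : ∃ g : C(X × I, ℂ), (∀ x, g (x, 0) = 0) ∧ (∀ w, Complex.exp (g w) = h w) ∧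
      ∀ x, (∀ t, h (x, t) = 1) → ∀ t, g (x, t) = 0 := by
  let B := {z : ℂ // z ≠ 0}
  have hq : Continuous fun p : B × B => p.2.1 / p.1.1 := by
    have e1 : Continuous fun b : B × B => b.1.1 := continuous_subtype_val.comp continuous_fst
    have e2 : Continuous fun b : B × B => b.2.1 := continuous_subtype_val.comp continuous_snd
    exact e2.div e1 (fun p => p.1.2)
  obtain ⟨g, g0, gT, gc⟩ := transport (X := X) (B := B) (G := Multiplicative ℂ)
    (fun g b b' => b'.1 = Complex.exp g.toAdd * b.1)
    (by intro b; simp)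
    (by
      intro g g' b b' b'' h1 h2
      rw [h2, h1, toAdd_mul, Complex.exp_add, mul_assoc])
    {p | p.2.1 / p.1.1 ∈ Complex.slitPlane}
    (Complex.isOpen_slitPlane.preimage hq)
    (by intro b; simp [div_self b.2])
    (fun p => Multiplicative.ofAdd (Complex.log (p.2.1 / p.1.1)))
    (by
      have : ContinuousOn (fun p : B × B => Complex.log (p.2.1 / p.1.1)) {p | p.2.1 / p.1.1 ∈ Complex.slitPlane} :=
        hq.continuousOn.clog (fun p hp => hp)
      exact continuous_ofAdd.comp_continuousOn this)
    (by intro b; simp [div_self b.2])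
    (by
      rintro ⟨b, b'⟩ hb
      simp only [toAdd_ofAdd]
      rw [Complex.exp_log (div_ne_zero b'.2 b.2), div_mul_cancel₀ _ b.2])
    ⟨fun w => ⟨h w, hne w⟩, by fun_prop⟩
  refine ⟨⟨fun w => (g w).toAdd, continuous_toAdd.comp g.continuous⟩, ?_, ?_, ?_⟩
  · intro x
    simp [g0]
  · rintro ⟨x, t⟩
    have := gT x t
    simp only [ContinuousMap.coe_mk, h1, mul_one] at this
    exact this.symm
  · intro x hx t
    have := gc x (fun t => Subtype.ext (by simp [hx])) t
    simp [this]

/-- exponential in rank one -/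
def dE (φ : C(Y, ℂ)) : C(Y, GL (Fin 1) ℂ) :=
  mkGL (fun y => Matrix.diagonal fun _ => Complex.exp (φ y)) (by fun_prop) (fun y => by
    rw [Matrix.isUnit_iff_isUnit_det, Matrix.det_diagonal]
    simp [Complex.exp_ne_zero])

theorem dE_val (φ : C(Y, ℂ)) (y : Y) : ((dE φ y : GL (Fin 1) ℂ) : Matrix (Fin 1) (Fin 1) ℂ) =
    Matrix.diagonal fun _ => Complex.exp (φ y) := rfl

theorem dE_ext {φ : C(Y, ℂ)} {y : Y} {g : GL (Fin 1) ℂ} (h : Complex.exp (φ y) = (g : Matrix (Fin 1) (Fin 1) ℂ) 0 0) :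
    dE φ y = g := by
  apply Units.ext
  rw [dE_val, h]
  ext i j
  fin_cases i
  fin_cases j
  simp

theorem dE_entry (φ : C(Y, ℂ)) (y : Y) : ((dE φ y : GL (Fin 1) ℂ) : Matrix (Fin 1) (Fin 1) ℂ) 0 0 =
    Complex.exp (φ y) := by simp [dE_val]

theorem dE_add (φ ψ : C(Y, ℂ)) : dE (φ + ψ) = dE φ * dE ψ := by
  ext1 y
  apply Units.ext
  rw [ContinuousMap.mul_apply, Units.val_mul, dE_val, dE_val, dE_val, Matrix.diagonal_mul_diagonal]
  simp [Complex.exp_add]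

/-- linear phase -/
def ph (U : Type) [TopologicalSpace U] (n : ℤ) : C(U × I, ℂ) := ⟨fun w => n * (2 * Real.pi * Complex.I) * ((w.2 : ℝ) : ℂ), by fun_prop⟩

theorem ph_apply (U : Type) [TopologicalSpace U] (n : ℤ) (w : U × I) :
    ph U n w = n * (2 * Real.pi * Complex.I) * ((w.2 : ℝ) : ℂ) := rfl

theorem ph_Lp (U : Type) [TopologicalSpace U] (n : ℤ) : dE (ph U n) ∈ Lp (bd (∅ : Set U)) (GL (Fin 1) ℂ) := by
  rintro ⟨u, t⟩ (h | h | h)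
  · exact absurd h (Set.notMem_empty _)
  · simp only at h; subst h
    apply dE_ext
    simp [ph_apply]
  · simp only at h; subst h
    apply dE_ext
    simp [ph_apply, Complex.exp_int_mul_two_pi_mul_I]

/-- the degree homomorphism -/
def phH (U : Type) [TopologicalSpace U] : Multiplicative ℤ →* A (bd (∅ : Set U)) (GL (Fin 1) ℂ) :=
  MonoidHom.mk' (fun n => QuotientGroup.mk ⟨dE (ph U n.toAdd), ph_Lp U _⟩) (by
    intro a b
    rw [← QuotientGroup.mk_mul]
    congr 1
    apply Subtype.ext
    change dE _ = dE _ * dE _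
    rw [← dE_add]
    congr 1
    ext w
    simp [ph_apply]
    ring)

theorem base_one (U : Type) [TopologicalSpace U] [Unique U] [CompactSpace U] :
    Nonempty (A (bd (∅ : Set U)) (GL (Fin 1) ℂ) ≃* Multiplicative ℤ) := by
  have inj : Function.Injective (phH U) := by
    rw [injective_iff_map_eq_one]
    intro n hn
    have hn : dE (ph U n.toAdd) ∈ Nul (bd (∅ : Set U)) (GL (Fin 1) ℂ) := A_eq_one.1 hn
    obtain ⟨K, k0, k1, kS⟩ := hn
    obtain ⟨g, g0, ge, gc⟩ := exp_lift (fun w => ((K w : GL (Fin 1) ℂ) : Matrix (Fin 1) (Fin 1) ℂ) 0 0)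
      ((Units.continuous_val.comp K.continuous).matrix_elem 0 0) (fun w => by
        have := (Matrix.isUnit_iff_isUnit_det _).1 (K w).isUnit
        rw [Matrix.det_fin_one] at this
        exact this.ne_zero) (fun x => by simp [k0])
    let u : U := default
    let ψ : I → ℝ := fun t => ((g ((u, t), 1) - ph U n.toAdd (u, t)) / (2 * Real.pi * Complex.I)).re
    have hψ : Continuous ψ := by
      refine Complex.continuous_re.comp (Continuous.div_const ?_ _)
      exact Continuous.sub (by fun_prop) (by fun_prop)
    have hne : (2 * Real.pi * Complex.I : ℂ) ≠ 0 := Complex.two_pi_I_ne_zero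
    have hintg : ∀ t, ∃ m : ℤ, ψ t = m := by
      intro t
      have e1 : Complex.exp (g ((u, t), 1)) = Complex.exp (ph U n.toAdd (u, t)) := by
        rw [ge, k1, dE_entry]
      obtain ⟨m, hm⟩ := Complex.exp_eq_exp_iff_exists_int.1 e1
      refine ⟨m, ?_⟩
      simp only [ψ, hm, add_sub_cancel_left, mul_div_cancel_right₀ _ hne]
      simp
    have hz : ∀ t : I, (t = 0 ∨ t = 1) → g ((u, t), 1) = 0 := by
      intro t ht
      exact gc _ (fun s => by rw [kS (u, t) (Or.inr ht)]; simp) 1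
    have p0 : ψ 0 = 0 := by simp [ψ, hz 0 (Or.inl rfl), ph_apply]
    have p1 : ψ 1 = -(n.toAdd : ℝ) := by
      simp only [ψ, hz 1 (Or.inr rfl), ph_apply]
      simp only [Set.Icc.coe_one, Complex.ofReal_one, mul_one, zero_sub, neg_div, mul_div_cancel_right₀ _ hne]
      simp
    by_contra hn0
    have hn1 : n.toAdd ≠ 0 := fun h => hn0 (by simpa using h)
    rcases lt_or_gt_of_ne hn1 with hlt | hgt
    · have : (1 / 2 : ℝ) ∈ Set.range ψ := mem_range_of_exists_le_of_exists_ge hψ ⟨0, by rw [p0]; norm_num⟩ ⟨1, by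
        rw [p1]
        have : n.toAdd ≤ -1 := by omega
        have : (n.toAdd : ℝ) ≤ -1 := by exact_mod_cast this
        linarith⟩
      obtain ⟨t, ht⟩ := this
      obtain ⟨m, hm⟩ := hintg t
      rw [ht] at hm
      have : (1 : ℝ) = ((2 * m : ℤ) : ℝ) := by push_cast; linarith
      have : (1 : ℤ) = 2 * m := by exact_mod_cast this
      omega
    · have : (-(1 / 2) : ℝ) ∈ Set.range ψ := mem_range_of_exists_le_of_exists_ge hψ ⟨1, by
        rw [p1]
        have : 1 ≤ n.toAdd := by omega
        have : 1 ≤ (n.toAdd : ℝ) := by exact_mod_cast this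
        linarith⟩ ⟨0, by rw [p0]; norm_num⟩
      obtain ⟨t, ht⟩ := this
      obtain ⟨m, hm⟩ := hintg t
      rw [ht] at hm
      have : (-1 : ℝ) = ((2 * m : ℤ) : ℝ) := by push_cast; linarith
      have : (-1 : ℤ) = 2 * m := by exact_mod_cast this
      omega
  have surj : Function.Surjective (phH U) := by
    intro a
    induction a using QuotientGroup.induction_on with
    | H f =>
      obtain ⟨f, hf⟩ := f
      have hf0 : ∀ u, f (u, 0) = 1 := fun u => hf _ (Or.inr (Or.inl rfl))
      have hf1 : ∀ u, f (u, 1) = 1 := fun u => hf _ (Or.inr (Or.inr rfl))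
      obtain ⟨g, g0, ge, -⟩ := exp_lift (fun w => ((f w : GL (Fin 1) ℂ) : Matrix (Fin 1) (Fin 1) ℂ) 0 0)
        ((Units.continuous_val.comp f.continuous).matrix_elem 0 0) (fun w => by
          have := (Matrix.isUnit_iff_isUnit_det _).1 (f w).isUnit
          rw [Matrix.det_fin_one] at this
          exact this.ne_zero) (fun x => by simp [hf0])
      have hg1 : Complex.exp (g (default, 1)) = 1 := by rw [ge, hf1]; simp
      obtain ⟨n, hn⟩ := Complex.exp_eq_one_iff.1 hg1
      refine ⟨Multiplicative.ofAdd n, ?_⟩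
      change (QuotientGroup.mk (⟨dE (ph U n), ph_Lp U n⟩ : Lp _ _) : A _ _) = _
      rw [A_eq]
      apply Ht.symm
      let L : C((U × I) × I, ℂ) := ⟨fun w => ((1 - (w.2 : ℝ) : ℝ) : ℂ) * g w.1 + ((w.2 : ℝ) : ℂ) * ph U n w.1, by fun_prop⟩
      have hL : ∀ w, L w = ((1 - (w.2 : ℝ) : ℝ) : ℂ) * g w.1 + ((w.2 : ℝ) : ℂ) * ph U n w.1 := fun _ => rfl
      refine Ht.of_homotopy (dE L) ?_ ?_ ?_
      · intro w
        apply dE_ext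
        rw [hL, ← ge]; simp
      · intro w
        apply dE_ext
        rw [hL, dE_entry]; simp
      · rintro ⟨u, t⟩ hw τ
        apply dE_ext
        obtain rfl : u = default := Subsingleton.elim _ _
        rw [hL, ← ge]
        congr 1
        have : g (default, t) = ph U n (default, t) := by
          rcases hw with h | h | h
          · exact absurd h (Set.notMem_empty _)
          · simp only at h; subst h; rw [g0, ph_apply]; simp
          · simp only at h; subst h; rw [hn, ph_apply]; simp
        simp only [this]
        push_cast
        ring
  exact ⟨(MulEquiv.ofBijective (phH U) ⟨inj, surj⟩).symm⟩

end base

section cubes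
variable {G : Type} [Group G] [TopologicalSpace G] [IsTopologicalGroup G]
variable {ι κ : Type} [Fintype ι] [DecidableEq ι] [Fintype κ] [DecidableEq κ]

/-- boundary of the cube -/
abbrev bC (m : ℕ) : Set (Fin m → I) := Cube.boundary (Fin m)

/-- splitting off a coordinate -/
def spl (m : ℕ) : (Fin (m + 1) → I) ≃ₜ (Fin m → I) × I where
  toFun x := (fun i => x i.succ, x 0)
  invFun p := Fin.cons p.2 p.1
  left_inv x := by
    ext i
    refine Fin.cases ?_ (fun j => ?_) i <;> simp
  right_inv p := by simp
  continuous_toFun := by fun_prop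
  continuous_invFun := by
    refine continuous_pi fun i => ?_
    refine Fin.cases ?_ (fun j => ?_) i
    · simpa using continuous_snd
    · simp only [Fin.cons_succ]; fun_prop

theorem spl_bd (m : ℕ) (x : Fin (m + 1) → I) : x ∈ bC (m + 1) ↔ spl m x ∈ bd (bC m) := by
  simp only [Cube.boundary, Set.mem_ofPred_eq, bd, spl, Homeomorph.homeomorph_mk_coe, Equiv.coe_fn_mk, Fin.exists_fin_succ]
  exact or_comm

/-- cube groups -/
def Asucc (m : ℕ) : A (bd (bC m)) G ≃* A (bC (m + 1)) G := Apre (spl m) _ _ (spl_bd m)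

/-- cube groups, two steps -/
def Asucc2 (m : ℕ) : A (bd (bd (bC m))) G ≃* A (bC (m + 2)) G :=
  Apre ((spl (m + 1)).trans ((spl m).prodCongr (Homeomorph.refl I))) _ _ (by
    intro x
    rw [spl_bd]
    simp only [bd, Set.mem_ofPred_eq, Homeomorph.trans_apply]
    have := spl_bd m (spl (m + 1) x).1
    simp only [bd, Set.mem_ofPred_eq] at this
    rw [this]
    rfl)

theorem DimLE_1 (m : ℕ) : DimLE ((Fin m → I) × I) (m + 1) := (DimLE_cube (m + 1)).of_homeo (spl m)

theorem DimLE_3 (m : ℕ) : DimLE ((((Fin m → I) × I) × I) × I) (m + 3) :=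
  (((DimLE_cube (m + 3)).of_homeo (spl (m + 2))).of_homeo ((spl (m + 1)).prodCongr (Homeomorph.refl I))).of_homeo
    (((spl m).prodCongr (Homeomorph.refl I)).prodCongr (Homeomorph.refl I))

theorem stab_iso_inj (m : ℕ) (e : ι ↪ κ) (h : m + 1 ≤ 2 * Fintype.card ι) :
    Function.Injective (Amap (ext e) (ext_continuous e) (bC m)) := by
  rw [injective_iff_map_eq_one]
  intro a
  induction a using QuotientGroup.induction_on with
  | H f =>
    intro hf
    have hf : pe e f.1 ∈ Nul (bC m) (GL κ ℂ) := A_eq_one.1 hf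
    exact A_eq_one.2 (stab_inj (DimLE_1 m) e h f.2 hf)

theorem stab_iso (m : ℕ) (e : ι ↪ κ) (h : m + 1 ≤ 2 * Fintype.card ι) :
    Nonempty (A (bC m) (GL ι ℂ) ≃* A (bC m) (GL κ ℂ)) := by
  refine ⟨MulEquiv.ofBijective (Amap (ext e) (ext_continuous e) (bC m)) ⟨stab_iso_inj m e h, ?_⟩⟩
  intro a
  induction a using QuotientGroup.induction_on with
  | H f =>
    obtain ⟨g, hg, hfg⟩ := stab_surj (DimLE_cube m) e (by omega) f.2
    refine ⟨QuotientGroup.mk ⟨g, hg⟩, ?_⟩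
    rw [Amap_mk, A_eq]
    exact hfg.symm

theorem bott_cube (m N : ℕ) (hN : m + 3 ≤ 2 * N) :
    ∃ (ι : Type) (_ : Fintype ι) (_ : DecidableEq ι), N = Fintype.card ι ∧
      Nonempty (A (bC m) (GL ι ℂ) ≃* A (bC (m + 2)) (GL (Fin N ⊕ Fin N) ℂ)) := by
  let c : Finset (Fin N ⊕ Fin N) := Finset.univ.map Function.Embedding.inl
  have h1 : c.card = N := by simp [c]
  have h2 : cᶜ.card = N := by rw [Finset.card_compl, h1]; simp
  obtain ⟨b⟩ := bott (S := bC m) (c := c) (n := m + 3) ((DimLE_cube m).mono (by omega)) ((DimLE_1 m).mono (by omega))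
    (DimLE_3 m) (by omega) (by omega)
  exact ⟨c, inferInstance, inferInstance, by simp [h1], ⟨b.trans (Asucc2 m)⟩⟩

theorem A_equiv (m : ℕ) (e : ι ≃ κ) : Nonempty (A (bC m) (GL ι ℂ) ≃* A (bC m) (GL κ ℂ)) := by
  refine ⟨MulEquiv.ofBijective (Amap (ext e.toEmbedding) (ext_continuous _) (bC m)) ⟨?_, ?_⟩⟩
  · rw [injective_iff_map_eq_one]
    intro a
    induction a using QuotientGroup.induction_on with
    | H f =>
      intro hf
      have hf : pe e.toEmbedding f.1 ∈ Nul (bC m) (GL κ ℂ) := A_eq_one.1 hf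
      have := pe_Nul e.symm.toEmbedding hf
      have h2 := pe_equiv e.symm f.1
      rw [Equiv.symm_symm] at h2
      rw [h2] at this
      exact A_eq_one.2 this
  · intro a
    induction a using QuotientGroup.induction_on with
    | H f =>
      refine ⟨QuotientGroup.mk ⟨pe e.symm.toEmbedding f.1, pe_Lp _ f.2⟩, ?_⟩
      rw [Amap_mk, A_eq]
      have := pe_equiv e f.1
      change Ht _ (pe e.toEmbedding (pe e.symm.toEmbedding f.1)) f.1
      rw [this]
      exact Ht.refl _ _

theorem A_step (m : ℕ) (hι : m + 3 ≤ 2 * Fintype.card ι) (n : ℕ) (hn : m + 3 ≤ 2 * n) :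
    ∃ N, n ≤ N ∧ Nonempty (A (bC m) (GL (Fin N) ℂ) ≃* A (bC (m + 2)) (GL ι ℂ)) := by
  obtain ⟨κ, i1, i2, hκ, ⟨b⟩⟩ := bott_cube m (max n (Fintype.card ι)) (by omega)
  refine ⟨max n (Fintype.card ι), le_max_left _ _, ?_⟩
  obtain ⟨e1⟩ := A_equiv m (Fintype.equivFinOfCardEq hκ.symm)
  obtain ⟨e⟩ : Nonempty (ι ↪ Fin (max n (Fintype.card ι)) ⊕ Fin (max n (Fintype.card ι))) :=
    Function.Embedding.nonempty_of_card_le (by simp; omega)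
  obtain ⟨e2⟩ := stab_iso (m + 2) e hι
  exact ⟨(e1.symm.trans b).trans e2.symm⟩

theorem pi_odd (r : ℕ) : ∀ (ι : Type) [Fintype ι] [DecidableEq ι], r + 1 ≤ Fintype.card ι →
    Nonempty (A (bC (2 * r + 1)) (GL ι ℂ) ≃* Multiplicative ℤ) := by
  induction r with
  | zero =>
    intro ι _ _ h
    have hb : bC 0 = ∅ := by
      ext x; simp [Cube.boundary]
    obtain ⟨b⟩ := base_one (Fin 0 → I)
    rw [← hb] at b
    obtain ⟨e⟩ : Nonempty (Fin 1 ↪ ι) := Function.Embedding.nonempty_of_card_le (by simp; omega)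
    obtain ⟨e1⟩ := stab_iso 1 e (by simp)
    exact ⟨e1.symm.trans ((Asucc 0).symm.trans b)⟩
  | succ r ih =>
    intro ι _ _ h
    obtain ⟨N, hN, ⟨e⟩⟩ := A_step (ι := ι) (2 * r + 1) (by omega) (r + 2) (by omega)
    obtain ⟨b⟩ := ih (Fin N) (by simp; omega)
    exact ⟨e.symm.trans b⟩

theorem pi_even (r : ℕ) : ∀ (ι : Type) [Fintype ι] [DecidableEq ι], r + 1 ≤ Fintype.card ι →
    Subsingleton (A (bC (2 * r)) (GL ι ℂ)) := by
  induction r with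
  | zero =>
    intro ι _ _ h
    change Subsingleton (A (bC 0) (GL ι ℂ))
    rw [A_subsingleton]
    intro f _
    obtain ⟨γ, h0, h1⟩ := GL_path (f default)
    refine ⟨⟨fun w => γ w.2, by fun_prop⟩, ?_, ?_, ?_⟩
    · intro x; exact h0
    · intro x
      obtain rfl : x = default := Subsingleton.elim _ _
      exact h1
    · rintro x ⟨i, -⟩
      exact i.elim0
  | succ r ih =>
    intro ι _ _ h
    obtain ⟨N, hN, ⟨e⟩⟩ := A_step (ι := ι) (2 * r) (by omega) (r + 2) (by omega)
    have := ih (Fin N) (by simp; omega)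
    exact e.symm.toEquiv.subsingleton

end cubes
end
end BP
end Part12

section Part13
open Matrix Kronecker Topology
namespace BP
set_option linter.unusedSectionVars false
set_option linter.unusedSimpArgs false
noncomputable section
open unitInterval

section polar
open scoped MatrixOrder Matrix.Norms.L2Operator ComplexOrder
variable {ι : Type} [Fintype ι] [DecidableEq ι]

/-- absolute value -/
def ab (M : Matrix ι ι ℂ) : Matrix ι ι ℂ := CFC.sqrt (Mᴴ * M)

theorem ab_nonneg (M : Matrix ι ι ℂ) : (ab M).PosSemidef :=
  Matrix.nonneg_iff_posSemidef.1 (CFC.sqrt_nonneg _)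

theorem ab_sq (M : Matrix ι ι ℂ) : ab M * ab M = Mᴴ * M :=
  CFC.sqrt_mul_sqrt_self _ (Matrix.nonneg_iff_posSemidef.2 (Matrix.posSemidef_conjTranspose_mul_self M))

theorem ab_herm (M : Matrix ι ι ℂ) : (ab M)ᴴ = ab M := (ab_nonneg M).1

theorem ab_continuous : Continuous (ab : Matrix ι ι ℂ → Matrix ι ι ℂ) := by
  have h := CFC.continuousOn_sqrt (A := Matrix ι ι ℂ)
  have h2 : Continuous fun M : Matrix ι ι ℂ => Mᴴ * M := by fun_prop
  exact h.comp_continuous h2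
    (fun M => Matrix.nonneg_iff_posSemidef.2 (Matrix.posSemidef_conjTranspose_mul_self M))

theorem ab_unit {M : Matrix ι ι ℂ} (h : IsUnit M) : IsUnit (ab M) := by
  have : IsUnit (ab M * ab M) := by
    rw [ab_sq]
    exact (h.star).mul h
  rw [Matrix.isUnit_iff_isUnit_det] at this ⊢
  rw [Matrix.det_mul] at this
  exact isUnit_of_mul_isUnit_left this

theorem ab_mul_left {B : Matrix ι ι ℂ} (hB : Bᴴ * B = 1) (M : Matrix ι ι ℂ) : ab (B * M) = ab M := by
  unfold ab
  congr 1
  rw [Matrix.conjTranspose_mul, Matrix.mul_assoc, ← Matrix.mul_assoc Bᴴ, hB, Matrix.one_mul]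

theorem ab_mul_right {B : Matrix ι ι ℂ} (hB : B * Bᴴ = 1) (M : Matrix ι ι ℂ) : ab (M * B) = Bᴴ * ab M * B := by
  refine CFC.sqrt_unique ?_ ?_
  · rw [Matrix.conjTranspose_mul]
    calc Bᴴ * ab M * B * (Bᴴ * ab M * B) = Bᴴ * (ab M * (B * Bᴴ) * ab M) * B := by simp only [Matrix.mul_assoc]
      _ = _ := by rw [hB, Matrix.mul_one, ab_sq]; simp only [Matrix.mul_assoc]
  · exact Matrix.nonneg_iff_posSemidef.2 ((ab_nonneg M).conjTranspose_mul_mul_same B)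

theorem ab_one : ab (1 : Matrix ι ι ℂ) = 1 := by
  simp [ab, CFC.sqrt_one]

theorem ab_posDef {M : Matrix ι ι ℂ} (h : IsUnit M) : (ab M).PosDef :=
  ((ab_nonneg M).posDef_iff_isUnit).2 (ab_unit h)

end polar

section polar2
open scoped ComplexOrder
variable {ι : Type} [Fintype ι] [DecidableEq ι]
variable {X : Type} [TopologicalSpace X]

/-- unitary part -/
def pol (M : Matrix ι ι ℂ) : Matrix ι ι ℂ := M * (ab M)⁻¹

theorem pol_mul_ab {M : Matrix ι ι ℂ} (h : IsUnit M) : pol M * ab M = M := by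
  rw [pol, Matrix.mul_assoc, Matrix.nonsing_inv_mul _ ((Matrix.isUnit_iff_isUnit_det _).1 (ab_unit h)), Matrix.mul_one]

theorem pol_unitary {M : Matrix ι ι ℂ} (h : IsUnit M) : pol M ∈ Matrix.unitaryGroup ι ℂ := by
  have hd := (Matrix.isUnit_iff_isUnit_det _).1 (ab_unit h)
  rw [Matrix.mem_unitaryGroup_iff', Matrix.star_eq_conjTranspose, pol, Matrix.conjTranspose_mul, Matrix.conjTranspose_nonsing_inv, ab_herm]
  calc (ab M)⁻¹ * Mᴴ * (M * (ab M)⁻¹) = (ab M)⁻¹ * (Mᴴ * M) * (ab M)⁻¹ := by simp only [Matrix.mul_assoc]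
    _ = ((ab M)⁻¹ * ab M) * (ab M * (ab M)⁻¹) := by rw [← ab_sq]; simp only [Matrix.mul_assoc]
    _ = 1 := by rw [Matrix.nonsing_inv_mul _ hd, Matrix.mul_nonsing_inv _ hd, Matrix.one_mul]

theorem pol_mul_left {B : Matrix ι ι ℂ} (hB : B ∈ Matrix.unitaryGroup ι ℂ) (M : Matrix ι ι ℂ) : pol (B * M) = B * pol M := by
  rw [pol, pol, ab_mul_left (Matrix.mem_unitaryGroup_iff'.1 hB), Matrix.mul_assoc]

theorem pol_mul_right {B : Matrix ι ι ℂ} (hB : B ∈ Matrix.unitaryGroup ι ℂ) (M : Matrix ι ι ℂ) : pol (M * B) = pol M * B := by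
  have h1 : B * Bᴴ = 1 := Matrix.mem_unitaryGroup_iff.1 hB
  have h2 : Bᴴ * B = 1 := Matrix.mem_unitaryGroup_iff'.1 hB
  have i1 : B⁻¹ = Bᴴ := Matrix.inv_eq_right_inv h1
  have i2 : Bᴴ⁻¹ = B := Matrix.inv_eq_right_inv h2
  rw [pol, pol, ab_mul_right h1, Matrix.mul_inv_rev, Matrix.mul_inv_rev, i1, i2]
  calc M * B * (Bᴴ * ((ab M)⁻¹ * B)) = M * (B * Bᴴ) * (ab M)⁻¹ * B := by simp only [Matrix.mul_assoc]
    _ = _ := by rw [h1, Matrix.mul_one]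

theorem pol_one : pol (1 : Matrix ι ι ℂ) = 1 := by simp [pol, ab_one]

theorem pol_of_unitary {B : Matrix ι ι ℂ} (hB : B ∈ Matrix.unitaryGroup ι ℂ) : pol B = B := by
  have := pol_mul_left hB 1
  rwa [pol_one, Matrix.mul_one] at this

theorem continuousOn_pol {M : X → Matrix ι ι ℂ} {W : Set X} (hM : ContinuousOn M W) (hu : ∀ w ∈ W, IsUnit (M w)) :
    ContinuousOn (fun x => pol (M x)) W := by
  rw [continuousOn_iff_continuous_domRestrict] at hM ⊢
  refine Continuous.matrix_mul hM ?_
  exact continuous_inv_mat (ab_continuous.comp hM) (fun w => ab_unit (hu w w.2))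

open Classical in
/-- unitary part as element of the group -/
def polU (M : Matrix ι ι ℂ) : Matrix.unitaryGroup ι ℂ := if h : IsUnit M then ⟨pol M, pol_unitary h⟩ else 1

theorem polU_val {M : Matrix ι ι ℂ} (h : IsUnit M) : (polU M : Matrix ι ι ℂ) = pol M := by
  rw [polU, dif_pos h]

theorem continuousOn_polU {M : X → Matrix ι ι ℂ} {W : Set X} (hM : ContinuousOn M W) (hu : ∀ w ∈ W, IsUnit (M w)) :
    ContinuousOn (fun x => polU (M x)) W := by
  rw [Topology.IsInducing.subtypeVal.continuousOn_iff]
  refine (continuousOn_pol hM hu).congr ?_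
  intro w hw
  exact polU_val (hu w hw)

theorem U_isUnit (B : Matrix.unitaryGroup ι ℂ) : IsUnit (B : Matrix ι ι ℂ) :=
  (Unitary.toUnits B).isUnit

theorem polU_of (B : Matrix.unitaryGroup ι ℂ) : polU (B : Matrix ι ι ℂ) = B :=
  Subtype.ext (by rw [polU_val (U_isUnit B), pol_of_unitary B.2])

/-- inclusion -/
def toGL : Matrix.unitaryGroup ι ℂ →* GL ι ℂ := Unitary.toUnits

theorem toGL_val (B : Matrix.unitaryGroup ι ℂ) : ((toGL B : GL ι ℂ) : Matrix ι ι ℂ) = (B : Matrix ι ι ℂ) := rfl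

theorem toGL_continuous : Continuous (toGL : Matrix.unitaryGroup ι ℂ → GL ι ℂ) := by
  refine Units.continuous_iff.2 ⟨continuous_subtype_val, ?_⟩
  change Continuous fun B : Matrix.unitaryGroup ι ℂ => ((B⁻¹ : Matrix.unitaryGroup ι ℂ) : Matrix ι ι ℂ)
  exact continuous_subtype_val.comp continuous_inv

theorem U_Nul {S : Set X} {f : C(X, Matrix.unitaryGroup ι ℂ)} (hf : pc toGL toGL_continuous f ∈ Nul S (GL ι ℂ)) :
    f ∈ Nul S (Matrix.unitaryGroup ι ℂ) := by
  obtain ⟨K, k0, k1, kS⟩ := hf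
  refine ⟨⟨fun w => polU ((K w : GL ι ℂ) : Matrix ι ι ℂ), ?_⟩, ?_, ?_, ?_⟩
  · rw [← continuousOn_univ]
    exact continuousOn_polU (Units.continuous_val.comp K.continuous).continuousOn (fun w _ => (K w).isUnit)
  · intro x
    simp only [ContinuousMap.coe_mk, k0]
    exact polU_of 1
  · intro x
    simp only [ContinuousMap.coe_mk, k1]
    exact polU_of (f x)
  · intro x hx t
    simp only [ContinuousMap.coe_mk, kS x hx t]
    exact polU_of 1

theorem line_unit {M : Matrix ι ι ℂ} (h : IsUnit M) (t : I) :
    IsUnit (((1 - (t : ℝ) : ℝ) : ℂ) • M + ((t : ℝ) : ℂ) • pol M) := by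
  have e : ((1 - (t : ℝ) : ℝ) : ℂ) • M + ((t : ℝ) : ℂ) • pol M =
      pol M * (((1 - (t : ℝ) : ℝ) : ℂ) • ab M + ((t : ℝ) : ℂ) • (1 : Matrix ι ι ℂ)) := by
    rw [Matrix.mul_add, Matrix.mul_smul, Matrix.mul_smul, pol_mul_ab h, Matrix.mul_one]
  rw [e]
  refine (U_isUnit ⟨_, pol_unitary h⟩).mul ?_
  refine Matrix.PosDef.isUnit ?_
  rcases eq_or_lt_of_le t.2.1 with h0 | h0
  · rw [← h0]
    simpa using ab_posDef h
  · refine Matrix.PosDef.posSemidef_add ((ab_nonneg M).smul ?_) (Matrix.PosDef.one.smul ?_)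
    · exact_mod_cast sub_nonneg.2 t.2.2
    · exact_mod_cast h0

theorem U_surj {S : Set X} {f : C(X, GL ι ℂ)} (hf : f ∈ Lp S (GL ι ℂ)) :
    ∃ g ∈ Lp S (Matrix.unitaryGroup ι ℂ), Ht S f (pc toGL toGL_continuous g) := by
  have hv : Continuous fun x => ((f x : GL ι ℂ) : Matrix ι ι ℂ) := Units.continuous_val.comp f.continuous
  have hc : Continuous fun x => polU ((f x : GL ι ℂ) : Matrix ι ι ℂ) := by
    rw [← continuousOn_univ]
    exact continuousOn_polU hv.continuousOn (fun w _ => (f w).isUnit)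
  have hp : Continuous fun x => pol ((f x : GL ι ℂ) : Matrix ι ι ℂ) := by
    rw [← continuousOn_univ]
    exact continuousOn_pol hv.continuousOn (fun w _ => (f w).isUnit)
  refine ⟨⟨fun x => polU ((f x : GL ι ℂ) : Matrix ι ι ℂ), hc⟩, ?_, ?_⟩
  · intro x hx
    simp only [ContinuousMap.coe_mk, hf x hx]
    exact polU_of 1
  · let M : X × I → Matrix ι ι ℂ := fun w => ((1 - (w.2 : ℝ) : ℝ) : ℂ) • ((f w.1 : GL ι ℂ) : Matrix ι ι ℂ) +
      ((w.2 : ℝ) : ℂ) • pol ((f w.1 : GL ι ℂ) : Matrix ι ι ℂ)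
    have hM : Continuous M := by
      have a1 : Continuous fun w : X × I => ((1 - (w.2 : ℝ) : ℝ) : ℂ) := by fun_prop
      have a2 : Continuous fun w : X × I => ((w.2 : ℝ) : ℂ) := by fun_prop
      exact (a1.smul (hv.comp continuous_fst)).add (a2.smul (hp.comp continuous_fst))
    have hu : ∀ w, IsUnit (M w) := fun w => line_unit (f w.1).isUnit w.2
    refine Ht.of_homotopy (mkGL M hM hu) ?_ ?_ ?_
    · intro x
      apply Units.ext
      rw [mkGL_val]
      simp [M]
    · intro x
      apply Units.ext
      rw [mkGL_val, pc_apply, toGL_val]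
      simp [M, polU_val (f x).isUnit]
    · intro x hx t
      apply Units.ext
      rw [mkGL_val]
      simp only [M, hf x hx, Units.val_one, pol_one, ← add_smul]
      push_cast
      simp

/-- unitary and general linear homotopy groups agree -/
def AU (S : Set X) : A S (Matrix.unitaryGroup ι ℂ) ≃* A S (GL ι ℂ) :=
  MulEquiv.ofBijective (Amap toGL toGL_continuous S) (by
    constructor
    · rw [injective_iff_map_eq_one]
      intro a
      induction a using QuotientGroup.induction_on with
      | H f =>
        intro hf
        exact A_eq_one.2 (U_Nul (A_eq_one.1 hf))
    · intro a
      induction a using QuotientGroup.induction_on with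
      | H f =>
        obtain ⟨g, hg, h⟩ := U_surj f.2
        refine ⟨QuotientGroup.mk ⟨g, hg⟩, ?_⟩
        rw [Amap_mk, A_eq]
        exact h.symm)

theorem AU_mk (S : Set X) (f : C(X, Matrix.unitaryGroup ι ℂ)) (hf : f ∈ Lp S _) :
    AU S (QuotientGroup.mk ⟨f, hf⟩) = QuotientGroup.mk ⟨pc toGL toGL_continuous f, pc_Lp _ _ hf⟩ := rfl

end polar2
end
end BP
end Part13

section Part14
open Matrix Kronecker Topology
namespace BP
set_option linter.unusedSectionVars false
set_option linter.unusedSimpArgs false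
noncomputable section
open unitInterval

section frame
variable {k l : ℕ}

/-- big unitary group -/
abbrev UG (k l : ℕ) := Matrix.unitaryGroup (Fin k × Fin l) ℂ
/-- small unitary group -/
abbrev VG (l : ℕ) := Matrix.unitaryGroup (Fin l) ℂ

theorem kron_unitary (k : ℕ) (B : VG l) : (1 : Matrix (Fin k) (Fin k) ℂ) ⊗ₖ (B : Matrix (Fin l) (Fin l) ℂ) ∈
    Matrix.unitaryGroup (Fin k × Fin l) ℂ := by
  rw [Matrix.mem_unitaryGroup_iff, Matrix.star_eq_conjTranspose, Matrix.conjTranspose_kronecker,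
    ← Matrix.mul_kronecker_mul, Matrix.conjTranspose_one, Matrix.one_mul]
  have : (B : Matrix (Fin l) (Fin l) ℂ) * (B : Matrix (Fin l) (Fin l) ℂ)ᴴ = 1 := Matrix.mem_unitaryGroup_iff.1 B.2
  rw [this, Matrix.one_kronecker_one]

/-- the subgroup inclusion -/
def del (k l : ℕ) : VG l →* UG k l where
  toFun B := ⟨(1 : Matrix (Fin k) (Fin k) ℂ) ⊗ₖ (B : Matrix (Fin l) (Fin l) ℂ), kron_unitary k B⟩
  map_one' := Subtype.ext (by simp)
  map_mul' B C := Subtype.ext (by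
    change _ = (1 ⊗ₖ (B : Matrix (Fin l) (Fin l) ℂ)) * (1 ⊗ₖ (C : Matrix (Fin l) (Fin l) ℂ))
    rw [← Matrix.mul_kronecker_mul, Matrix.one_mul]
    rfl)

theorem del_val (B : VG l) : (del k l B : Matrix (Fin k × Fin l) (Fin k × Fin l) ℂ) =
    (1 : Matrix (Fin k) (Fin k) ℂ) ⊗ₖ (B : Matrix (Fin l) (Fin l) ℂ) := rfl

theorem del_continuous : Continuous (del k l) := by
  refine Continuous.subtype_mk ?_ _
  refine continuous_matrix ?_
  rintro ⟨a, i⟩ ⟨b, j⟩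
  simp only [Matrix.kroneckerMap_apply]
  exact continuous_const.mul (continuous_subtype_val.matrix_elem i j)

/-- quotient map -/
def qF (k l : ℕ) : C(UG k l, FrU k l) := ⟨fun X => Quot.mk _ X, continuous_quot_mk⟩

theorem qF_eq {X Y : UG k l} : qF k l X = qF k l Y ↔ ∃ B : VG l, Y = X * del k l B := by
  have hrel : ∀ X Y : UG k l, frameCosetRel k l X Y ↔ ∃ B : VG l, Y = X * del k l B := by
    intro X Y
    constructor
    · rintro ⟨B, hB, h⟩
      exact ⟨⟨B, hB⟩, Subtype.ext h⟩
    · rintro ⟨B, h⟩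
      exact ⟨B, B.2, by rw [h]; rfl⟩
  have heq : Equivalence (frameCosetRel k l) := by
    refine ⟨fun X => (hrel _ _).2 ⟨1, by simp⟩, ?_, ?_⟩
    · intro X Y h
      obtain ⟨B, rfl⟩ := (hrel _ _).1 h
      exact (hrel _ _).2 ⟨B⁻¹, by rw [mul_assoc, ← map_mul]; simp⟩
    · intro X Y Z h h'
      obtain ⟨B, rfl⟩ := (hrel _ _).1 h
      obtain ⟨C, rfl⟩ := (hrel _ _).1 h'
      exact (hrel _ _).2 ⟨B * C, by rw [mul_assoc, ← map_mul]⟩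
  rw [← hrel]
  constructor
  · intro h
    exact heq.eqvGen_iff.1 (Quot.eqvGen_exact h)
  · intro h
    exact Quot.sound h

theorem qF_del (X : UG k l) (B : VG l) : qF k l (X * del k l B) = qF k l X := (qF_eq.2 ⟨B, rfl⟩).symm

theorem qF_one : qF k l 1 = FrU.pt k l := rfl

theorem qF_surj : Function.Surjective (qF k l) := fun b => Quot.inductionOn b fun X => ⟨X, rfl⟩

theorem qF_open : IsOpenQuotientMap (qF k l) := by
  refine ⟨qF_surj, (qF k l).continuous, ?_⟩
  intro O hO
  have hq : IsQuotientMap (qF k l) := isQuotientMap_quot_mk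
  rw [← hq.isOpen_preimage]
  have : qF k l ⁻¹' (qF k l '' O) = ⋃ B : VG l, (fun X : UG k l => X * del k l B) ⁻¹' O := by
    ext Y
    simp only [Set.mem_preimage, Set.mem_image, Set.mem_iUnion]
    constructor
    · rintro ⟨X, hX, h⟩
      obtain ⟨B, rfl⟩ := qF_eq.1 h
      refine ⟨B⁻¹, ?_⟩
      rwa [mul_assoc, ← map_mul, mul_inv_cancel, map_one, mul_one]
    · rintro ⟨B, hB⟩
      exact ⟨_, hB, qF_del _ _⟩
  rw [this]
  exact isOpen_iUnion fun B => hO.preimage (by fun_prop)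

/-- averaged diagonal block -/
def EE (M : Matrix (Fin k × Fin l) (Fin k × Fin l) ℂ) : Matrix (Fin l) (Fin l) ℂ :=
  (k : ℂ)⁻¹ • ∑ a : Fin k, Matrix.of fun i j => M (a, i) (a, j)

theorem EE_continuous : Continuous (EE : Matrix (Fin k × Fin l) (Fin k × Fin l) ℂ → _) := by
  unfold EE
  have hid : Continuous fun M : Matrix (Fin k × Fin l) (Fin k × Fin l) ℂ => M := continuous_id
  have h1 : ∀ a : Fin k, Continuous fun M : Matrix (Fin k × Fin l) (Fin k × Fin l) ℂ =>
      (Matrix.of fun i j => M (a, i) (a, j) : Matrix (Fin l) (Fin l) ℂ) := fun a =>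
    continuous_matrix fun i j => hid.matrix_elem (a, i) (a, j)
  have h2 : Continuous fun M : Matrix (Fin k × Fin l) (Fin k × Fin l) ℂ =>
      ∑ a : Fin k, (Matrix.of fun i j => M (a, i) (a, j) : Matrix (Fin l) (Fin l) ℂ) :=
    continuous_finsetSum _ fun a _ => h1 a
  exact h2.const_smul ((k : ℂ)⁻¹)

theorem EE_kron (hk : 1 < k) (B : Matrix (Fin l) (Fin l) ℂ) : EE ((1 : Matrix (Fin k) (Fin k) ℂ) ⊗ₖ B) = B := by
  have hk0 : (k : ℂ) ≠ 0 := by exact_mod_cast (by omega : k ≠ 0)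
  ext i j
  simp [EE, Matrix.sum_apply, hk0]

theorem EE_mul (B C : Matrix (Fin l) (Fin l) ℂ) (M : Matrix (Fin k × Fin l) (Fin k × Fin l) ℂ) :
    EE (((1 : Matrix (Fin k) (Fin k) ℂ) ⊗ₖ B) * M * ((1 : Matrix (Fin k) (Fin k) ℂ) ⊗ₖ C)) = B * EE M * C := by
  unfold EE
  rw [Matrix.mul_smul, Matrix.smul_mul, Matrix.mul_sum, Matrix.sum_mul]
  congr 1
  refine Finset.sum_congr rfl fun a _ => ?_
  ext i j
  simp only [Matrix.of_apply, Matrix.mul_apply, Fintype.sum_prod_type, Matrix.kroneckerMap_apply, Matrix.one_apply]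
  rw [Finset.sum_eq_single a (by
    intro b _ hb
    simp [hb]) (by simp)]
  refine Finset.sum_congr rfl fun x _ => ?_
  rw [Finset.sum_eq_single a (by
    intro b _ hb
    simp [hb.symm]) (by simp)]
  simp

/-- local cross section -/
def Sg (X Y : UG k l) : UG k l := Y * (del k l (polU (EE (X⁻¹ * Y : UG k l).1)))⁻¹ * X⁻¹

theorem EE_conj (X Y : UG k l) (B C : VG l) :
    EE (((X * del k l B)⁻¹ * (Y * del k l C) : UG k l) : Matrix (Fin k × Fin l) (Fin k × Fin l) ℂ) =
      ((B⁻¹ : VG l) : Matrix (Fin l) (Fin l) ℂ) * EE (X⁻¹ * Y : UG k l).1 * (C : Matrix (Fin l) (Fin l) ℂ) := by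
  rw [← EE_mul]
  congr 1
  have : (X * del k l B)⁻¹ * (Y * del k l C) = del k l B⁻¹ * (X⁻¹ * Y) * del k l C := by
    rw [map_inv]; group
  rw [this]
  rfl

theorem polU_conj {M : Matrix (Fin l) (Fin l) ℂ} (hM : IsUnit M) (B C : VG l) :
    polU ((B : Matrix (Fin l) (Fin l) ℂ) * M * (C : Matrix (Fin l) (Fin l) ℂ)) = B * polU M * C := by
  apply Subtype.ext
  rw [polU_val (((U_isUnit B).mul hM).mul (U_isUnit C)), pol_mul_right C.2, pol_mul_left B.2]
  change _ = (B : Matrix (Fin l) (Fin l) ℂ) * (polU M : Matrix (Fin l) (Fin l) ℂ) * (C : Matrix (Fin l) (Fin l) ℂ)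
  rw [polU_val hM]

theorem EE_conj_unit {X Y : UG k l} (h : IsUnit (EE (X⁻¹ * Y : UG k l).1)) (B C : VG l) :
    IsUnit (EE ((X * del k l B)⁻¹ * (Y * del k l C) : UG k l).1) := by
  rw [EE_conj]
  exact ((U_isUnit _).mul h).mul (U_isUnit C)

theorem Sg_conj {X Y : UG k l} (h : IsUnit (EE (X⁻¹ * Y : UG k l).1)) (B C : VG l) :
    Sg (X * del k l B) (Y * del k l C) = Sg X Y := by
  unfold Sg
  rw [EE_conj, polU_conj h]
  simp only [map_mul, map_inv]
  group

theorem Sg_self (hk : 1 < k) (X : UG k l) : Sg X X = 1 := by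
  have h : EE (1 : UG k l).1 = 1 := by
    have := EE_kron hk (1 : Matrix (Fin l) (Fin l) ℂ)
    rwa [Matrix.one_kronecker_one] at this
  unfold Sg
  rw [inv_mul_cancel, h]
  have : polU (1 : Matrix (Fin l) (Fin l) ℂ) = 1 := polU_of 1
  rw [this]
  simp

/-- good pairs -/
def OO (k l : ℕ) : Set (UG k l × UG k l) := {p | IsUnit (EE (p.1⁻¹ * p.2 : UG k l).1)}

theorem OO_cont : Continuous fun p : UG k l × UG k l => EE (p.1⁻¹ * p.2 : UG k l).1 :=
  EE_continuous.comp (continuous_subtype_val.comp (by fun_prop))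

theorem OO_open : IsOpen (OO k l) := by
  have : OO k l = (fun p : UG k l × UG k l => (EE (p.1⁻¹ * p.2 : UG k l).1).det) ⁻¹' {0}ᶜ := by
    ext p
    simp [OO, Matrix.isUnit_iff_isUnit_det]
  rw [this]
  exact isOpen_compl_singleton.preimage (OO_cont.matrix_det)

theorem Sg_cont : ContinuousOn (fun p : UG k l × UG k l => Sg p.1 p.2) (OO k l) := by
  unfold Sg
  have h1 : ContinuousOn (fun p : UG k l × UG k l => polU (EE (p.1⁻¹ * p.2 : UG k l).1)) (OO k l) :=
    continuousOn_polU OO_cont.continuousOn (fun w hw => hw)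
  have h2 := (del_continuous (k := k) (l := l)).comp_continuousOn h1
  exact (continuous_snd.continuousOn.mul h2.inv).mul continuous_fst.inv.continuousOn

theorem fr_transport (hk : 1 < k) {X : Type} [TopologicalSpace X] [CompactSpace X] (h : C(X × I, FrU k l)) :
    ∃ g : C(X × I, UG k l), (∀ x, g (x, 0) = 1) ∧
      (∀ x t Z, qF k l Z = h (x, 0) → qF k l (g (x, t) * Z) = h (x, t)) ∧
      ∀ x, (∀ t, h (x, t) = h (x, 0)) → ∀ t, g (x, t) = 1 := by
  let Q : UG k l × UG k l → FrU k l × FrU k l := Prod.map (qF k l) (qF k l)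
  have hQ : IsOpenQuotientMap Q :=
    ⟨qF_surj.prodMap qF_surj, (qF k l).continuous.prodMap (qF k l).continuous, qF_open.isOpenMap.prodMap qF_open.isOpenMap⟩
  let o : FrU k l → UG k l := Function.surjInv qF_surj
  have ho : ∀ b, qF k l (o b) = b := Function.surjInv_eq qF_surj
  let sg : FrU k l × FrU k l → UG k l := fun p => Sg (o p.1) (o p.2)
  have key : ∀ p ∈ OO k l, sg (Q p) = Sg p.1 p.2 := by
    rintro ⟨Y, Z⟩ hp
    obtain ⟨B, hB⟩ := qF_eq.1 (ho (qF k l Y)).symm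
    obtain ⟨C, hC⟩ := qF_eq.1 (ho (qF k l Z)).symm
    change Sg (o (qF k l Y)) (o (qF k l Z)) = Sg Y Z
    rw [hB, hC]
    exact Sg_conj hp B C
  refine transport (fun g b b' => ∀ Z, qF k l Z = b → qF k l (g * Z) = b') ?_ ?_ (Q '' OO k l)
    (hQ.isOpenMap _ OO_open) ?_ sg ?_ ?_ ?_ h
  · intro b Z hZ
    rw [one_mul, hZ]
  · intro g g' b b' b'' h1 h2 Z hZ
    rw [mul_assoc]
    exact h2 _ (h1 Z hZ)
  · intro b
    refine ⟨(o b, o b), ?_, by simp [Q, ho]⟩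
    have h : EE (1 : UG k l).1 = 1 := by
      have := EE_kron hk (1 : Matrix (Fin l) (Fin l) ℂ)
      rwa [Matrix.one_kronecker_one] at this
    change IsUnit (EE ((o b)⁻¹ * o b : UG k l).1)
    rw [inv_mul_cancel, h]
    exact isUnit_one
  · rintro _ ⟨p, hp, rfl⟩
    apply ContinuousAt.continuousWithinAt
    rw [← hQ.continuousAt_comp_iff]
    have := Sg_cont.continuousAt (OO_open.mem_nhds hp)
    refine this.congr ?_
    filter_upwards [OO_open.mem_nhds hp] with p hp
    exact (key p hp).symm
  · intro b
    exact Sg_self hk _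
  · rintro _ ⟨p, hp, rfl⟩ Z hZ
    rw [key p hp]
    have hZ : qF k l Z = qF k l p.1 := hZ
    change _ = qF k l p.2
    obtain ⟨B, hB⟩ := qF_eq.1 hZ.symm
    rw [hB, Sg]
    have : p.2 * (del k l (polU (EE (p.1⁻¹ * p.2 : UG k l).1)))⁻¹ * p.1⁻¹ * (p.1 * del k l B) =
      p.2 * del k l ((polU (EE (p.1⁻¹ * p.2 : UG k l).1))⁻¹ * B) := by
        rw [map_mul, map_inv]; group
    rw [this, qF_del]

theorem del_lift (hk : 1 < k) {X : Type} [TopologicalSpace X] (f : C(X, UG k l)) (h : ∀ x, qF k l (f x) = FrU.pt k l) :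
    ∃ B : C(X, VG l), f = pc (del k l) del_continuous B := by
  have h1 : ∀ x, ∃ B : VG l, f x = del k l B := by
    intro x
    obtain ⟨B, hB⟩ := qF_eq.1 ((qF_one (k := k) (l := l)).trans (h x).symm)
    exact ⟨B, by rw [hB, one_mul]⟩
  choose B hB using h1
  have hB2 : ∀ x, (B x : Matrix (Fin l) (Fin l) ℂ) = EE (f x).1 := by
    intro x
    rw [hB x, del_val, EE_kron hk]
  refine ⟨⟨B, ?_⟩, ?_⟩
  · rw [Topology.IsInducing.subtypeVal.continuous_iff]
    have hE : Continuous fun x => EE (f x).1 := EE_continuous.comp (continuous_subtype_val.comp f.continuous)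
    exact hE.congr (fun x => (hB2 x).symm)
  · ext1 x
    exact hB x

theorem del_inj (hk : 1 < k) : Function.Injective (del k l) := by
  intro B C h
  apply Subtype.ext
  have := congrArg (fun X : UG k l => EE X.1) h
  simpa only [del_val, EE_kron hk] using this

end frame
end
end BP
end Part14

section Part15
open Matrix Kronecker Topology
namespace BP
set_option linter.unusedSectionVars false
set_option linter.unusedSimpArgs false
noncomputable section
open unitInterval
open scoped Topology.Homotopy

section delta
variable {k l : ℕ} {X : Type} [TopologicalSpace X]

/-- block embedding -/
def eb (l : ℕ) (a : Fin k) : Fin l ↪ Fin k × Fin l := ⟨fun i => (a, i), fun i j h => (Prod.ext_iff.1 h).2⟩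

theorem eb_apply (a : Fin k) (i : Fin l) : eb l a i = (a, i) := rfl

/-- coordinate projection -/
def Pj (s : Finset (Fin k)) : Matrix (Fin k) (Fin k) ℂ := Matrix.diagonal fun b => if b ∈ s then 1 else 0

/-- block matrices -/
def KD (P : Matrix (Fin k) (Fin k) ℂ) (g : Matrix (Fin l) (Fin l) ℂ) : Matrix (Fin k × Fin l) (Fin k × Fin l) ℂ :=
  P ⊗ₖ g + (1 - P) ⊗ₖ (1 : Matrix (Fin l) (Fin l) ℂ)

theorem KD_mul {P Q : Matrix (Fin k) (Fin k) ℂ} (h : P * Q = 0) (g : Matrix (Fin l) (Fin l) ℂ) :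
    KD P g * KD Q g = KD (P + Q) g := by
  have h1 : P * (1 - Q) = P := by rw [Matrix.mul_sub, h, Matrix.mul_one, sub_zero]
  have h2 : (1 - P) * Q = Q := by rw [Matrix.sub_mul, h, Matrix.one_mul, sub_zero]
  have h3 : (1 - P) * (1 - Q) = 1 - (P + Q) := by
    rw [Matrix.sub_mul, h1, Matrix.one_mul]; abel
  unfold KD
  rw [Matrix.add_mul, Matrix.mul_add, Matrix.mul_add, ← Matrix.mul_kronecker_mul, ← Matrix.mul_kronecker_mul,
    ← Matrix.mul_kronecker_mul, ← Matrix.mul_kronecker_mul, h, h1, h2, h3, Matrix.mul_one, Matrix.one_mul,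
    Matrix.one_mul, Matrix.add_kronecker, Matrix.zero_kronecker]
  abel

theorem extM_eb (a : Fin k) (g : Matrix (Fin l) (Fin l) ℂ) : extM (eb l a) g = KD (Pj {a}) g := by
  ext ⟨b, i⟩ ⟨c, j⟩
  by_cases hb : b = a
  · subst hb
    by_cases hc : c = b
    · subst hc
      have := extM_apply (eb l c) g i j
      rw [eb_apply, eb_apply] at this
      rw [this]
      simp [KD, Pj, Matrix.kroneckerMap_apply]
    · rw [extM_apply_right _ _ _ _ (by
        intro i' h
        rw [eb_apply] at h
        exact hc (Prod.ext_iff.1 h).1)]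
      have hc' : b ≠ c := fun h => hc h.symm
      simp [KD, Pj, Matrix.kroneckerMap_apply, Matrix.diagonal_apply, Matrix.one_apply, hc']
  · rw [extM_apply_left _ _ _ _ (by
        intro i' h
        rw [eb_apply] at h
        exact hb (Prod.ext_iff.1 h).1)]
    by_cases hc : b = c
    · subst hc
      simp [KD, Pj, Matrix.kroneckerMap_apply, Matrix.diagonal_apply, Matrix.one_apply, hb]
    · simp [KD, Pj, Matrix.kroneckerMap_apply, Matrix.diagonal_apply, Matrix.one_apply, hc]

theorem Pj_insert {a : Fin k} {s : Finset (Fin k)} (ha : a ∉ s) : Pj (insert a s) = Pj s + Pj {a} := by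
  unfold Pj
  rw [Matrix.diagonal_add]
  congr 1
  ext b
  by_cases hb : b = a
  · subst hb; simp [ha]
  · simp [hb]

theorem Pj_mul {a : Fin k} {s : Finset (Fin k)} (ha : a ∉ s) : Pj s * Pj {a} = 0 := by
  unfold Pj
  rw [Matrix.diagonal_mul_diagonal, ← Matrix.diagonal_zero]
  congr 1
  ext b
  by_cases hb : b = a
  · subst hb; simp [ha]
  · simp [hb]

theorem pow_Ht {G : Type} [Group G] [TopologicalSpace G] [IsTopologicalGroup G] {S : Set X} {f g : C(X, G)}
    (h : Ht S f g) (n : ℕ) : Ht S (f ^ n) (g ^ n) := by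
  induction n with
  | zero => simpa using Ht.refl S 1
  | succ n ih => rw [pow_succ, pow_succ]; exact ih.mul h

theorem KD_family {S : Set X} (f : C(X, GL (Fin l) ℂ)) (hf : f ∈ Lp S (GL (Fin l) ℂ)) (a₀ : Fin k) (s : Finset (Fin k)) :
    ∃ F : C(X, GL (Fin k × Fin l) ℂ), (∀ x, ((F x : GL (Fin k × Fin l) ℂ) : Matrix (Fin k × Fin l) (Fin k × Fin l) ℂ) =
      KD (Pj s) ((f x : GL (Fin l) ℂ) : Matrix (Fin l) (Fin l) ℂ)) ∧ Ht S F ((pe (eb l a₀) f) ^ s.card) := by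
  induction s using Finset.induction_on with
  | empty =>
    refine ⟨1, ?_, by simpa using Ht.refl S 1⟩
    intro x
    simp [KD, Pj]
  | insert a s ha ih =>
    obtain ⟨F, h1, h2⟩ := ih
    refine ⟨F * pe (eb l a) f, ?_, ?_⟩
    · intro x
      rw [ContinuousMap.mul_apply, Units.val_mul, h1, pe_apply, ext_val, extM_eb, KD_mul (Pj_mul ha), Pj_insert ha]
    · rw [Finset.card_insert_of_notMem ha, pow_succ]
      exact h2.mul (pe_indep _ _ hf)

theorem Pj_univ : Pj (Finset.univ : Finset (Fin k)) = 1 := by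
  simp [Pj]

theorem del_pow {S : Set X} (B : C(X, VG l)) (hB : B ∈ Lp S (VG l)) (a₀ : Fin k) :
    Ht S (pc toGL toGL_continuous (pc (del k l) del_continuous B))
      ((pe (eb l a₀) (pc toGL toGL_continuous B)) ^ k) := by
  obtain ⟨F, h1, h2⟩ := KD_family (k := k) (pc toGL toGL_continuous B) (pc_Lp _ _ hB) a₀ Finset.univ
  have : pc toGL toGL_continuous (pc (del k l) del_continuous B) = F := by
    ext1 x
    apply Units.ext
    rw [h1, Pj_univ]
    simp [KD, toGL_val, del_val]
  rw [this]
  simpa using h2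

/-- abstract version -/
theorem del_A {S : Set X} (B : C(X, VG l)) (hB : B ∈ Lp S (VG l)) (a₀ : Fin k) :
    AU S (QuotientGroup.mk ⟨pc (del k l) del_continuous B, pc_Lp _ _ hB⟩) =
      (Amap (ext (eb l a₀)) (ext_continuous _) S (AU S (QuotientGroup.mk ⟨B, hB⟩))) ^ k := by
  rw [AU_mk, AU_mk, Amap_mk, ← QuotientGroup.mk_pow, A_eq]
  exact del_pow B hB a₀

end delta

section lifting
variable {k l : ℕ}

theorem lift_lemma (hk : 1 < k) (s : ℕ) (p : Ω^ (Fin (s + 1)) (FrU k l) (FrU.pt k l)) :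
    ∃ B ∈ Lp (bC s) (VG l), pc (del k l) del_continuous B ∈ Nul (bC s) (UG k l) ∧
      (B ∈ Nul (bC s) (VG l) → ∃ F ∈ Lp (bC (s + 1)) (UG k l), ∀ x, qF k l (F x) = p x) := by
  let h : C((Fin s → I) × I, FrU k l) := p.1.comp ⟨(spl s).symm, (spl s).symm.continuous⟩
  have hh : ∀ w, h w = p ((spl s).symm w) := fun _ => rfl
  have hbd : ∀ w ∈ bd (bC s), h w = FrU.pt k l := by
    intro w hw
    refine p.2 _ ?_
    refine (spl_bd s _).2 ?_
    change spl s ((spl s).symm w) ∈ _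
    rwa [Homeomorph.apply_symm_apply]
  have hb0 : ∀ x, h (x, 0) = FrU.pt k l := fun x => hbd _ (Or.inr (Or.inl rfl))
  have hb1 : ∀ x, h (x, 1) = FrU.pt k l := fun x => hbd _ (Or.inr (Or.inr rfl))
  have hbS : ∀ x ∈ bC s, ∀ t, h (x, t) = FrU.pt k l := fun x hx t => hbd _ (Or.inl hx)
  obtain ⟨g, g0, gq, gS⟩ := fr_transport hk h
  have gq' : ∀ x t, qF k l (g (x, t)) = h (x, t) := by
    intro x t
    have := gq x t 1 (by rw [hb0]; rfl)
    rwa [mul_one] at this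
  have gS' : ∀ x ∈ bC s, ∀ t, g (x, t) = 1 := fun x hx => gS x (fun t => by rw [hbS x hx, hb0])
  obtain ⟨B, hB⟩ := del_lift hk ⟨fun x => g (x, 1), by fun_prop⟩ (fun x => by
    change qF k l (g (x, 1)) = _
    rw [gq', hb1])
  have hB' : ∀ x, g (x, 1) = del k l (B x) := fun x => congrArg (fun f : C(_, _) => f x) hB
  refine ⟨B, ?_, ⟨g, g0, fun x => hB' x, gS'⟩, ?_⟩
  · intro x hx
    apply del_inj hk
    rw [← hB', gS' x hx, map_one]
  · rintro ⟨C, c0, c1, cS⟩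
    let G : C((Fin s → I) × I, UG k l) := g * (pc (del k l) del_continuous C)⁻¹
    have hG : ∀ w, G w = g w * (del k l (C w))⁻¹ := fun _ => rfl
    refine ⟨G.comp ⟨spl s, (spl s).continuous⟩, ?_, ?_⟩
    · intro x hx
      rw [spl_bd] at hx
      change G (spl s x) = 1
      generalize spl s x = w at hx
      obtain ⟨y, t⟩ := w
      rcases hx with hx | hx | hx
      · rw [hG, gS' y hx, cS y hx]; simp
      · simp only at hx; subst hx; rw [hG, g0, c0]; simp
      · simp only at hx; subst hx; rw [hG, hB', c1]; simp
    · intro x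
      change qF k l (G (spl s x)) = p x
      rw [hG, ← map_inv, qF_del]
      have := gq' (spl s x).1 (spl s x).2
      rw [Prod.mk.eta, hh, Homeomorph.symm_apply_apply] at this
      exact this

/-- projection of a based family -/
def qL {m : ℕ} (F : C(Fin m → I, UG k l)) (hF : F ∈ Lp (bC m) (UG k l)) : Ω^ (Fin m) (FrU k l) (FrU.pt k l) :=
  ⟨(qF k l).comp F, fun y hy => by
    change qF k l (F y) = _
    rw [hF y hy]; rfl⟩

theorem qL_apply {m : ℕ} (F : C(Fin m → I, UG k l)) (hF : F ∈ Lp (bC m) (UG k l)) (x : Fin m → I) :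
    qL F hF x = qF k l (F x) := rfl

theorem qL_homotopic {m : ℕ} {F F' : C(Fin m → I, UG k l)} (hF : F ∈ Lp (bC m) (UG k l)) (hF' : F' ∈ Lp (bC m) (UG k l))
    (h : Ht (bC m) F F') : GenLoop.Homotopic (qL F hF) (qL F' hF') := by
  obtain ⟨K, k0, k1, kS⟩ := h.exists_homotopy
  refine ⟨⟨⟨⟨fun w => qF k l (K (w.2, w.1)), by fun_prop⟩, ?_, ?_⟩, ?_⟩⟩
  · intro x
    change qF k l (K (x, 0)) = _
    rw [k0]; rfl
  · intro x
    change qF k l (K (x, 1)) = _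
    rw [k1]; rfl
  · intro t x hx
    change qF k l (K (x, t)) = qF k l (F x)
    rw [kS x hx]

theorem inj_del (hk : 1 < k) (m : ℕ) (hl : m + 1 ≤ 2 * l) (e : A (bC m) (GL (Fin l) ℂ) ≃* Multiplicative ℤ)
    {B : C(Fin m → I, VG l)} (hB : B ∈ Lp (bC m) (VG l))
    (h : pc (del k l) del_continuous B ∈ Nul (bC m) (UG k l)) : B ∈ Nul (bC m) (VG l) := by
  have a₀ : Fin k := ⟨0, by omega⟩
  have h1 := del_A B hB a₀
  rw [A_eq_one.2 h, map_one, ← map_pow, eq_comm] at h1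
  have h2 := (injective_iff_map_eq_one _).1 (stab_iso_inj m (eb l a₀) (by simpa using hl)) _ h1
  have h3 := congrArg e h2
  rw [map_pow, map_one] at h3
  have h4 : k * (e (AU (bC m) (QuotientGroup.mk ⟨B, hB⟩))).toAdd = 0 := by
    have := congrArg Multiplicative.toAdd h3
    simpa using this
  have h5 : (e (AU (bC m) (QuotientGroup.mk ⟨B, hB⟩))).toAdd = 0 := by
    rcases mul_eq_zero.1 h4 with h | h
    · omega
    · exact h
  have h6 : e (AU (bC m) (QuotientGroup.mk ⟨B, hB⟩)) = 1 := h5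
  rw [map_eq_one_iff e e.injective] at h6
  have h7 := (AU (ι := Fin l) (bC m)).injective (h6.trans (map_one (AU (ι := Fin l) (bC m))).symm)
  exact A_eq_one.1 h7

theorem even_case (hk : 1 < k) (r : ℕ) (hr : 1 ≤ r) (hl : r ≤ l) :
    Subsingleton (HomotopyGroup (Fin (2 * r)) (FrU k l) (FrU.pt k l)) := by
  obtain ⟨s, hs⟩ : ∃ s, 2 * r = s + 1 := ⟨2 * r - 1, by omega⟩
  have hcard : r + 1 ≤ Fintype.card (Fin k × Fin l) := by
    simp only [Fintype.card_prod, Fintype.card_fin]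
    nlinarith
  have hsub := pi_even r (Fin k × Fin l) hcard
  obtain ⟨r', rfl⟩ : ∃ r', r = r' + 1 := ⟨r - 1, by omega⟩
  obtain rfl : s = 2 * r' + 1 := by omega
  obtain ⟨e⟩ := pi_odd r' (Fin l) (by simpa using hl)
  rw [hs] at hsub ⊢
  have hsub' : Subsingleton (A (bC (2 * r' + 1 + 1)) (UG k l)) := (AU _).toEquiv.subsingleton
  rw [A_subsingleton] at hsub'
  refine subsingleton_of_forall_eq (Quotient.mk _ GenLoop.const) ?_
  intro a
  induction a using Quotient.inductionOn with
  | h p =>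
    apply Quotient.sound
    obtain ⟨B, hB, h1, h2⟩ := lift_lemma hk (2 * r' + 1) p
    obtain ⟨F, hF, hp⟩ := h2 (inj_del hk _ (by omega) e hB h1)
    have := qL_homotopic hF (Lp _ _).one_mem (Ht.iff_one.2 (hsub' hF))
    have e1 : qL F hF = p := by
      ext1 x
      exact hp x
    have e2 : qL (1 : C(_, UG k l)) (Lp (bC (2 * r' + 1 + 1)) _).one_mem = GenLoop.const := by
      ext1 x
      rfl
    rw [e1, e2] at this
    exact this

end lifting
end
end BP
end Part15

section Part16
open Matrix Kronecker Topology
namespace BP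
set_option linter.unusedSectionVars false
set_option linter.unusedSimpArgs false
noncomputable section
open unitInterval
open scoped Topology.Homotopy

section reparam
variable {m : ℕ}

/-- reparametrisation of one coordinate -/
def rpm (i : Fin m) (φ : C(I, I)) : C(Fin m → I, Fin m → I) :=
  ⟨fun x => Function.update x i (φ (x i)), by fun_prop⟩

theorem rpm_bd {i : Fin m} {x : Fin m → I} (hx : x ∈ bC m) {v : I} (h0 : x i = 0 → v = 0) (h1 : x i = 1 → v = 1) :
    Function.update x i v ∈ bC m := by
  obtain ⟨j, hj⟩ := hx
  refine ⟨j, ?_⟩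
  by_cases hji : j = i
  · subst hji
    rw [Function.update_self]
    rcases hj with hj | hj
    · exact Or.inl (h0 hj)
    · exact Or.inr (h1 hj)
  · rwa [Function.update_of_ne hji]

theorem rpm_Ht {G : Type} [Group G] [TopologicalSpace G] [IsTopologicalGroup G] (i : Fin m) (φ : C(I, I))
    (h0 : φ 0 = 0) (h1 : φ 1 = 1) {F : C(Fin m → I, G)} (hF : F ∈ Lp (bC m) G) :
    Ht (bC m) F (F.comp (rpm i φ)) := by
  let w : C((Fin m → I) × I, I) := ⟨fun p => Set.projIcc (0 : ℝ) 1 zero_le_one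
    ((1 - (p.2 : ℝ)) * (p.1 i : ℝ) + (p.2 : ℝ) * (φ (p.1 i) : ℝ)), by
      have : Continuous fun p : (Fin m → I) × I => φ (p.1 i) := by fun_prop
      fun_prop⟩
  have hw : ∀ p, w p = Set.projIcc (0 : ℝ) 1 zero_le_one
    ((1 - (p.2 : ℝ)) * (p.1 i : ℝ) + (p.2 : ℝ) * (φ (p.1 i) : ℝ)) := fun _ => rfl
  refine Ht.of_homotopy ⟨fun p => F (Function.update p.1 i (w p)), by fun_prop⟩ ?_ ?_ ?_
  · intro x
    change F (Function.update x i (w (x, 0))) = F x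
    rw [hw]
    simp
  · intro x
    change F (Function.update x i (w (x, 1))) = F (Function.update x i (φ (x i)))
    rw [hw]
    simp
  · intro x hx t
    change F (Function.update x i (w (x, t))) = F x
    rw [hF x hx]
    refine hF _ (rpm_bd hx ?_ ?_)
    · intro h
      rw [hw]
      simp [h, h0]
    · intro h
      rw [hw]
      simp [h, h1]

/-- first half -/
def ph1 : C(I, I) := ⟨fun t => Set.projIcc (0 : ℝ) 1 zero_le_one (2 * t), by fun_prop⟩
/-- second half -/
def ph2 : C(I, I) := ⟨fun t => Set.projIcc (0 : ℝ) 1 zero_le_one (2 * t - 1), by fun_prop⟩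

theorem ph1_apply (t : I) : ph1 t = Set.projIcc (0 : ℝ) 1 zero_le_one (2 * t) := rfl
theorem ph2_apply (t : I) : ph2 t = Set.projIcc (0 : ℝ) 1 zero_le_one (2 * t - 1) := rfl

theorem ph1_zero : ph1 0 = 0 := by simp [ph1_apply]
theorem ph1_of_ge {t : I} (h : 1 / 2 ≤ (t : ℝ)) : ph1 t = 1 := by
  rw [ph1_apply]
  exact Set.projIcc_of_right_le _ (by linarith)
theorem ph2_of_le {t : I} (h : (t : ℝ) ≤ 1 / 2) : ph2 t = 0 := by
  rw [ph2_apply]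
  exact Set.projIcc_of_le_left _ (by linarith)
theorem ph1_one : ph1 1 = 1 := ph1_of_ge (by norm_num)
theorem ph2_zero : ph2 0 = 0 := ph2_of_le (by norm_num)
theorem ph2_one : ph2 1 = 1 := by
  rw [ph2_apply]
  exact Set.projIcc_of_right_le _ (by norm_num)

end reparam

section odd
variable {k l : ℕ} {m : ℕ}

theorem rpm_Lp (i : Fin m) (φ : C(I, I)) (h0 : φ 0 = 0) (h1 : φ 1 = 1) {F : C(Fin m → I, UG k l)}
    (hF : F ∈ Lp (bC m) (UG k l)) : F.comp (rpm i φ) ∈ Lp (bC m) (UG k l) := by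
  intro x hx
  exact hF _ (rpm_bd hx (fun h => by rw [h, h0]) (fun h => by rw [h, h1]))

theorem qL_mul (i : Fin m) {F G : C(Fin m → I, UG k l)} (hF : F ∈ Lp (bC m) (UG k l)) (hG : G ∈ Lp (bC m) (UG k l)) :
    GenLoop.Homotopic (qL (F * G) ((Lp _ _).mul_mem hF hG)) (GenLoop.transAt i (qL G hG) (qL F hF)) := by
  have hF' := rpm_Lp i ph2 ph2_zero ph2_one hF
  have hG' := rpm_Lp i ph1 ph1_zero ph1_one hG
  have h := qL_homotopic ((Lp _ _).mul_mem hF hG) ((Lp _ _).mul_mem hF' hG')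
    ((rpm_Ht i ph2 ph2_zero ph2_one hF).mul (rpm_Ht i ph1 ph1_zero ph1_one hG))
  have e : qL (F.comp (rpm i ph2) * G.comp (rpm i ph1)) ((Lp _ _).mul_mem hF' hG') =
      GenLoop.transAt i (qL G hG) (qL F hF) := by
    ext1 x
    change qF k l (F (Function.update x i (ph2 (x i))) * G (Function.update x i (ph1 (x i)))) =
      if (x i : ℝ) ≤ 1 / 2 then qF k l (G (Function.update x i (ph1 (x i))))
        else qF k l (F (Function.update x i (ph2 (x i))))
    split_ifs with hx
    · rw [hF (Function.update x i (ph2 (x i))) ⟨i, Or.inl (by rw [Function.update_self, ph2_of_le hx])⟩, one_mul]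
    · rw [hG (Function.update x i (ph1 (x i))) ⟨i, Or.inr (by
        rw [Function.update_self, ph1_of_ge (le_of_not_ge hx)])⟩, mul_one]
  rwa [e] at h

/-- the projection homomorphism -/
def Psi (k l m : ℕ) [Nonempty (Fin m)] : Lp (bC m) (UG k l) →* HomotopyGroup (Fin m) (FrU k l) (FrU.pt k l) :=
  MonoidHom.mk' (fun F => (Quotient.mk _ (qL F.1 F.2) : HomotopyGroup (Fin m) (FrU k l) (FrU.pt k l))) (by
    intro F G
    refine Eq.trans ?_ (HomotopyGroup.mul_spec (i := Classical.arbitrary (Fin m)) (p := qL F.1 F.2) (q := qL G.1 G.2)).symm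
    apply Quotient.sound
    exact qL_mul _ F.2 G.2)

theorem Psi_apply [Nonempty (Fin m)] (F : Lp (bC m) (UG k l)) :
    Psi k l m F = (Quotient.mk _ (qL F.1 F.2) : HomotopyGroup (Fin m) (FrU k l) (FrU.pt k l)) := rfl

theorem Psi_surj (hk : 1 < k) (r : ℕ) (hr : r + 1 ≤ l) : Function.Surjective (Psi k l (2 * r + 1)) := by
  have hsub := pi_even r (Fin l) (by simpa using hr)
  have hsub' : Subsingleton (A (bC (2 * r)) (VG l)) := (AU _).toEquiv.subsingleton
  rw [A_subsingleton] at hsub'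
  intro a
  induction a using Quotient.inductionOn with
  | h p =>
    obtain ⟨B, hB, h1, h2⟩ := lift_lemma hk (2 * r) p
    obtain ⟨F, hF, hp⟩ := h2 (hsub' hB)
    refine ⟨⟨F, hF⟩, ?_⟩
    have e1 : qL F hF = p := by
      ext1 x
      exact hp x
    rw [Psi_apply, e1]

theorem Psi_ker (hk : 1 < k) [Nonempty (Fin m)] (F : Lp (bC m) (UG k l)) :
    Psi k l m F = 1 ↔ ∃ B ∈ Lp (bC m) (VG l), Ht (bC m) (F : C(Fin m → I, UG k l)) (pc (del k l) del_continuous B) := by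
  rw [HomotopyGroup.one_def, Psi_apply]
  constructor
  · intro h
    have h' : GenLoop.Homotopic (qL F.1 F.2) GenLoop.const := Quotient.exact h
    obtain ⟨H⟩ := h'.symm
    let h : C((Fin m → I) × I, FrU k l) := ⟨fun w => H (w.2, w.1), by fun_prop⟩
    have hh : ∀ x t, h (x, t) = H (t, x) := fun _ _ => rfl
    have hb0 : ∀ x, h (x, 0) = FrU.pt k l := fun x => by rw [hh, H.apply_zero]; rfl
    have hb1 : ∀ x, h (x, 1) = qF k l (F.1 x) := fun x => by rw [hh, H.apply_one]; rfl
    have hbS : ∀ x ∈ bC m, ∀ t, h (x, t) = FrU.pt k l := fun x hx t => by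
      rw [hh, H.eq_fst t hx]; rfl
    obtain ⟨g, g0, gq, gS⟩ := fr_transport hk h
    have gq' : ∀ x t, qF k l (g (x, t)) = h (x, t) := by
      intro x t
      have := gq x t 1 (by rw [hb0]; rfl)
      rwa [mul_one] at this
    have gS' : ∀ x ∈ bC m, ∀ t, g (x, t) = 1 := fun x hx => gS x (fun t => by rw [hbS x hx, hb0])
    let g1 : C(Fin m → I, UG k l) := ⟨fun x => g (x, 1), by fun_prop⟩
    have hg1 : g1 ∈ Nul (bC m) (UG k l) := ⟨g, g0, fun x => rfl, gS'⟩
    obtain ⟨B, hB⟩ := del_lift hk (g1⁻¹ * F.1) (fun x => by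
      obtain ⟨b, hb⟩ := qF_eq.1 ((gq' x 1).trans (hb1 x))
      change qF k l ((g (x, 1))⁻¹ * F.1 x) = _
      rw [hb, inv_mul_cancel_left, ← one_mul (del k l b), qF_del]
      rfl)
    have hB' : ∀ x, (g (x, 1))⁻¹ * F.1 x = del k l (B x) := fun x => congrArg (fun f : C(_, _) => f x) hB
    refine ⟨B, ?_, ?_⟩
    · intro x hx
      apply del_inj hk
      rw [← hB', gS' x hx, F.2 x hx, map_one, inv_one, one_mul]
    · rw [← hB]
      have h2 : Ht (bC m) g1⁻¹ 1 := Ht.iff_one.2 ((Nul _ _).inv_mem hg1)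
      have := (h2.mul (Ht.refl (bC m) F.1)).symm
      rwa [one_mul] at this
  · rintro ⟨B, hB, h⟩
    apply Quotient.sound
    have := qL_homotopic F.2 (pc_Lp _ _ hB) h
    have e : qL (pc (del k l) del_continuous B) (pc_Lp _ _ hB) = GenLoop.const := by
      ext1 x
      change qF k l (del k l (B x)) = FrU.pt k l
      rw [← one_mul (del k l (B x)), qF_del]
      rfl
    rw [e] at this
    exact this

theorem ker_pow (hk : 1 < k) (hm : m ≤ 2 * l) [Nonempty (Fin m)] (F : Lp (bC m) (UG k l)) :
    Psi k l m F = 1 ↔ ∃ b : A (bC m) (GL (Fin k × Fin l) ℂ), AU (bC m) (QuotientGroup.mk F) = b ^ k := by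
  have a₀ : Fin k := ⟨0, by omega⟩
  rw [Psi_ker hk]
  constructor
  · rintro ⟨B, hB, h⟩
    refine ⟨_, Eq.trans ?_ (del_A B hB a₀)⟩
    congr 1
    exact A_eq.2 h
  · rintro ⟨b, hb⟩
    induction b using QuotientGroup.induction_on with
    | H f =>
      obtain ⟨g, hg, h1⟩ := stab_surj (DimLE_cube m) (eb l a₀) (by simpa using hm) f.2
      obtain ⟨c, hc⟩ := (AU (ι := Fin l) (bC m)).surjective (QuotientGroup.mk ⟨g, hg⟩)
      induction c using QuotientGroup.induction_on with
      | H B =>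
        refine ⟨B.1, B.2, ?_⟩
        have h2 := del_A B.1 B.2 a₀
        have h3 : (QuotientGroup.mk f : A (bC m) (GL (Fin k × Fin l) ℂ)) =
            Amap (ext (eb l a₀)) (ext_continuous _) (bC m) (QuotientGroup.mk ⟨g, hg⟩) := A_eq.2 h1
        have h4 : AU (bC m) (QuotientGroup.mk ⟨B.1, B.2⟩) = (QuotientGroup.mk ⟨g, hg⟩ : A (bC m) (GL (Fin l) ℂ)) := hc
        rw [h4, ← h3, ← hb] at h2
        have h5 := (AU (ι := Fin k × Fin l) (bC m)).injective h2
        have h6 := A_eq.1 h5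
        exact h6.symm

/-- reduction mod k -/
def redk (k : ℕ) : Multiplicative ℤ →* Multiplicative (ZMod k) :=
  AddMonoidHom.toMultiplicative (Int.castAddHom (ZMod k))

theorem redk_surj (k : ℕ) : Function.Surjective (redk k) := fun a => by
  obtain ⟨n, hn⟩ := ZMod.intCast_surjective (Multiplicative.toAdd a)
  exact ⟨Multiplicative.ofAdd n, congrArg Multiplicative.ofAdd hn⟩

theorem redk_ker (k : ℕ) (a : Multiplicative ℤ) : redk k a = 1 ↔ ∃ b, a = b ^ k := by
  have : redk k a = 1 ↔ ((Multiplicative.toAdd a : ℤ) : ZMod k) = 0 := Iff.rfl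
  rw [this, ZMod.intCast_zmod_eq_zero_iff_dvd]
  constructor
  · rintro ⟨c, hc⟩
    refine ⟨Multiplicative.ofAdd c, Multiplicative.toAdd.injective ?_⟩
    rw [toAdd_pow, toAdd_ofAdd, hc, nsmul_eq_mul]
  · rintro ⟨b, rfl⟩
    refine ⟨Multiplicative.toAdd b, ?_⟩
    rw [toAdd_pow, nsmul_eq_mul]

theorem odd_case (hk : 1 < k) (r : ℕ) (hr : r + 1 ≤ l) :
    Nonempty (HomotopyGroup (Fin (2 * r + 1)) (FrU k l) (FrU.pt k l) ≃* Multiplicative (ZMod k)) := by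
  obtain ⟨e⟩ := pi_odd r (Fin k × Fin l) (by
    simp only [Fintype.card_prod, Fintype.card_fin]
    nlinarith)
  let Phi : Lp (bC (2 * r + 1)) (UG k l) →* Multiplicative (ZMod k) :=
    (redk k).comp ((e.toMonoidHom.comp (AU (bC (2 * r + 1))).toMonoidHom).comp (QuotientGroup.mk' _))
  have hPhi : ∀ F, Phi F = redk k (e (AU (bC (2 * r + 1)) (QuotientGroup.mk F))) := fun _ => rfl
  have hsurj : Function.Surjective Phi := by
    intro a
    obtain ⟨z, rfl⟩ := redk_surj k a
    obtain ⟨y, rfl⟩ := e.surjective z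
    obtain ⟨x, rfl⟩ := (AU (ι := Fin k × Fin l) (bC (2 * r + 1))).surjective y
    obtain ⟨F, rfl⟩ := QuotientGroup.mk_surjective x
    exact ⟨F, rfl⟩
  have hker : (Psi k l (2 * r + 1)).ker = Phi.ker := by
    ext F
    rw [MonoidHom.mem_ker, MonoidHom.mem_ker, ker_pow hk (by omega), hPhi, redk_ker]
    constructor
    · rintro ⟨b, hb⟩
      exact ⟨e b, by rw [hb, map_pow]⟩
    · rintro ⟨b, hb⟩
      refine ⟨e.symm b, e.injective ?_⟩
      rw [hb, map_pow, MulEquiv.apply_symm_apply]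
  exact ⟨((QuotientGroup.quotientKerEquivOfSurjective _ (Psi_surj hk r hr)).symm.trans
    (QuotientGroup.quotientMulEquivOfEq hker)).trans (QuotientGroup.quotientKerEquivOfSurjective _ hsurj)⟩

end odd
end
end BP
end Part16

/-- For 1 ≤ r ≤ l, the homotopy group π_{2r}(Fr^U_{k,l}) is trivial and
π_{2r-1}(Fr^U_{k,l}) ≅ ℤ/kℤ. -/
theorem stmt_2 (k l : ℕ) (hk : 1 < k) (hl : 1 < l) :
    ∀ r : ℕ, (hr : 1 ≤ r) → r ≤ l →
      (Nonempty (HomotopyGroup (Fin (2 * r)) (FrU k l) (FrU.pt k l)) ∧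
        Subsingleton (HomotopyGroup (Fin (2 * r)) (FrU k l) (FrU.pt k l))) ∧
      (letI : Nonempty (Fin (2 * r - 1)) := ⟨⟨0, by omega⟩⟩
       Nonempty (HomotopyGroup (Fin (2 * r - 1)) (FrU k l) (FrU.pt k l) ≃*
         Multiplicative (ZMod k))) := by
  intro r hr hrl
  refine ⟨⟨⟨Quotient.mk _ GenLoop.const⟩, BP.even_case hk r hr hrl⟩, ?_⟩
  have key : ∀ (m : ℕ) (inst : Nonempty (Fin m)), m = 2 * (r - 1) + 1 →
      Nonempty (HomotopyGroup (Fin m) (FrU k l) (FrU.pt k l) ≃* Multiplicative (ZMod k)) := by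
    rintro m inst rfl
    exact BP.odd_case hk (r - 1) (by omega)
  exact key _ _ (by omega)
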